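/- Assume k is algebraically closed. For V, W ∈ rep_{Q*(n)}(d*): (a) every element of S̃(d*) that lies in Zcl(K·η(V)·P(d*)) is of the form η(V') for some V' ∈ rep_{Q*(n)}(d*); (b) Zcl(K·η(V)·P(d*)) ∩ S̃(d*) ⊆ Zcl(K·η(W)·P(d*)) if and only if f(V) ≤ f(W) for every f ∈ D_n; (c) (K·η(V)·P(d*)) ∩ S̃(d*) = (K·η(W)·P(d*)) ∩ S̃(d*) if and only if f(V) = f(W) for every f ∈ D_n. -/

import Mathlib

open Matrix

/-! Statement 12: the embedding `η : rep_{Q*(n)}(d*) → S(d*) ⊆ K\GL(a+b)` and the group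
embedding `θ : GL(d*) → P(d*) ≤ GL(a+b)`.

Dimension data: `dx i = d*(x_i)` for `0 ≤ i ≤ n`, `dy0 = d*(y₀)`, `dy0' = d*(y₀')`,
`dy i = d*(y_{i+1})` for `0 ≤ i ≤ n-1`. -/

/-- Partial sums `psum f m = f 0 + ⋯ + f (m-1)`. -/
def psum (f : ℕ → ℕ) (m : ℕ) : ℕ := ∑ i ∈ Finset.range m, f i

/-- `d*_x`, the total dimension over the `x`-vertices. -/
def dXt (dx : ℕ → ℕ) (n : ℕ) : ℕ := psum dx (n + 1)

/-- `d*_y`, the total dimension over the vertices `y₁, …, y_n`. -/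
def dYt (dy : ℕ → ℕ) (n : ℕ) : ℕ := psum dy n

/-- `a = d*(y₀) + d*_y + d*_x`. -/
def aD (n : ℕ) (dx dy : ℕ → ℕ) (dy0 : ℕ) : ℕ := dy0 + dYt dy n + dXt dx n

/-- `a + b`. -/
def NN (n : ℕ) (dx dy : ℕ → ℕ) (dy0 dy0' : ℕ) : ℕ :=
  aD n dx dy dy0 + (dy0' + dYt dy n + dXt dx n)

abbrev inBlk (off len i : ℕ) : Prop := off ≤ i ∧ i < off + len

abbrev Jpos (roff coff len i j : ℕ) : Prop :=
  inBlk roff len i ∧ inBlk coff len j ∧ (i - roff) + (j - coff) = len - 1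

abbrev Ipos (roff coff len i j : ℕ) : Prop :=
  inBlk roff len i ∧ inBlk coff len j ∧ i - roff = j - coff

/-- A representation of the quiver `Q*(n)`: `vb0 = V_{β₀}`, `va1 = V_{α₁}`,
`va1' = V_{α₁'}`, `vb i = V_{β_{i+1}}` (for `0 ≤ i ≤ n-1`) and `va i = V_{α_{i+2}}`
(for `0 ≤ i ≤ n-2`). -/
structure QRep (k : Type) [Field k] (n : ℕ) (dx dy : ℕ → ℕ) (dy0 dy0' : ℕ) where
  vb0 : Matrix (Fin dy0) (Fin (dx 0)) k
  va1 : Matrix (Fin dy0) (Fin (dx 1)) k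
  va1' : Matrix (Fin dy0') (Fin (dx 1)) k
  vb : ∀ i : Fin n, Matrix (Fin (dy (i : ℕ))) (Fin (dx ((i : ℕ) + 1))) k
  va : ∀ i : Fin (n - 1), Matrix (Fin (dy (i : ℕ))) (Fin (dx ((i : ℕ) + 2))) k

/-- The entry of the zig-zag matrix `A_V` (block rows `y₀, y₁, …, y_n`, block columns
`x₀, …, x_n`; nonzero blocks `(y₀,x₀) = V_{β₀}`, `(y_{i−1},x_i) = V_{α_i}`,
`(y_i,x_i) = V_{β_i}`) at the global position `(p, c)`. -/
def Aent {k : Type} [Field k] {n : ℕ} {dx dy : ℕ → ℕ} {dy0 dy0' : ℕ}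
    (V : QRep k n dx dy dy0 dy0') (p c : ℕ) : k :=
  (if h : p < dy0 ∧ c < dx 0 then V.vb0 ⟨p, h.1⟩ ⟨c, h.2⟩ else 0) +
  (if h : p < dy0 ∧ psum dx 1 ≤ c ∧ c < psum dx 2 then
      V.va1 ⟨p, h.1⟩ ⟨c - psum dx 1, by
        have hs : psum dx 2 = psum dx 1 + dx 1 := Finset.sum_range_succ dx 1
        omega⟩
    else 0) +
  (∑ i : Fin n,
    if h : dy0 + psum dy (i : ℕ) ≤ p ∧ p < dy0 + psum dy ((i : ℕ) + 1) ∧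
        psum dx ((i : ℕ) + 1) ≤ c ∧ c < psum dx ((i : ℕ) + 2) then
      V.vb i
        ⟨p - (dy0 + psum dy (i : ℕ)), by
          have hs : psum dy ((i : ℕ) + 1) = psum dy (i : ℕ) + dy (i : ℕ) :=
            Finset.sum_range_succ dy (i : ℕ)
          omega⟩
        ⟨c - psum dx ((i : ℕ) + 1), by
          have hs : psum dx ((i : ℕ) + 2) = psum dx ((i : ℕ) + 1) + dx ((i : ℕ) + 1) :=
            Finset.sum_range_succ dx ((i : ℕ) + 1)
          omega⟩
    else 0) +
  (∑ i : Fin (n - 1),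
    if h : dy0 + psum dy (i : ℕ) ≤ p ∧ p < dy0 + psum dy ((i : ℕ) + 1) ∧
        psum dx ((i : ℕ) + 2) ≤ c ∧ c < psum dx ((i : ℕ) + 3) then
      V.va i
        ⟨p - (dy0 + psum dy (i : ℕ)), by
          have hs : psum dy ((i : ℕ) + 1) = psum dy (i : ℕ) + dy (i : ℕ) :=
            Finset.sum_range_succ dy (i : ℕ)
          omega⟩
        ⟨c - psum dx ((i : ℕ) + 2), by
          have hs : psum dx ((i : ℕ) + 3) = psum dx ((i : ℕ) + 2) + dx ((i : ℕ) + 2) :=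
            Finset.sum_range_succ dx ((i : ℕ) + 2)
          omega⟩
    else 0)

/-- The entry of `B'_V = [0 B_V]` (block rows `y₀', y₁, …, y_n`, block columns
`x₀, x₁, …, x_n` with the `x₀` column block zero; nonzero blocks `(y₀',x₁) = V_{α₁'}`,
`(y_{i−1},x_i) = V_{α_i}` for `i ≥ 2`, `(y_i,x_i) = V_{β_i}`) at `(p, c)`. -/
def Bent {k : Type} [Field k] {n : ℕ} {dx dy : ℕ → ℕ} {dy0 dy0' : ℕ}
    (V : QRep k n dx dy dy0 dy0') (p c : ℕ) : k :=
  (if h : p < dy0' ∧ psum dx 1 ≤ c ∧ c < psum dx 2 then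
      V.va1' ⟨p, h.1⟩ ⟨c - psum dx 1, by
        have hs : psum dx 2 = psum dx 1 + dx 1 := Finset.sum_range_succ dx 1
        omega⟩
    else 0) +
  (∑ i : Fin n,
    if h : dy0' + psum dy (i : ℕ) ≤ p ∧ p < dy0' + psum dy ((i : ℕ) + 1) ∧
        psum dx ((i : ℕ) + 1) ≤ c ∧ c < psum dx ((i : ℕ) + 2) then
      V.vb i
        ⟨p - (dy0' + psum dy (i : ℕ)), by
          have hs : psum dy ((i : ℕ) + 1) = psum dy (i : ℕ) + dy (i : ℕ) :=
            Finset.sum_range_succ dy (i : ℕ)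
          omega⟩
        ⟨c - psum dx ((i : ℕ) + 1), by
          have hs : psum dx ((i : ℕ) + 2) = psum dx ((i : ℕ) + 1) + dx ((i : ℕ) + 1) :=
            Finset.sum_range_succ dx ((i : ℕ) + 1)
          omega⟩
    else 0) +
  (∑ i : Fin (n - 1),
    if h : dy0' + psum dy (i : ℕ) ≤ p ∧ p < dy0' + psum dy ((i : ℕ) + 1) ∧
        psum dx ((i : ℕ) + 2) ≤ c ∧ c < psum dx ((i : ℕ) + 3) then
      V.va i
        ⟨p - (dy0' + psum dy (i : ℕ)), by
          have hs : psum dy ((i : ℕ) + 1) = psum dy (i : ℕ) + dy (i : ℕ) :=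
            Finset.sum_range_succ dy (i : ℕ)
          omega⟩
        ⟨c - psum dx ((i : ℕ) + 2), by
          have hs : psum dx ((i : ℕ) + 3) = psum dx ((i : ℕ) + 2) + dx ((i : ℕ) + 2) :=
            Finset.sum_range_succ dx ((i : ℕ) + 2)
          omega⟩
    else 0)

/-- The matrix `η(V)`: block row sizes `(d*(y₀), d*_y, d*_x, d*(y₀'), d*_y, d*_x)`,
block column sizes `(d*_x, d*_x, d*_y, d*(y₀), d*(y₀'), d*_y)`; block rows 1–2 of block
column 2 form `A_V`, block rows 4–5 of block column 2 form `B'_V`, and the other nonzero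
blocks are `(1,4)=J`, `(2,3)=J`, `(3,1)=J`, `(4,5)=1`, `(5,3)=J`, `(5,6)=1`, `(6,1)=J`,
`(6,2)=1`. -/
def etaMat {k : Type} [Field k] {n : ℕ} {dx dy : ℕ → ℕ} {dy0 dy0' : ℕ}
    (V : QRep k n dx dy dy0 dy0') :
    Matrix (Fin (NN n dx dy dy0 dy0')) (Fin (NN n dx dy dy0 dy0')) k :=
  Matrix.of fun i c =>
    if (i : ℕ) < dy0 + dYt dy n ∧ dXt dx n ≤ (c : ℕ) ∧ (c : ℕ) < 2 * dXt dx n then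
      Aent V (i : ℕ) ((c : ℕ) - dXt dx n)
    else if aD n dx dy dy0 ≤ (i : ℕ) ∧ (i : ℕ) < aD n dx dy dy0 + dy0' + dYt dy n ∧
        dXt dx n ≤ (c : ℕ) ∧ (c : ℕ) < 2 * dXt dx n then
      Bent V ((i : ℕ) - aD n dx dy dy0) ((c : ℕ) - dXt dx n)
    else if
      Jpos 0 (2 * dXt dx n + dYt dy n) dy0 (i : ℕ) (c : ℕ) ∨
      Jpos dy0 (2 * dXt dx n) (dYt dy n) (i : ℕ) (c : ℕ) ∨
      Jpos (dy0 + dYt dy n) 0 (dXt dx n) (i : ℕ) (c : ℕ) ∨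
      Ipos (aD n dx dy dy0) (2 * dXt dx n + dYt dy n + dy0) dy0' (i : ℕ) (c : ℕ) ∨
      Jpos (aD n dx dy dy0 + dy0') (2 * dXt dx n) (dYt dy n) (i : ℕ) (c : ℕ) ∨
      Ipos (aD n dx dy dy0 + dy0') (2 * dXt dx n + dYt dy n + dy0 + dy0') (dYt dy n)
        (i : ℕ) (c : ℕ) ∨
      Jpos (aD n dx dy dy0 + dy0' + dYt dy n) 0 (dXt dx n) (i : ℕ) (c : ℕ) ∨
      Ipos (aD n dx dy dy0 + dy0' + dYt dy n) (dXt dx n) (dXt dx n) (i : ℕ) (c : ℕ)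
    then 1 else 0

/-- The subgroup `K = diag(GL(a), GL(b)) ≤ GL(a+b)` as a set of matrices. -/
def kDiag (k : Type) [Field k] (n : ℕ) (dx dy : ℕ → ℕ) (dy0 dy0' : ℕ) :
    Set (Matrix (Fin (NN n dx dy dy0 dy0')) (Fin (NN n dx dy dy0 dy0')) k) :=
  {g | IsUnit g ∧ ∀ i c : Fin (NN n dx dy dy0 dy0'),
    (((i : ℕ) < aD n dx dy dy0 ∧ aD n dx dy dy0 ≤ (c : ℕ)) ∨
      (aD n dx dy dy0 ≤ (i : ℕ) ∧ (c : ℕ) < aD n dx dy dy0)) → g i c = 0}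

/-- `x` is a boundary of the column partition of `a + b` into consecutive blocks of
sizes `d*(x_n), …, d*(x₀), d*(x₀), …, d*(x_n), d*(y_n), …, d*(y₁), d*(y₀)+d*(y₀'),
d*(y₁), …, d*(y_n)`. -/
def isCut (n : ℕ) (dx dy : ℕ → ℕ) (dy0 dy0' : ℕ) (x : ℕ) : Prop :=
  (∃ m ≤ n + 1, x = dXt dx n - psum dx m) ∨
  (∃ m ≤ n + 1, x = dXt dx n + psum dx m) ∨
  (∃ m ≤ n, x = 2 * dXt dx n + dYt dy n - psum dy m) ∨
  x = 2 * dXt dx n + dYt dy n + dy0 + dy0' ∨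
  (∃ m ≤ n, x = 2 * dXt dx n + dYt dy n + dy0 + dy0' + psum dy m)

/-- The parabolic subgroup `P(d*)` of block upper triangular invertible matrices for the
above partition. -/
def pPara (k : Type) [Field k] (n : ℕ) (dx dy : ℕ → ℕ) (dy0 dy0' : ℕ) :
    Set (Matrix (Fin (NN n dx dy dy0 dy0')) (Fin (NN n dx dy dy0 dy0')) k) :=
  {g | IsUnit g ∧ ∀ i c : Fin (NN n dx dy dy0 dy0'),
    (∃ x : ℕ, isCut n dx dy dy0 dy0' x ∧ (c : ℕ) < x ∧ x ≤ (i : ℕ)) → g i c = 0}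

/-- The orbit `K·g·P(d*)` as a set of matrices. -/
def orbitKP (k : Type) [Field k] (n : ℕ) (dx dy : ℕ → ℕ) (dy0 dy0' : ℕ)
    (g : Matrix (Fin (NN n dx dy dy0 dy0')) (Fin (NN n dx dy dy0 dy0')) k) :
    Set (Matrix (Fin (NN n dx dy dy0 dy0')) (Fin (NN n dx dy dy0 dy0')) k) :=
  {x | ∃ κ ∈ kDiag k n dx dy dy0 dy0', ∃ π ∈ pPara k n dx dy dy0 dy0', x = κ * g * π}

/-- The Zariski closure of a set of `N × N` matrices. -/
def Zcl {k : Type} [Field k] {N : ℕ} (T : Set (Matrix (Fin N) (Fin N) k)) :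
    Set (Matrix (Fin N) (Fin N) k) :=
  {x | ∀ f : MvPolynomial (Fin N × Fin N) k,
    (∀ y ∈ T, MvPolynomial.eval (fun pr => y pr.1 pr.2) f = 0) →
    MvPolynomial.eval (fun pr => x pr.1 pr.2) f = 0}

/-- The zero representation. -/
def zeroRep (k : Type) [Field k] (n : ℕ) (dx dy : ℕ → ℕ) (dy0 dy0' : ℕ) :
    QRep k n dx dy dy0 dy0' :=
  ⟨0, 0, 0, fun _ => 0, fun _ => 0⟩

/-- The slice `S̃(d*)`: matrices of the same shape as the `η(V)`, but with the `A_V` and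
`B'_V` regions (block rows 1–2 and 4–5 of block column 2) arbitrary. -/
def sTildeD (k : Type) [Field k] (n : ℕ) (dx dy : ℕ → ℕ) (dy0 dy0' : ℕ) :
    Set (Matrix (Fin (NN n dx dy dy0 dy0')) (Fin (NN n dx dy dy0 dy0')) k) :=
  {m | ∀ i c : Fin (NN n dx dy dy0 dy0'),
    ¬ ((((i : ℕ) < dy0 + dYt dy n) ∨
         (aD n dx dy dy0 ≤ (i : ℕ) ∧ (i : ℕ) < aD n dx dy dy0 + dy0' + dYt dy n)) ∧
        dXt dx n ≤ (c : ℕ) ∧ (c : ℕ) < 2 * dXt dx n) →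
    m i c = etaMat (zeroRep k n dx dy dy0 dy0') i c}

/-- Like `Aent`, but with `V_{β₀}` replaced by the zero matrix (used for `⟦α₁,δ⟧⁰`). -/
def Aent0 {k : Type} [Field k] {n : ℕ} {dx dy : ℕ → ℕ} {dy0 dy0' : ℕ}
    (V : QRep k n dx dy dy0 dy0') (p c : ℕ) : k :=
  (if h : p < dy0 ∧ psum dx 1 ≤ c ∧ c < psum dx 2 then
      V.va1 ⟨p, h.1⟩ ⟨c - psum dx 1, by
        have hs : psum dx 2 = psum dx 1 + dx 1 := Finset.sum_range_succ dx 1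
        omega⟩
    else 0) +
  (∑ i : Fin n,
    if h : dy0 + psum dy (i : ℕ) ≤ p ∧ p < dy0 + psum dy ((i : ℕ) + 1) ∧
        psum dx ((i : ℕ) + 1) ≤ c ∧ c < psum dx ((i : ℕ) + 2) then
      V.vb i
        ⟨p - (dy0 + psum dy (i : ℕ)), by
          have hs : psum dy ((i : ℕ) + 1) = psum dy (i : ℕ) + dy (i : ℕ) :=
            Finset.sum_range_succ dy (i : ℕ)
          omega⟩
        ⟨c - psum dx ((i : ℕ) + 1), by
          have hs : psum dx ((i : ℕ) + 2) = psum dx ((i : ℕ) + 1) + dx ((i : ℕ) + 1) :=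
            Finset.sum_range_succ dx ((i : ℕ) + 1)
          omega⟩
    else 0) +
  (∑ i : Fin (n - 1),
    if h : dy0 + psum dy (i : ℕ) ≤ p ∧ p < dy0 + psum dy ((i : ℕ) + 1) ∧
        psum dx ((i : ℕ) + 2) ≤ c ∧ c < psum dx ((i : ℕ) + 3) then
      V.va i
        ⟨p - (dy0 + psum dy (i : ℕ)), by
          have hs : psum dy ((i : ℕ) + 1) = psum dy (i : ℕ) + dy (i : ℕ) :=
            Finset.sum_range_succ dy (i : ℕ)
          omega⟩
        ⟨c - psum dx ((i : ℕ) + 2), by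
          have hs : psum dx ((i : ℕ) + 3) = psum dx ((i : ℕ) + 2) + dx ((i : ℕ) + 2) :=
            Finset.sum_range_succ dx ((i : ℕ) + 2)
          omega⟩
    else 0)

/-- `Yoff i` = row offset of the block row `y_i` in `A_V` (rows `y₀, y₁, …, y_n`).
With `dy0'` in place of `dy0` it is the row offset of `y_i` in `B_V`
(rows `y₀', y₁, …, y_n`). -/
def Yoff (dy : ℕ → ℕ) (dy0 : ℕ) (i : ℕ) : ℕ := if i = 0 then 0 else dy0 + psum dy (i - 1)

/-- The rank of the rectangular submatrix of `A_V` with block rows `y_{r₁}, …, y_{r₂}`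
and block columns `x_{c₁}, …, x_{c₂}`; for arrows `γ ≤ δ` of the first chain this
computes `|γ,δ|(V) = rank [γ,δ]_V`. -/
noncomputable def rkA {k : Type} [Field k] {n : ℕ} {dx dy : ℕ → ℕ} {dy0 dy0' : ℕ}
    (V : QRep k n dx dy dy0 dy0') (r₁ r₂ c₁ c₂ : ℕ) : ℕ :=
  (Matrix.of fun (p : Fin (Yoff dy dy0 (r₂ + 1) - Yoff dy dy0 r₁))
      (q : Fin (psum dx (c₂ + 1) - psum dx c₁)) =>
    Aent V (Yoff dy dy0 r₁ + (p : ℕ)) (psum dx c₁ + (q : ℕ))).rank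

/-- The analogous rank of a rectangular submatrix of `B_V` (block rows `y₀', y₁, …`),
computing `|α₁',δ|(V)`. -/
noncomputable def rkB {k : Type} [Field k] {n : ℕ} {dx dy : ℕ → ℕ} {dy0 dy0' : ℕ}
    (V : QRep k n dx dy dy0 dy0') (r₁ r₂ c₁ c₂ : ℕ) : ℕ :=
  (Matrix.of fun (p : Fin (Yoff dy dy0' (r₂ + 1) - Yoff dy dy0' r₁))
      (q : Fin (psum dx (c₂ + 1) - psum dx c₁)) =>
    Bent V (Yoff dy dy0' r₁ + (p : ℕ)) (psum dx c₁ + (q : ℕ))).rank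

/-- `rank ⟦α₁,δ⟧_V`, for `δ` with row index `r` and column index `c`: the vertical stack
of (`A_V` on block rows `y₀..y_r`, block columns `x₀..x_c`) over (`B'_V` on block rows
`y₀'..y_r`, block columns `x₀..x_c`). -/
noncomputable def rkS {k : Type} [Field k] {n : ℕ} {dx dy : ℕ → ℕ} {dy0 dy0' : ℕ}
    (V : QRep k n dx dy dy0 dy0') (r c : ℕ) : ℕ :=
  (Matrix.of fun (p : Fin (Yoff dy dy0 (r + 1) + Yoff dy dy0' (r + 1)))
      (q : Fin (psum dx (c + 1))) =>
    if (p : ℕ) < Yoff dy dy0 (r + 1) then Aent V (p : ℕ) (q : ℕ)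
    else Bent V ((p : ℕ) - Yoff dy dy0 (r + 1)) (q : ℕ)).rank

/-- `rank ⟦α₁,δ⟧⁰_V`: as `rkS`, with `V_{β₀}` replaced by `0`. -/
noncomputable def rkS0 {k : Type} [Field k] {n : ℕ} {dx dy : ℕ → ℕ} {dy0 dy0' : ℕ}
    (V : QRep k n dx dy dy0 dy0') (r c : ℕ) : ℕ :=
  (Matrix.of fun (p : Fin (Yoff dy dy0 (r + 1) + Yoff dy dy0' (r + 1)))
      (q : Fin (psum dx (c + 1))) =>
    if (p : ℕ) < Yoff dy dy0 (r + 1) then Aent0 V (p : ℕ) (q : ℕ)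
    else Bent V ((p : ℕ) - Yoff dy dy0 (r + 1)) (q : ℕ)).rank

/-- `rank ⟦α_i,δ⟧_V` for `i ≥ 2` and `δ` with row index `r`, column index `c`: with
`A' = [β₀,δ]_V` and `B'' = [α₁',δ]_V`, the rank of
`[[A' on cols x₀..x_{i−1}, 0, A' on cols x_i..x_c], [0, B'' on cols x₁..x_{i−1}, B'' on
cols x_i..x_c]]`. -/
noncomputable def rkMA {k : Type} [Field k] {n : ℕ} {dx dy : ℕ → ℕ} {dy0 dy0' : ℕ}
    (V : QRep k n dx dy dy0 dy0') (i r c : ℕ) : ℕ :=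
  (Matrix.of fun (p : Fin (Yoff dy dy0 (r + 1) + Yoff dy dy0' (r + 1)))
      (q : Fin (psum dx i + (psum dx i - psum dx 1) + (psum dx (c + 1) - psum dx i))) =>
    if (q : ℕ) < psum dx i then
      (if (p : ℕ) < Yoff dy dy0 (r + 1) then Aent V (p : ℕ) (q : ℕ) else 0)
    else if (q : ℕ) < psum dx i + (psum dx i - psum dx 1) then
      (if Yoff dy dy0 (r + 1) ≤ (p : ℕ) then
        Bent V ((p : ℕ) - Yoff dy dy0 (r + 1)) (psum dx 1 + ((q : ℕ) - psum dx i))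
      else 0)
    else
      (if (p : ℕ) < Yoff dy dy0 (r + 1) then
        Aent V (p : ℕ) (psum dx i + ((q : ℕ) - (psum dx i + (psum dx i - psum dx 1))))
      else
        Bent V ((p : ℕ) - Yoff dy dy0 (r + 1))
          (psum dx i + ((q : ℕ) - (psum dx i + (psum dx i - psum dx 1)))))).rank

/-- `rank ⟦β_i,δ⟧_V` for `i ≥ 1` and `δ` with row index `r`, column index `c`: with
`A' = [β₀,δ]_V` and `B'' = [α₁',δ]_V`, the rank of
`[[A' on rows y₀..y_{i−1}, 0], [0, B'' on rows y₀',y₁..y_{i−1}],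
[A' on rows y_i..y_r, B'' on rows y_i..y_r]]`. -/
noncomputable def rkMB {k : Type} [Field k] {n : ℕ} {dx dy : ℕ → ℕ} {dy0 dy0' : ℕ}
    (V : QRep k n dx dy dy0 dy0') (i r c : ℕ) : ℕ :=
  (Matrix.of fun
      (p : Fin (Yoff dy dy0 i + Yoff dy dy0' i + (Yoff dy dy0 (r + 1) - Yoff dy dy0 i)))
      (q : Fin (psum dx (c + 1) + (psum dx (c + 1) - psum dx 1))) =>
    if (p : ℕ) < Yoff dy dy0 i then
      (if (q : ℕ) < psum dx (c + 1) then Aent V (p : ℕ) (q : ℕ) else 0)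
    else if (p : ℕ) < Yoff dy dy0 i + Yoff dy dy0' i then
      (if psum dx (c + 1) ≤ (q : ℕ) then
        Bent V ((p : ℕ) - Yoff dy dy0 i) (psum dx 1 + ((q : ℕ) - psum dx (c + 1)))
      else 0)
    else
      (if (q : ℕ) < psum dx (c + 1) then Aent V ((p : ℕ) - Yoff dy dy0' i) (q : ℕ)
      else Bent V ((p : ℕ) - Yoff dy dy0 i)
        (psum dx 1 + ((q : ℕ) - psum dx (c + 1))))).rank

/-- `DnRel R V W` says that `R (f V) (f W)` holds for every function `f` in the
distinguished collection `D_n` of rank functions: `|γ,δ|` for comparable `γ ≤ δ` with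
`γ ≠ α₁`, `‖γ,δ‖` for `α₁ ≤ γ ≤ δ`, and `‖α₁,δ‖⁰` for `δ ≥ α₁` (row/column indices in
the zig-zag matrices: `β_j ↦ (j,j)`, `α_j ↦ (j-1,j)`). -/
def DnRel {k : Type} [Field k] {n : ℕ} {dx dy : ℕ → ℕ} {dy0 dy0' : ℕ}
    (R : ℕ → ℕ → Prop) (V W : QRep k n dx dy dy0 dy0') : Prop :=
  -- |β₀,β₀|
  R (rkA V 0 0 0 0) (rkA W 0 0 0 0) ∧
  -- |β₀,α_j| and |β₀,β_j|, 1 ≤ j ≤ n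
  (∀ j, 1 ≤ j → j ≤ n →
    R (rkA V 0 (j - 1) 0 j) (rkA W 0 (j - 1) 0 j) ∧ R (rkA V 0 j 0 j) (rkA W 0 j 0 j)) ∧
  -- |α₁',α₁'|
  R (rkB V 0 0 1 1) (rkB W 0 0 1 1) ∧
  -- |α₁',α_j|, 2 ≤ j ≤ n
  (∀ j, 2 ≤ j → j ≤ n → R (rkB V 0 (j - 1) 1 j) (rkB W 0 (j - 1) 1 j)) ∧
  -- |α₁',β_j|, 1 ≤ j ≤ n
  (∀ j, 1 ≤ j → j ≤ n → R (rkB V 0 j 1 j) (rkB W 0 j 1 j)) ∧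
  -- |β_i,β_j|, 1 ≤ i ≤ j ≤ n
  (∀ i j, 1 ≤ i → i ≤ j → j ≤ n → R (rkA V i j i j) (rkA W i j i j)) ∧
  -- |β_i,α_j|, 1 ≤ i < j ≤ n
  (∀ i j, 1 ≤ i → i < j → j ≤ n → R (rkA V i (j - 1) i j) (rkA W i (j - 1) i j)) ∧
  -- |α_i,α_j| and |α_i,β_j|, 2 ≤ i ≤ j ≤ n
  (∀ i j, 2 ≤ i → i ≤ j → j ≤ n →
    R (rkA V (i - 1) (j - 1) i j) (rkA W (i - 1) (j - 1) i j) ∧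
    R (rkA V (i - 1) j i j) (rkA W (i - 1) j i j)) ∧
  -- ‖α₁,α_j‖, ‖α₁,β_j‖ and their ⁰-versions, 1 ≤ j ≤ n
  (∀ j, 1 ≤ j → j ≤ n →
    R (rkS V (j - 1) j) (rkS W (j - 1) j) ∧ R (rkS V j j) (rkS W j j) ∧
    R (rkS0 V (j - 1) j) (rkS0 W (j - 1) j) ∧ R (rkS0 V j j) (rkS0 W j j)) ∧
  -- ‖α_i,α_j‖ and ‖α_i,β_j‖, 2 ≤ i ≤ j ≤ n
  (∀ i j, 2 ≤ i → i ≤ j → j ≤ n →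
    R (rkMA V i (j - 1) j) (rkMA W i (j - 1) j) ∧ R (rkMA V i j j) (rkMA W i j j)) ∧
  -- ‖β_i,β_j‖, 1 ≤ i ≤ j ≤ n
  (∀ i j, 1 ≤ i → i ≤ j → j ≤ n → R (rkMB V i j j) (rkMB W i j j)) ∧
  -- ‖β_i,α_{j+1}‖, 1 ≤ i ≤ j, j + 1 ≤ n
  (∀ i j, 1 ≤ i → i ≤ j → j + 1 ≤ n → R (rkMB V i j (j + 1)) (rkMB W i j (j + 1)))


set_option linter.unusedSectionVars false
set_option linter.unusedVariables false
set_option maxHeartbeats 1000000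
namespace FC
open Submodule Module
section core
variable {k U : Type} [Field k] [AddCommGroup U] [Module k U] [FiniteDimensional k U]

noncomputable def phi (f : U →ₗ[k] U) (S Q : Submodule k U) : ℕ :=
  finrank k ↥(Submodule.map f Q ⊔ S)

def Zs (f : U →ₗ[k] U) (S G0 : Submodule k U) : Submodule k U := comap f (Submodule.map f G0 ⊔ S)

lemma le_Zs (f : U →ₗ[k] U) (S G0 : Submodule k U) : G0 ≤ Zs f S G0 := by
  intro x hx
  exact mem_sup_left (mem_map_of_mem hx)

lemma finrank_map_add_inf_ker {U' : Type} [AddCommGroup U'] [Module k U']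
    (f : U →ₗ[k] U') (p : Submodule k U) :
    finrank k ↥(Submodule.map f p) + finrank k ↥(p ⊓ LinearMap.ker f) = finrank k p := by
  have h := LinearMap.finrank_range_add_finrank_ker (f.domRestrict p)
  rw [LinearMap.range_domRestrict] at h
  have h2 : LinearMap.ker (f.domRestrict p) = comap p.subtype (LinearMap.ker f) := by
    ext x; simp
  rw [h2] at h
  have h3 : finrank k ↥(comap p.subtype (LinearMap.ker f)) = finrank k ↥(p ⊓ LinearMap.ker f) := by
    rw [← Submodule.map_comap_subtype]
    exact (Submodule.equivMapOfInjective p.subtype p.injective_subtype _).finrank_eq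
  omega

lemma finrank_sup_mkQ (p q : Submodule k U) :
    finrank k ↥(p ⊔ q) = finrank k q + finrank k ↥(Submodule.map q.mkQ p) := by
  have h := finrank_map_add_inf_ker q.mkQ (p ⊔ q)
  rw [Submodule.ker_mkQ, Submodule.map_sup, (show Submodule.map q.mkQ q = ⊥ by simp),
    sup_bot_eq, inf_eq_right.2 (le_sup_right)] at h
  omega

lemma phi_formula (f : U →ₗ[k] U) (S : Submodule k U) {G0 G2 : Submodule k U} (h : G0 ≤ G2) :
    phi f S G2 + finrank k ↥(G2 ⊓ Zs f S G0) = phi f S G0 + finrank k G2 := by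
  unfold phi
  have e : Submodule.map f G2 ⊔ S = Submodule.map f G2 ⊔ (Submodule.map f G0 ⊔ S) := by
    rw [← sup_assoc, sup_eq_left.2 (Submodule.map_mono (f := f) h)]
  rw [e, finrank_sup_mkQ]
  have h1 := finrank_map_add_inf_ker ((Submodule.map f G0 ⊔ S).mkQ ∘ₗ f) G2
  rw [LinearMap.ker_comp, ker_mkQ, Submodule.map_comp] at h1
  unfold Zs
  omega

lemma phi_mono (f : U →ₗ[k] U) (S : Submodule k U) {G0 G2 : Submodule k U} (h : G0 ≤ G2) :
    phi f S G0 ≤ phi f S G2 :=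
  finrank_mono (sup_le_sup_right (Submodule.map_mono h) _)

lemma phi_inc (f : U →ₗ[k] U) (S : Submodule k U) {G0 G2 : Submodule k U} (h : G0 ≤ G2) :
    phi f S G2 + finrank k G0 ≤ phi f S G0 + finrank k G2 := by
  have := phi_formula f S h
  have h2 : finrank k G0 ≤ finrank k ↥(G2 ⊓ Zs f S G0) := finrank_mono (le_inf h (le_Zs f S G0))
  omega

def Cmp (G2 E Z : Submodule k U) : Prop := E ≤ Z ∨ G2 ⊓ Z ≤ E

lemma phi_comp (f : U →ₗ[k] U) (S : Submodule k U) {G0 E G2 : Submodule k U}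
    (h0 : G0 ≤ E) (h2 : E ≤ G2) (d0 : finrank k E = finrank k G0 + 1)
    (d2 : finrank k G2 = finrank k G0 + 2) (hc : Cmp G2 E (Zs f S G0)) :
    phi f S E = phi f S G0 ∨ phi f S E + 1 = phi f S G2 := by
  have e1 := phi_formula f S h0
  have e2 := phi_formula f S (h0.trans h2)
  rcases hc with hc | hc
  · left
    rw [inf_eq_left.2 hc] at e1; omega
  · right
    have : E ⊓ Zs f S G0 = G2 ⊓ Zs f S G0 :=
      le_antisymm (inf_le_inf_right _ h2) (le_inf hc inf_le_right)
    rw [this] at e1; omega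

lemma exists_mid {G0 G2 : Submodule k U} (h : G0 ≤ G2) {m : ℕ}
    (d0 : finrank k G0 ≤ m) (d2 : m ≤ finrank k G2) :
    ∃ E, G0 ≤ E ∧ E ≤ G2 ∧ finrank k E = m := by
  induction m with
  | zero => exact ⟨G0, le_rfl, h, by omega⟩
  | succ m ih =>
    rcases Nat.lt_or_ge m (finrank k G0) with h1 | h1
    · exact ⟨G0, le_rfl, h, by omega⟩
    · obtain ⟨E, e0, e2, e⟩ := ih h1 (by omega)
      have hlt : E < G2 := lt_of_le_of_ne e2 (by rintro rfl; omega)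
      obtain ⟨x, hx, hxE⟩ := SetLike.exists_of_lt hlt
      refine ⟨E ⊔ span k {x}, e0.trans le_sup_left,
        sup_le e2 ((span_singleton_le_iff_mem _ _).2 hx), ?_⟩
      have hd : Disjoint E (span k {x}) := by
        rw [disjoint_span_singleton' (by rintro rfl; exact hxE (zero_mem _))]
        exact hxE
      have := Submodule.finrank_sup_add_finrank_inf_eq E (span k {x})
      rw [disjoint_iff.1 hd, finrank_bot, finrank_span_singleton
        (by rintro rfl; exact hxE (zero_mem _))] at this
      omega

lemma finrank_sup_span {E : Submodule k U} {x : U} (hxE : x ∉ E) :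
    finrank k ↥(E ⊔ span k {x}) = finrank k E + 1 := by
  have hd : Disjoint E (span k {x}) := by
    rw [disjoint_span_singleton' (by rintro rfl; exact hxE (zero_mem _))]
    exact hxE
  have := Submodule.finrank_sup_add_finrank_inf_eq E (span k {x})
  rw [disjoint_iff.1 hd, finrank_bot, finrank_span_singleton
    (by rintro rfl; exact hxE (zero_mem _))] at this
  omega

lemma chain_lemma {G0 G2 : Submodule k U} (h : G0 ≤ G2)
    (d2 : finrank k G2 = finrank k G0 + 2) (Zf : Set (Submodule k U))
    (hZ0 : ∀ Z ∈ Zf, G0 ≤ Z)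
    (hch : ∀ Z ∈ Zf, ∀ Z' ∈ Zf, G2 ⊓ Z ≤ Z' ∨ G2 ⊓ Z' ≤ Z) :
    ∃ E, G0 ≤ E ∧ E ≤ G2 ∧ finrank k E = finrank k G0 + 1 ∧ ∀ Z ∈ Zf, Cmp G2 E Z := by
  by_cases hex : ∃ Z ∈ Zf, finrank k ↥(G2 ⊓ Z) = finrank k G0 + 1
  · obtain ⟨Z, hZ, hd⟩ := hex
    refine ⟨G2 ⊓ Z, le_inf h (hZ0 Z hZ), inf_le_left, hd, fun Z' hZ' => ?_⟩
    rcases hch Z hZ Z' hZ' with h1 | h1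
    · exact Or.inl h1
    · exact Or.inr (le_inf inf_le_left h1)
  · push Not at hex
    obtain ⟨E, e0, e2, e⟩ := exists_mid h (m := finrank k G0 + 1) (by omega) (by omega)
    refine ⟨E, e0, e2, e, fun Z hZ => ?_⟩
    have h1 : G0 ≤ G2 ⊓ Z := le_inf h (hZ0 Z hZ)
    have h2 : finrank k G0 ≤ finrank k ↥(G2 ⊓ Z) := finrank_mono h1
    have h3 : finrank k ↥(G2 ⊓ Z) ≤ finrank k G2 := finrank_mono inf_le_left
    have h4 := hex Z hZ
    rcases (show finrank k ↥(G2 ⊓ Z) = finrank k G0 ∨ finrank k ↥(G2 ⊓ Z) = finrank k G2 by omega)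
      with h5 | h5
    · right
      rw [← Submodule.eq_of_le_of_finrank_eq h1 h5.symm]; exact e0
    · left
      have := Submodule.eq_of_le_of_finrank_eq (inf_le_left : G2 ⊓ Z ≤ G2) h5
      exact e2.trans (inf_eq_left.1 this)

structure Pr (T T' : U →ₗ[k] U) : Prop where
  add : ∀ x, T x + T' x = x
  tt' : ∀ x, T (T' x) = 0
  t't : ∀ x, T' (T x) = 0

lemma Pr.symm {T T' : U →ₗ[k] U} (h : Pr T T') : Pr T' T :=
  ⟨fun x => by rw [add_comm]; exact h.add x, h.t't, h.tt'⟩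

lemma Pr.idem {T T' : U →ₗ[k] U} (h : Pr T T') (x : U) : T (T x) = T x := by
  have := h.add (T x); rwa [h.t't, add_zero] at this

lemma Pr.T_mem_iff {T T' : U →ₗ[k] U} (h : Pr T T') {p : Submodule k U} {x : U} (hx : x ∈ p) :
    T x ∈ p ↔ T' x ∈ p := by
  constructor <;> intro hh
  · have : T' x = x - T x := by rw [← h.add x]; simp [h.idem, h.symm.idem, h.tt', h.t't]
    rw [this]; exact sub_mem hx hh
  · have : T x = x - T' x := by
      conv_rhs => rw [← h.add x]
      simp [h.t't, h.symm.idem]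
    rw [this]; exact sub_mem hx hh

/-- for `P ≤ Q` -/
lemma Pr.map_sup_swap {T T' : U →ₗ[k] U} (h : Pr T T') {P Q : Submodule k U} (hPQ : P ≤ Q) :
    Submodule.map T P ⊔ Q = Submodule.map T' P ⊔ Q := by
  apply le_antisymm
  · refine sup_le ?_ le_sup_right
    rintro _ ⟨x, hx, rfl⟩
    have h1 : x ∈ Submodule.map T' P ⊔ Q := mem_sup_right (hPQ hx)
    exact (h.T_mem_iff h1).2 (mem_sup_left (mem_map_of_mem hx))
  · refine sup_le ?_ le_sup_right
    rintro _ ⟨x, hx, rfl⟩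
    have h1 : x ∈ Submodule.map T P ⊔ Q := mem_sup_right (hPQ hx)
    exact (h.T_mem_iff h1).1 (mem_sup_left (mem_map_of_mem hx))

/-- for `Q ≤ P` -/
lemma Pr.map_sup_eq {T T' : U →ₗ[k] U} (h : Pr T T') {P Q : Submodule k U} (hPQ : Q ≤ P) :
    Submodule.map T P ⊔ Q = Submodule.map T P ⊔ Submodule.map T' Q := by
  apply le_antisymm
  · refine sup_le le_sup_left ?_
    intro x hx
    rw [← h.add x]
    exact add_mem (mem_sup_left (mem_map_of_mem (hPQ hx))) (mem_sup_right (mem_map_of_mem hx))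
  · refine sup_le le_sup_left ?_
    rintro _ ⟨x, hx, rfl⟩
    have h1 : x ∈ Submodule.map T P ⊔ Q := mem_sup_right hx
    exact (h.T_mem_iff h1).1 (mem_sup_left (mem_map_of_mem (hPQ hx)))

lemma Pr.finrank_sup {T T' : U →ₗ[k] U} (h : Pr T T') (P Q : Submodule k U) :
    finrank k ↥(Submodule.map T P ⊔ Submodule.map T' Q) = finrank k ↥(Submodule.map T P) + finrank k ↥(Submodule.map T' Q) := by
  have hd : Disjoint (Submodule.map T P) (Submodule.map T' Q) := by
    rw [disjoint_def]
    rintro _ ⟨x, hx, rfl⟩ ⟨y, hy, hxy⟩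
    rw [← h.idem, ← hxy, h.tt']
  have := Submodule.finrank_sup_add_finrank_inf_eq (Submodule.map T P) (Submodule.map T' Q)
  rw [disjoint_iff.1 hd, finrank_bot] at this
  omega

lemma phi_bot (f : U →ₗ[k] U) (Q : Submodule k U) : phi f ⊥ Q = finrank k ↥(Submodule.map f Q) := by
  unfold phi; rw [sup_bot_eq]

lemma Pr.phi_ge {T T' : U →ₗ[k] U} (h : Pr T T') {P Q : Submodule k U} (hPQ : Q ≤ P) :
    phi T Q P = phi T ⊥ P + phi T' ⊥ Q := by
  rw [phi_bot, phi_bot, ← h.finrank_sup, phi, h.map_sup_eq hPQ]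

lemma Pr.phi_swap {T T' : U →ₗ[k] U} (h : Pr T T') {P Q : Submodule k U} (hPQ : P ≤ Q) :
    phi T Q P = phi T' Q P := by
  rw [phi, h.map_sup_swap hPQ, phi]

lemma phi_id (T : U →ₗ[k] U) (P Q : Submodule k U) :
    phi T Q P = phi LinearMap.id (Submodule.map T P) Q := by
  rw [phi, phi, Submodule.map_id, sup_comm]

structure IsFlag (F : ℕ → Submodule k U) : Prop where
  mono : Monotone F
  dim : ∀ i ≤ finrank k U, finrank k (F i) = i

structure FLeOn (C : Set ℕ) (T T' : U →ₗ[k] U) (G F : ℕ → Submodule k U) : Prop where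
  a : ∀ i ∈ C, phi T ⊥ (G i) ≤ phi T ⊥ (F i)
  b : ∀ i ∈ C, phi T' ⊥ (G i) ≤ phi T' ⊥ (F i)
  c : ∀ i ∈ C, ∀ j ∈ C, i < j → phi T (G j) (G i) ≤ phi T (F j) (F i)

lemma FLeOn.all {C : Set ℕ} {T T' : U →ₗ[k] U} (hT : Pr T T') {G F : ℕ → Submodule k U}
    (hG : Monotone G) (hF : Monotone F) (h : FLeOn C T T' G F) {i j : ℕ} (hi : i ∈ C) (hj : j ∈ C) :
    phi T (G j) (G i) ≤ phi T (F j) (F i) := by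
  rcases Nat.lt_or_ge i j with hij | hij
  · exact h.c i hi j hj hij
  · rw [hT.phi_ge (hG hij), hT.phi_ge (hF hij)]
    exact Nat.add_le_add (h.a i hi) (h.b j hj)

lemma FLeOn.symm {C : Set ℕ} {T T' : U →ₗ[k] U} (hT : Pr T T') {G F : ℕ → Submodule k U}
    (hG : Monotone G) (hF : Monotone F) (h : FLeOn C T T' G F) : FLeOn C T' T G F :=
  ⟨h.b, h.a, fun i hi j hj hij => by
    rw [hT.symm.phi_swap (hG hij.le), hT.symm.phi_swap (hF hij.le)]; exact h.c i hi j hj hij⟩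

lemma IsFlag.update {F : ℕ → Submodule k U} (hF : IsFlag F) {t : ℕ} {E : Submodule k U}
    (h0 : F t ≤ E) (h2 : E ≤ F (t + 2)) (d : finrank k E = t + 1) :
    IsFlag (Function.update F (t + 1) E) := by
  constructor
  · intro i j hij
    by_cases hi : i = t + 1 <;> by_cases hj : j = t + 1
    · subst hi; subst hj; exact le_rfl
    · subst hi
      rw [Function.update_self, Function.update_of_ne hj]
      exact h2.trans (hF.mono (by omega))
    · subst hj
      rw [Function.update_self, Function.update_of_ne hi]
      exact (hF.mono (by omega)).trans h0
    · rw [Function.update_of_ne hi, Function.update_of_ne hj]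
      exact hF.mono hij
  · intro i hi
    by_cases h : i = t + 1
    · subst h; rw [Function.update_self]; exact d
    · rw [Function.update_of_ne h]; exact hF.dim i hi

/-- data of a tau step -/
structure Step (T T' : U →ₗ[k] U) (F : ℕ → Submodule k U) (t : ℕ) (w : U) : Prop where
  ht : t + 2 ≤ finrank k U
  ja : phi T ⊥ (F t) < phi T ⊥ (F (t+1))
  jb : phi T' ⊥ (F t) < phi T' ⊥ (F (t+1))
  nb : phi T' ⊥ (F (t+2)) = phi T' ⊥ (F (t+1))
  w2 : w ∈ F (t+2)
  w1 : w ∉ F (t+1)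
  tw : T' w = 0

lemma exists_step {T T' : U →ₗ[k] U} {F : ℕ → Submodule k U} (hF : IsFlag F) {t : ℕ}
    (ht : t + 2 ≤ finrank k U)
    (ja : phi T ⊥ (F t) < phi T ⊥ (F (t+1))) (jb : phi T' ⊥ (F t) < phi T' ⊥ (F (t+1)))
    (nb : phi T' ⊥ (F (t+2)) = phi T' ⊥ (F (t+1))) : ∃ w, Step T T' F t w := by
  have hle : F (t+1) ≤ F (t+2) := hF.mono (by omega)
  have hlt : F (t+1) < F (t+2) := lt_of_le_of_ne hle (by
    intro h
    have h1 := hF.dim (t+1) (by omega)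
    have h2 := hF.dim (t+2) (by omega)
    rw [h] at h1; omega)
  obtain ⟨u, hu, hu1⟩ := SetLike.exists_of_lt hlt
  have e : Submodule.map T' (F (t+1)) = Submodule.map T' (F (t+2)) := by
    apply Submodule.eq_of_le_of_finrank_eq (Submodule.map_mono hle)
    rw [← phi_bot, ← phi_bot, nb]
  have : T' u ∈ Submodule.map T' (F (t+1)) := by rw [e]; exact mem_map_of_mem hu
  obtain ⟨u', hu', h'⟩ := this
  refine ⟨u - u', ht, ja, jb, nb, sub_mem hu (hle hu'), fun h => hu1 ?_, ?_⟩
  · have := add_mem h hu'; simpa using this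
  · rw [map_sub, h', sub_self]

section step
variable {T T' : U →ₗ[k] U} {F : ℕ → Submodule k U} {t : ℕ} {w : U}

lemma Pr.Tw (hT : Pr T T') {w : U} (tw : T' w = 0) : T w = w := by
  have := hT.add w; rwa [tw, add_zero] at this

lemma Step.dimE (s : Step T T' F t w) (hF : IsFlag F) :
    finrank k ↥(F t ⊔ span k {w}) = t + 1 := by
  rw [finrank_sup_span (fun h => s.w1 (hF.mono (by omega) h)), hF.dim t (by have := s.ht; omega)]

lemma Step.leE (s : Step T T' F t w) (hF : IsFlag F) : F t ⊔ span k {w} ≤ F (t+2) :=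
  sup_le (hF.mono (by omega)) ((span_singleton_le_iff_mem _ _).2 s.w2)

lemma Step.bE (s : Step T T' F t w) : Submodule.map T' (F t ⊔ span k {w}) = Submodule.map T' (F t) := by
  rw [Submodule.map_sup, Submodule.map_span, Set.image_singleton, s.tw, span_zero_singleton, sup_bot_eq]

lemma Step.aE (s : Step T T' F t w) (hT : Pr T T') :
    Submodule.map T (F t ⊔ span k {w}) = Submodule.map T (F t) ⊔ span k {w} := by
  rw [Submodule.map_sup, Submodule.map_span, Set.image_singleton, hT.Tw s.tw]

lemma Step.cE (s : Step T T' F t w) (hT : Pr T T') {Q : Submodule k U} (hQ : w ∈ Q) :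
    phi T Q (F t ⊔ span k {w}) = phi T Q (F t) := by
  rw [phi, s.aE hT, sup_assoc, sup_eq_right.2 ((span_singleton_le_iff_mem _ _).2 hQ), phi]

lemma Step.cE2 (s : Step T T' F t w) (hT : Pr T T') (hF : IsFlag F) {P : Submodule k U}
    (hP : P ≤ F t) :
    phi T (F t ⊔ span k {w}) P + 1 = phi T (F (t+2)) P := by
  have e1 := phi_inc LinearMap.id (Submodule.map T P) (s.leE hF)
  rw [s.dimE hF, hF.dim (t+2) s.ht, ← phi_id, ← phi_id] at e1
  have e2 : phi T (F t ⊔ span k {w}) P < phi T (F (t+2)) P := by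
    unfold phi
    apply Submodule.finrank_lt_finrank_of_lt
    refine lt_of_le_of_ne (sup_le_sup_left (s.leE hF) _) (fun h => ?_)
    have h1 : F (t+1) ≤ Submodule.map T P ⊔ (F t ⊔ span k {w}) := by
      rw [h]; exact (hF.mono (by omega)).trans le_sup_right
    have h2 : Submodule.map T' (F (t+1)) ≤ Submodule.map T' (F t) := by
      refine (Submodule.map_mono h1).trans ?_
      rw [Submodule.map_sup, s.bE]
      refine sup_le ?_ le_rfl
      rintro _ ⟨_, ⟨x, hx, rfl⟩, rfl⟩
      rw [hT.t't]; exact zero_mem _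
    have h3 := s.jb
    rw [phi_bot, phi_bot] at h3
    have := finrank_mono h2
    omega
  omega

lemma Step.aE2 (s : Step T T' F t w) (hT : Pr T T') (hF : IsFlag F) :
    phi T ⊥ (F t ⊔ span k {w}) + 1 + phi T' ⊥ (F t) = phi T (F (t+2)) (F t) := by
  have h1 := s.cE2 hT hF le_rfl
  have h2 : phi T (F t ⊔ span k {w}) (F t) = phi T ⊥ (F t ⊔ span k {w}) + phi T' ⊥ (F t) := by
    rw [phi_bot, phi_bot, ← hT.finrank_sup, phi, s.aE hT, ← sup_assoc, hT.map_sup_eq le_rfl,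
      sup_right_comm]
  omega

end step

/-- lifting -/
lemma lifting {T T' : U →ₗ[k] U} (hT : Pr T T') {F G : ℕ → Submodule k U} (hF : IsFlag F)
    (hG : IsFlag G) {t : ℕ} {w : U} (s : Step T T' F t w)
    (h : FLeOn (Set.Iic (finrank k U)) T T' G F) :
    ∃ E, G t ≤ E ∧ E ≤ G (t+2) ∧ finrank k E = t + 1 ∧
      phi T' ⊥ E ≤ phi T' ⊥ (F t ⊔ span k {w}) ∧
      phi T ⊥ E ≤ phi T ⊥ (F t ⊔ span k {w}) ∧
      (∀ j ≤ finrank k U, t + 2 ≤ j → phi T (G j) E ≤ phi T (F j) (F t ⊔ span k {w})) ∧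
      (∀ i ≤ t, phi T E (G i) ≤ phi T (F t ⊔ span k {w}) (F i)) := by
  have ht := s.ht
  have all : ∀ i ≤ finrank k U, ∀ j ≤ finrank k U, phi T (G j) (G i) ≤ phi T (F j) (F i) :=
    fun i hi j hj => h.all hT hG.mono hF.mono hi hj
  have dG0 := hG.dim t (by omega)
  have dG2 := hG.dim (t+2) ht
  have dF0 := hF.dim t (by omega)
  have dF1 := hF.dim (t+1) (by omega)
  have dF2 := hF.dim (t+2) ht
  have dE := s.dimE hF
  have lF0 : F t ≤ F t ⊔ span k {w} := le_sup_left
  have lF2 := s.leE hF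
  have lF01 : F t ≤ F (t+1) := hF.mono (by omega)
  have hle : G t ≤ G (t+2) := hG.mono (by omega)
  have hB0 := h.b t (by simp; omega)
  have hB2 := h.b (t+2) (by simp; omega)
  have hA0 := h.a t (by simp; omega)
  have hA2 := h.a (t+2) (by simp; omega)
  have hBE : phi T' ⊥ (F t ⊔ span k {w}) = phi T' ⊥ (F t) := by
    rw [phi_bot, phi_bot, s.bE]
  -- consequences of comparability
  have H2 : ∀ E, G t ≤ E → E ≤ G (t+2) → finrank k E = t+1 → ∀ j ≤ finrank k U, t+2 ≤ j →
      Cmp (G (t+2)) E (Zs T (G j) (G t)) → phi T (G j) E ≤ phi T (F j) (F t ⊔ span k {w}) := by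
    intro E e0 e2 d j hj hj2 hc
    rcases phi_comp T (G j) e0 e2 (by omega) (by omega) hc with h1 | h1
    · rw [h1, s.cE hT (hF.mono hj2 s.w2)]
      exact all t (by omega) j hj
    · have h2 := all (t+2) ht j hj
      have h3 := phi_inc T (F j) lF2
      omega
  have H4 : ∀ E, G t ≤ E → E ≤ G (t+2) → finrank k E = t+1 → ∀ i ≤ t,
      Cmp (G (t+2)) E (Zs LinearMap.id (Submodule.map T (G i)) (G t)) →
      phi T E (G i) ≤ phi T (F t ⊔ span k {w}) (F i) := by
    intro E e0 e2 d i hi hc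
    rcases phi_comp LinearMap.id (Submodule.map T (G i)) e0 e2 (by omega) (by omega) hc with h1 | h1
    · rw [← phi_id, ← phi_id] at h1
      rw [h1]
      refine (all i (by omega) t (by omega)).trans ?_
      rw [phi_id T (F i) (F t), phi_id T (F i) (F t ⊔ span k {w})]
      exact phi_mono _ _ lF0
    · rw [← phi_id, ← phi_id] at h1
      have h2 := all i (by omega) (t+2) ht
      have h3 := s.cE2 hT hF (hF.mono hi)
      omega
  have H1 : ∀ E, G t ≤ E → E ≤ G (t+2) → finrank k E = t+1 →
      Cmp (G (t+2)) E (Zs T' ⊥ (G t)) → phi T' ⊥ E ≤ phi T' ⊥ (F t ⊔ span k {w}) := by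
    intro E e0 e2 d hc
    have h3 := phi_inc T' ⊥ lF01
    have h4 := s.nb
    rw [dF0, dF1] at h3
    rw [hBE]
    rcases phi_comp T' ⊥ e0 e2 (by omega) (by omega) hc with h1 | h1
    · rw [h1]; exact hB0
    · clear H2 H4 dE lF2 lF0
      omega
  have H3 : ∀ E, G t ≤ E → E ≤ G (t+2) → finrank k E = t+1 →
      Cmp (G (t+2)) E (Zs T ⊥ (G t)) → phi T ⊥ E ≤ phi T ⊥ (F t ⊔ span k {w}) := by
    intro E e0 e2 d hc
    have h3 := phi_inc T ⊥ lF2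
    have h4 := phi_mono T ⊥ lF0
    rw [dE, dF2] at h3
    rcases phi_comp T ⊥ e0 e2 (by omega) (by omega) hc with h1 | h1
    · rw [h1]; exact hA0.trans h4
    · omega
  -- inclusions
  have I1 : ∀ i ≤ t, Zs LinearMap.id (Submodule.map T (G i)) (G t) ≤ Zs T ⊥ (G t) := by
    intro i hi x hx
    simp only [Zs, Submodule.map_id, Submodule.comap_id, Submodule.mem_comap] at hx ⊢
    obtain ⟨y, hy, z, ⟨u, hu, rfl⟩, rfl⟩ := mem_sup.1 hx
    rw [map_add, hT.idem]
    exact mem_sup_left (add_mem (mem_map_of_mem hy) (mem_map_of_mem (hG.mono hi hu)))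
  have I2 : ∀ i ≤ t, Zs LinearMap.id (Submodule.map T (G i)) (G t) ≤ Zs T' ⊥ (G t) := by
    intro i hi x hx
    simp only [Zs, Submodule.map_id, Submodule.comap_id, Submodule.mem_comap] at hx ⊢
    obtain ⟨y, hy, z, ⟨u, hu, rfl⟩, rfl⟩ := mem_sup.1 hx
    rw [map_add, hT.t't, add_zero]
    exact mem_sup_left (mem_map_of_mem hy)
  have I3 : ∀ j, Zs T ⊥ (G t) ≤ Zs T (G j) (G t) := by
    intro j x hx
    simp only [Zs, sup_bot_eq, Submodule.mem_comap] at hx ⊢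
    exact mem_sup_left hx
  have I4 : ∀ j, t + 2 ≤ j → G (t+2) ⊓ Zs T' ⊥ (G t) ≤ Zs T (G j) (G t) := by
    intro j hj x hx
    obtain ⟨hx2, hx⟩ := hx
    simp only [Zs, sup_bot_eq, SetLike.mem_coe, Submodule.mem_comap] at hx hx2 ⊢
    have h1 : x ∈ Submodule.map T (G t) ⊔ G j := mem_sup_right (hG.mono hj hx2)
    rw [hT.T_mem_iff h1, hT.map_sup_swap (hG.mono (by omega))]
    exact mem_sup_left hx
  have I5 : ∀ i i', i ≤ i' → Zs LinearMap.id (Submodule.map T (G i)) (G t) ≤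
      Zs LinearMap.id (Submodule.map T (G i')) (G t) := by
    intro i i' hi
    exact comap_mono (sup_le_sup_left (Submodule.map_mono (hG.mono hi)) _)
  have I6 : ∀ j j', j ≤ j' → Zs T (G j) (G t) ≤ Zs T (G j') (G t) := by
    intro i i' hi
    exact comap_mono (sup_le_sup_left (hG.mono hi) _)
  by_cases hcmp : G (t+2) ⊓ Zs T ⊥ (G t) ≤ Zs T' ⊥ (G t) ∨ G (t+2) ⊓ Zs T' ⊥ (G t) ≤ Zs T ⊥ (G t)
  · obtain ⟨E, e0, e2, d, hc⟩ := chain_lemma hle (by omega)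
      ({Z | Z = Zs T ⊥ (G t) ∨ Z = Zs T' ⊥ (G t) ∨ (∃ i ≤ t, Z = Zs LinearMap.id (Submodule.map T (G i)) (G t))
        ∨ ∃ j, t + 2 ≤ j ∧ Z = Zs T (G j) (G t)}) (by
        rintro Z (rfl | rfl | ⟨i, hi, rfl⟩ | ⟨j, hj, rfl⟩) <;> exact le_Zs _ _ _) (by
        rintro Z (rfl | rfl | ⟨i, hi, rfl⟩ | ⟨j, hj, rfl⟩) Z'
          (rfl | rfl | ⟨i', hi', rfl⟩ | ⟨j', hj', rfl⟩)
        · exact Or.inl inf_le_right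
        · exact hcmp
        · exact Or.inr (inf_le_right.trans (I1 _ hi'))
        · exact Or.inl (inf_le_right.trans (I3 _))
        · exact hcmp.symm
        · exact Or.inl inf_le_right
        · exact Or.inr (inf_le_right.trans (I2 _ hi'))
        · exact Or.inl (I4 _ hj')
        · exact Or.inl (inf_le_right.trans (I1 _ hi))
        · exact Or.inl (inf_le_right.trans (I2 _ hi))
        · rcases le_total i i' with h | h
          · exact Or.inl (inf_le_right.trans (I5 _ _ h))
          · exact Or.inr (inf_le_right.trans (I5 _ _ h))
        · exact Or.inl (inf_le_right.trans ((I1 _ hi).trans (I3 _)))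
        · exact Or.inr (inf_le_right.trans (I3 _))
        · exact Or.inr (I4 _ hj)
        · exact Or.inr (inf_le_right.trans ((I1 _ hi').trans (I3 _)))
        · rcases le_total j j' with h | h
          · exact Or.inl (inf_le_right.trans (I6 _ _ h))
          · exact Or.inr (inf_le_right.trans (I6 _ _ h)))
    have d' : finrank k E = t + 1 := by omega
    exact ⟨E, e0, e2, d', H1 E e0 e2 d' (hc _ (Or.inr (Or.inl rfl))),
      H3 E e0 e2 d' (hc _ (Or.inl rfl)),
      fun j hj hj2 => H2 E e0 e2 d' j hj hj2 (hc _ (Or.inr (Or.inr (Or.inr ⟨j, hj2, rfl⟩)))),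
      fun i hi => H4 E e0 e2 d' i hi (hc _ (Or.inr (Or.inr (Or.inl ⟨i, hi, rfl⟩))))⟩
  · push Not at hcmp
    obtain ⟨n1, n2⟩ := hcmp
    set ZA := Zs T ⊥ (G t) with hZA
    set ZB := Zs T' ⊥ (G t) with hZB
    have lA : G t ≤ G (t+2) ⊓ ZA := le_inf hle (le_Zs _ _ _)
    have lB : G t ≤ G (t+2) ⊓ ZB := le_inf hle (le_Zs _ _ _)
    have key : ∀ X Y : Submodule k U, G t ≤ X → G t ≤ Y → ¬ (G (t+2) ⊓ X ≤ Y) →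
        ¬ (G (t+2) ⊓ Y ≤ X) → finrank k ↥(G (t+2) ⊓ X) = t + 1 ∧ G (t+2) ⊓ X ⊓ Y = G t := by
      intro X Y hX hY hXY hYX
      have l1 : G (t+2) ⊓ X < G (t+2) := lt_of_le_of_ne inf_le_left (fun hh =>
        hYX (inf_le_left.trans (inf_eq_left.1 hh)))
      have l2 : G (t+2) ⊓ X ⊓ Y < G (t+2) ⊓ X := lt_of_le_of_ne inf_le_left (fun hh =>
        hXY (inf_eq_left.1 hh))
      have l3 : G t ≤ G (t+2) ⊓ X ⊓ Y := le_inf (le_inf hle hX) hY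
      have f1 := Submodule.finrank_lt_finrank_of_lt l1
      have f2 := Submodule.finrank_lt_finrank_of_lt l2
      have f3 := finrank_mono l3
      exact ⟨by omega, (Submodule.eq_of_le_of_finrank_le l3 (by omega)).symm⟩
    obtain ⟨dA, iA⟩ := key ZA ZB (le_Zs _ _ _) (le_Zs _ _ _) n1 n2
    obtain ⟨dB, iB⟩ := key ZB ZA (le_Zs _ _ _) (le_Zs _ _ _) n2 n1
    have zM : ∀ i ≤ t, G (t+2) ⊓ Zs LinearMap.id (Submodule.map T (G i)) (G t) ≤ G t := by
      intro i hi
      refine le_trans ?_ iA.le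
      exact le_inf (inf_le_inf_left _ (I1 i hi)) (inf_le_right.trans (I2 i hi))
    have zL : ∀ j, t + 2 ≤ j → G (t+2) ≤ Zs T (G j) (G t) := by
      intro j hj
      have l1 : G (t+2) ⊓ ZA ⊔ G (t+2) ⊓ ZB ≤ Zs T (G j) (G t) :=
        sup_le (inf_le_right.trans (I3 j)) (I4 j hj)
      have l2 : G (t+2) ⊓ ZA ⊔ G (t+2) ⊓ ZB ≤ G (t+2) := sup_le inf_le_left inf_le_left
      have f := Submodule.finrank_sup_add_finrank_inf_eq (G (t+2) ⊓ ZA) (G (t+2) ⊓ ZB)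
      have e : G (t+2) ⊓ ZA ⊓ (G (t+2) ⊓ ZB) = G t := by
        rw [← iA, ← inf_inf_distrib_left, inf_assoc]
      rw [e] at f
      rw [← Submodule.eq_of_le_of_finrank_le l2 (by omega)]
      exact l1
    by_cases hA : phi T ⊥ (G t) + 1 ≤ phi T ⊥ (F t ⊔ span k {w})
    · refine ⟨G (t+2) ⊓ ZB, lB, inf_le_left, dB, H1 _ lB inf_le_left dB (Or.inr le_rfl), ?_,
        fun j hj hj2 => H2 _ lB inf_le_left dB j hj hj2 (Or.inl (inf_le_left.trans (zL j hj2))),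
        fun i hi => H4 _ lB inf_le_left dB i hi (Or.inr ((zM i hi).trans lB))⟩
      have := phi_inc T ⊥ lB
      omega
    · refine ⟨G (t+2) ⊓ ZA, lA, inf_le_left, dA, ?_, H3 _ lA inf_le_left dA (Or.inr le_rfl),
        fun j hj hj2 => H2 _ lA inf_le_left dA j hj hj2 (Or.inl (inf_le_left.trans (zL j hj2))),
        fun i hi => H4 _ lA inf_le_left dA i hi (Or.inr ((zM i hi).trans lA))⟩
      have f0 := phi_mono T ⊥ lF0
      have f1 := phi_inc T' ⊥ lA
      have f2 := phi_formula LinearMap.id (Submodule.map T (G t)) hle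
      have f3 : G (t+2) ⊓ Zs LinearMap.id (Submodule.map T (G t)) (G t) = G t :=
        le_antisymm (zM t le_rfl) (le_inf hle (le_Zs _ _ _))
      rw [f3, ← phi_id, ← phi_id, hT.phi_ge le_rfl] at f2
      have f4 := all t (by omega) (t+2) ht
      have f5 := s.aE2 hT hF
      omega

end core
end FC

set_option linter.unusedSectionVars false
set_option linter.unusedVariables false
set_option maxHeartbeats 1000000
namespace FC
open Submodule Module
section core2
variable {k U : Type} [Field k] [AddCommGroup U] [Module k U] [FiniteDimensional k U]

lemma IsFlag.top {F : ℕ → Submodule k U} (hF : IsFlag F) {i : ℕ} (hi : finrank k U ≤ i) :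
    F i = ⊤ := by
  have h : F (finrank k U) = ⊤ := Submodule.eq_top_of_finrank_eq (hF.dim _ le_rfl)
  exact eq_top_iff.2 (h ▸ hF.mono hi)

lemma IsFlag.AB_ge {T T' : U →ₗ[k] U} (hT : Pr T T') {F : ℕ → Submodule k U} (hF : IsFlag F)
    {i : ℕ} (hi : i ≤ finrank k U) : i ≤ phi T ⊥ (F i) + phi T' ⊥ (F i) := by
  rw [← hT.phi_ge le_rfl, phi]
  conv_lhs => rw [← hF.dim i hi]
  exact finrank_mono le_sup_right

lemma IsFlag.AB_top {T T' : U →ₗ[k] U} (hT : Pr T T') {F : ℕ → Submodule k U} (hF : IsFlag F) :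
    phi T ⊥ (F (finrank k U)) + phi T' ⊥ (F (finrank k U)) = finrank k U := by
  rw [← hT.phi_ge le_rfl, phi, hF.top le_rfl, sup_top_eq, finrank_top]

lemma IsFlag.AB_zero {T : U →ₗ[k] U} {F : ℕ → Submodule k U} (hF : IsFlag F) :
    phi T ⊥ (F 0) = 0 := by
  have h := hF.dim 0 (Nat.zero_le _)
  rw [Submodule.finrank_eq_zero] at h
  rw [phi_bot, h, Submodule.map_bot, finrank_bot]

lemma exists_step_or {T T' : U →ₗ[k] U} (hT : Pr T T') {F : ℕ → Submodule k U} (hF : IsFlag F) :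
    (∃ t w, Step T T' F t w) ∨ (∃ t w, Step T' T F t w) ∨
    ∀ i ≤ finrank k U, phi T ⊥ (F i) + phi T' ⊥ (F i) = i := by
  classical
  set N := finrank k U with hN
  have inc : ∀ (S : U →ₗ[k] U) i, i + 1 ≤ N → phi S ⊥ (F (i+1)) ≤ phi S ⊥ (F i) + 1 := by
    intro S i hi
    have := phi_inc S ⊥ (hF.mono (show i ≤ i + 1 by omega))
    rw [hF.dim _ hi, hF.dim i (by omega)] at this
    omega
  have mon : ∀ (S : U →ₗ[k] U) i, phi S ⊥ (F i) ≤ phi S ⊥ (F (i+1)) := fun S i =>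
    phi_mono S ⊥ (hF.mono (Nat.le_succ i))
  let Q : ℕ → Prop := fun s => s < N ∧ phi T ⊥ (F s) < phi T ⊥ (F (s+1)) ∧
    phi T' ⊥ (F s) < phi T' ⊥ (F (s+1))
  by_cases hex : ∃ s, Q s
  · obtain ⟨s, hs⟩ := hex
    have hq : Q (Nat.findGreatest Q N) := Nat.findGreatest_spec hs.1.le hs
    have hm : ∀ m, Nat.findGreatest Q N < m → m ≤ N → ¬ Q m := fun m h1 h2 =>
      Nat.findGreatest_is_greatest h1 h2
    generalize Nat.findGreatest Q N = t at hq hm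
    obtain ⟨ht, ja, jb⟩ := hq
    have ht2 : t + 2 ≤ N := by
      by_contra hlt
      have e : t + 1 = N := by omega
      have h1 := hF.AB_top hT
      rw [← hN, ← e] at h1
      have h2 := hF.AB_ge hT (i := t) (by omega)
      omega
    have hn := hm (t+1) (by omega) (by omega)
    have m1 := mon T (t+1)
    have m2 := mon T' (t+1)
    by_cases hb : phi T' ⊥ (F (t+2)) = phi T' ⊥ (F (t+1))
    · left
      obtain ⟨w, hw⟩ := exists_step hF ht2 ja jb hb
      exact ⟨t, w, hw⟩
    · right; left
      have ha : phi T ⊥ (F (t+2)) = phi T ⊥ (F (t+1)) := by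
        by_contra hne
        exact hn ⟨by omega, lt_of_le_of_ne m1 (Ne.symm hne), lt_of_le_of_ne m2 (Ne.symm hb)⟩
      obtain ⟨w, hw⟩ := exists_step hF ht2 jb ja ha
      exact ⟨t, w, hw⟩
  · right; right
    push Not at hex
    intro i hi
    refine le_antisymm ?_ (hF.AB_ge hT hi)
    induction i with
    | zero => rw [hF.AB_zero, hF.AB_zero]
    | succ i ih =>
      have h1 := ih (by omega)
      have h2 := hex i
      have h3 := inc T i hi
      have h4 := inc T' i hi
      have h5 := mon T i
      have h6 := mon T' i
      by_contra hlt
      exact h2 ⟨by omega, by omega, by omega⟩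

/-- the transvection lemma -/
lemma exists_functional {Q : Submodule k U} {a b : U} (ha : a ∉ Q) (hb : b ∉ Q) :
    ∃ ψ : U →ₗ[k] k, (∀ x ∈ Q, ψ x = 0) ∧ ψ a = 1 ∧ ψ b ≠ 0 := by
  obtain ⟨f, hf, hQf⟩ := Submodule.exists_le_ker_of_notMem ha
  obtain ⟨g, hg, hQg⟩ := Submodule.exists_le_ker_of_notMem hb
  have main : ∃ ψ : U →ₗ[k] k, (∀ x ∈ Q, ψ x = 0) ∧ ψ a ≠ 0 ∧ ψ b ≠ 0 := by
    by_cases h1 : f b = 0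
    · by_cases h2 : g a = 0
      · refine ⟨f + g, fun x hx => ?_, ?_, ?_⟩
        · have h3 := hQf hx
          have h4 := hQg hx
          simp only [LinearMap.mem_ker] at h3 h4
          simp [h3, h4]
        · simp [h2, hf]
        · simp [h1, hg]
      · exact ⟨g, fun x hx => hQg hx, h2, hg⟩
    · exact ⟨f, fun x hx => hQf hx, hf, h1⟩
  obtain ⟨ψ, h1, h2, h3⟩ := main
  refine ⟨(ψ a)⁻¹ • ψ, fun x hx => ?_, ?_, ?_⟩
  · simp [h1 x hx]
  · simp [h2]
  · simp [h2, h3]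

lemma transv {T T' : U →ₗ[k] U} (hT : Pr T T') {Q : Submodule k U} {v z : U} (hz : T' z = 0)
    (h1 : T v ∉ Submodule.map T Q) (h2 : T (v + z) ∉ Submodule.map T Q) :
    ∃ κ : U ≃ₗ[k] U, (∀ x, κ (T x) = T (κ x)) ∧ (∀ x ∈ Q, κ x = x) ∧ κ v = v + z ∧
      ∀ R : Submodule k U, z ∈ R → Submodule.map (κ : U →ₗ[k] U) R = R := by
  have hTz := hT.Tw hz
  obtain ⟨ψ, p1, p2, p3⟩ := exists_functional h1 h2
  let f : U →ₗ[k] U := LinearMap.id + (LinearMap.toSpanSingleton k U z) ∘ₗ ψ ∘ₗ T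
  have hf : ∀ x, f x = x + ψ (T x) • z := fun x => by simp [f]
  have hinj : Function.Injective f := by
    rw [injective_iff_map_eq_zero]
    intro x hx
    rw [hf] at hx
    have h3 : ψ (T x) * (1 + ψ z) = 0 := by
      have := congrArg (fun y => ψ (T y)) hx
      simp only [map_add, map_smul, hTz, map_zero, smul_eq_mul] at this
      linear_combination this
    have h4 : 1 + ψ z ≠ 0 := by
      intro h; apply p3; rw [map_add, hTz, map_add, p2, h]
    have h5 := (mul_eq_zero.1 h3).resolve_right h4
    rw [h5, zero_smul, add_zero] at hx
    exact hx
  refine ⟨LinearEquiv.ofInjectiveEndo f hinj, fun x => ?_, fun x hx => ?_, ?_, fun R hR => ?_⟩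
  · simp only [LinearEquiv.coe_ofInjectiveEndo]
    rw [hf, hf, hT.idem, map_add, map_smul, hTz]
  · simp only [LinearEquiv.coe_ofInjectiveEndo]
    rw [hf, p1 _ (mem_map_of_mem hx), zero_smul, add_zero]
  · simp only [LinearEquiv.coe_ofInjectiveEndo]
    rw [hf, p2, one_smul]
  · apply Submodule.eq_of_le_of_finrank_eq
    · rintro _ ⟨x, hx, rfl⟩
      change f x ∈ R
      rw [hf]
      exact add_mem hx (smul_mem _ _ hR)
    · exact LinearEquiv.finrank_map_eq _ _

lemma span_step {F : ℕ → Submodule k U} (hF : IsFlag F) {t : ℕ} (ht : t + 1 ≤ finrank k U) {v : U}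
    (hv : v ∈ F (t+1)) (hv' : v ∉ F t) : F (t+1) = F t ⊔ span k {v} := by
  symm
  apply Submodule.eq_of_le_of_finrank_eq
  · exact sup_le (hF.mono (by omega)) ((span_singleton_le_iff_mem _ _).2 hv)
  · rw [finrank_sup_span hv', hF.dim _ ht, hF.dim t (by omega)]

lemma exists_new {F : ℕ → Submodule k U} (hF : IsFlag F) {t : ℕ} (ht : t + 1 ≤ finrank k U) :
    ∃ v ∈ F (t+1), v ∉ F t := by
  have hlt : F t < F (t+1) := lt_of_le_of_ne (hF.mono (by omega)) (by
    intro h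
    have h1 := hF.dim (t+1) (by omega)
    have h2 := hF.dim t (by omega)
    rw [h] at h2; omega)
  exact SetLike.exists_of_lt hlt

lemma jump_notMem {T : U →ₗ[k] U} {F : ℕ → Submodule k U} (hF : IsFlag F) {t : ℕ}
    (ht : t + 1 ≤ finrank k U) (ja : phi T ⊥ (F t) < phi T ⊥ (F (t+1))) {v : U}
    (hv : v ∈ F (t+1)) (hv' : v ∉ F t) : T v ∉ Submodule.map T (F t) := by
  intro h
  rw [phi_bot, phi_bot, span_step hF ht hv hv', Submodule.map_sup, Submodule.map_span, Set.image_singleton,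
    sup_eq_left.2 ((span_singleton_le_iff_mem _ _).2 h)] at ja
  exact lt_irrefl _ ja

lemma adj {T T' : U →ₗ[k] U} (hT : Pr T T') {F G : ℕ → Submodule k U} (hF : IsFlag F)
    (hG : IsFlag G) {t : ℕ} (ht : t + 2 ≤ finrank k U) (hne : ∀ i, i ≠ t + 1 → F i = G i)
    (jF : phi T ⊥ (F t) < phi T ⊥ (F (t+1))) (jG : phi T ⊥ (G t) < phi T ⊥ (G (t+1)))
    {w : U} (w2 : w ∈ F (t+2)) (wF : w ∉ F (t+1)) (wG : w ∉ G (t+1)) (tw : T' w = 0) :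
    ∃ κ : U ≃ₗ[k] U, (∀ x, κ (T x) = T (κ x)) ∧ ∀ i, G i = Submodule.map (κ : U →ₗ[k] U) (F i) := by
  obtain ⟨u, hu, hu'⟩ := exists_new hG (t := t) (by omega)
  have e0 : F t = G t := hne t (by omega)
  have h1 : u ∈ F (t+2) := by rw [hne (t+2) (by omega)]; exact hG.mono (by omega) hu
  rw [span_step hF ht w2 wF] at h1
  obtain ⟨f1, hf1, z, hz, rfl⟩ := mem_sup.1 h1
  obtain ⟨b, rfl⟩ := mem_span_singleton.1 hz
  have hf1' : f1 ∉ F t := by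
    intro h
    rw [e0] at h
    by_cases hb : b = 0
    · subst hb; apply hu'; simpa using h
    · apply wG
      have h3 : b • w ∈ G (t+1) := by
        have := sub_mem hu (hG.mono (Nat.le_succ t) h)
        simpa using this
      exact (smul_mem_iff _ hb).1 h3
  have n1 := jump_notMem hF (by omega) jF hf1 hf1'
  have n2 := jump_notMem hG (by omega) jG hu hu'
  rw [← e0] at n2
  obtain ⟨κ, k1, k2, k3, k4⟩ := transv hT (z := b • w) (by rw [map_smul, tw, smul_zero]) n1 n2
  refine ⟨κ, k1, fun i => ?_⟩
  have fixF : ∀ Q ≤ F t, Submodule.map (κ : U →ₗ[k] U) Q = Q := by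
    intro Q hQ
    apply Submodule.eq_of_le_of_finrank_eq
    · rintro _ ⟨x, hx, rfl⟩
      change κ x ∈ Q
      rw [k2 x (hQ hx)]; exact hx
    · exact LinearEquiv.finrank_map_eq _ _
  rcases lt_trichotomy i (t+1) with hi | hi | hi
  · rw [← hne i (by omega), fixF _ (hF.mono (by omega))]
  · subst hi
    rw [span_step hG (by omega) hu hu', span_step hF (by omega) hf1 hf1', Submodule.map_sup,
      fixF _ le_rfl, Submodule.map_span, Set.image_singleton, ← e0]
    change _ = F t ⊔ span k {κ f1}
    rw [k3]
  · rw [← hne i (by omega), k4 _ (smul_mem _ _ (hF.mono (by omega) w2))]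

lemma map_comm_phi {T : U →ₗ[k] U} {κ : U ≃ₗ[k] U} (hκ : ∀ x, κ (T x) = T (κ x))
    (P Q : Submodule k U) :
    phi T (Submodule.map (κ : U →ₗ[k] U) Q) (Submodule.map (κ : U →ₗ[k] U) P) = phi T Q P := by
  unfold phi
  have : Submodule.map T (Submodule.map (κ : U →ₗ[k] U) P) = Submodule.map (κ : U →ₗ[k] U) (Submodule.map T P) := by
    rw [← Submodule.map_comp, ← Submodule.map_comp]; congr 1; ext x; exact (hκ x).symm
  rw [this, ← Submodule.map_sup]
  exact LinearEquiv.finrank_map_eq _ _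

lemma map_comm_phi_bot {T : U →ₗ[k] U} {κ : U ≃ₗ[k] U} (hκ : ∀ x, κ (T x) = T (κ x))
    (P : Submodule k U) : phi T ⊥ (Submodule.map (κ : U →ₗ[k] U) P) = phi T ⊥ P := by
  have := map_comm_phi hκ P ⊥
  rwa [Submodule.map_bot] at this

lemma comm_symm {T T' : U →ₗ[k] U} (hT : Pr T T') {κ : U ≃ₗ[k] U} (hκ : ∀ x, κ (T x) = T (κ x)) :
    ∀ x, κ (T' x) = T' (κ x) := by
  intro x
  have h1 : κ (T x) + κ (T' x) = κ x := by rw [← map_add, hT.add]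
  have h2 := hT.add (κ x)
  rw [hκ] at h1
  exact add_left_cancel (h1.trans h2.symm)

lemma IsFlag.map {F : ℕ → Submodule k U} (hF : IsFlag F) (κ : U ≃ₗ[k] U) :
    IsFlag (fun i => Submodule.map (κ : U →ₗ[k] U) (F i)) :=
  ⟨fun i j hij => Submodule.map_mono (hF.mono hij), fun i hi => by
    rw [LinearEquiv.finrank_map_eq]; exact hF.dim i hi⟩

/-- under A+B = i the flag is T-stable -/
lemma stable_of_AB {T T' : U →ₗ[k] U} (hT : Pr T T') {F : ℕ → Submodule k U} (hF : IsFlag F)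
    {i : ℕ} (hi : i ≤ finrank k U) (h : phi T ⊥ (F i) + phi T' ⊥ (F i) = i) :
    Submodule.map T (F i) ≤ F i := by
  rw [← hT.phi_ge le_rfl, phi] at h
  have : F i = Submodule.map T (F i) ⊔ F i :=
    Submodule.eq_of_le_of_finrank_le le_sup_right (by rw [h, hF.dim i hi])
  rw [this]
  conv_lhs => rw [← this]
  exact le_sup_left

lemma stable_new {T T' : U →ₗ[k] U} (hT : Pr T T') {F : ℕ → Submodule k U} (hF : IsFlag F)
    {i : ℕ} (hi : i + 1 ≤ finrank k U) (h : ∀ i ≤ finrank k U, phi T ⊥ (F i) + phi T' ⊥ (F i) = i)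
    (hj : phi T ⊥ (F i) < phi T ⊥ (F (i+1))) :
    ∃ v ∈ F (i+1), v ∉ F i ∧ T' v = 0 := by
  have hlt : ¬ (Submodule.map T (F (i+1)) ≤ Submodule.map T (F i)) := by
    intro hle
    rw [phi_bot, phi_bot] at hj
    have := finrank_mono hle
    omega
  obtain ⟨_, ⟨x, hx, rfl⟩, hn⟩ := SetLike.not_le_iff_exists.1 hlt
  refine ⟨T x, stable_of_AB hT hF hi (h _ hi) (mem_map_of_mem hx), fun hh => hn ?_, hT.t't x⟩
  rw [← hT.idem]; exact mem_map_of_mem hh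

lemma base {T T' : U →ₗ[k] U} (hT : Pr T T') {F G : ℕ → Submodule k U} (hF : IsFlag F)
    (hG : IsFlag G) (hFi : ∀ i ≤ finrank k U, phi T ⊥ (F i) + phi T' ⊥ (F i) = i)
    (ha : ∀ i ≤ finrank k U, phi T ⊥ (G i) = phi T ⊥ (F i))
    (hb : ∀ i ≤ finrank k U, phi T' ⊥ (G i) = phi T' ⊥ (F i)) :
    ∃ κ : U ≃ₗ[k] U, (∀ x, κ (T x) = T (κ x)) ∧ ∀ i, G i = Submodule.map (κ : U →ₗ[k] U) (F i) := by
  have main : ∀ m, m ≤ finrank k U → ∃ κ : U ≃ₗ[k] U, (∀ x, κ (T x) = T (κ x)) ∧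
      ∀ i ≤ m, G i = Submodule.map (κ : U →ₗ[k] U) (F i) := by
    intro m
    induction m with
    | zero =>
      intro _
      refine ⟨LinearEquiv.refl k U, fun x => rfl, fun i hi => ?_⟩
      obtain rfl : i = 0 := by omega
      have h1 := hF.dim 0 (by omega)
      have h2 := hG.dim 0 (by omega)
      rw [Submodule.finrank_eq_zero] at h1 h2
      rw [h1, h2, Submodule.map_bot]
    | succ m ih =>
      intro hm
      obtain ⟨κ, hκ, hi⟩ := ih (by omega)
      have hF' := hF.map κ
      set F' : ℕ → Submodule k U := fun i => Submodule.map (κ : U →ₗ[k] U) (F i) with hF'def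
      have hκ' := comm_symm hT hκ
      have hFi' : ∀ i ≤ finrank k U, phi T ⊥ (F' i) + phi T' ⊥ (F' i) = i := by
        intro i hi
        rw [map_comm_phi_bot hκ, map_comm_phi_bot hκ', hFi i hi]
      have hGi : ∀ i ≤ finrank k U, phi T ⊥ (G i) + phi T' ⊥ (G i) = i := by
        intro i hi
        rw [ha i hi, hb i hi, hFi i hi]
      have em : G m = F' m := hi m le_rfl
      -- general step
      have gen : ∀ (S S' : U →ₗ[k] U), Pr S S' → (∀ i ≤ finrank k U, phi S ⊥ (F' i) + phi S' ⊥ (F' i) = i)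
          → (∀ i ≤ finrank k U, phi S ⊥ (G i) + phi S' ⊥ (G i) = i) →
          phi S ⊥ (F' m) < phi S ⊥ (F' (m+1)) → phi S ⊥ (G m) < phi S ⊥ (G (m+1)) →
          ∃ κ : U ≃ₗ[k] U, (∀ x, κ (S x) = S (κ x)) ∧
            ∀ i ≤ m+1, G i = Submodule.map (κ : U →ₗ[k] U) (F' i) := by
        intro S S' hS h1 h2 j1 j2
        obtain ⟨v, hv, hv', tv⟩ := stable_new hS hF' hm h1 j1
        obtain ⟨u, hu, hu', tu⟩ := stable_new hS hG hm h2 j2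
        have n1 := jump_notMem hF' hm j1 hv hv'
        have n2 := jump_notMem hG hm j2 hu hu'
        rw [em] at n2
        obtain ⟨κ2, k1, k2, k3, k4⟩ := transv hS (v := v) (z := u - v)
          (by rw [map_sub, tv, tu, sub_zero]) n1 (by rw [add_sub_cancel]; exact n2)
        rw [add_sub_cancel] at k3
        have fixF : ∀ Q ≤ F' m, Submodule.map (κ2 : U →ₗ[k] U) Q = Q := by
          intro Q hQ
          apply Submodule.eq_of_le_of_finrank_eq
          · rintro _ ⟨x, hx, rfl⟩
            change κ2 x ∈ Q
            rw [k2 x (hQ hx)]; exact hx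
          · exact LinearEquiv.finrank_map_eq _ _
        refine ⟨κ2, k1, fun i hi' => ?_⟩
        rcases Nat.lt_or_ge m i with h | h
        · obtain rfl : i = m + 1 := by omega
          rw [span_step hG hm hu hu', span_step hF' hm hv hv', Submodule.map_sup, fixF _ le_rfl,
            Submodule.map_span, Set.image_singleton, em]
          change _ = F' m ⊔ span k {κ2 v}
          rw [k3]
        · rw [fixF _ (hF'.mono h), hi i h]
      have a1 := map_comm_phi_bot hκ (F m)
      have a2 := map_comm_phi_bot hκ (F (m+1))
      have b1 := map_comm_phi_bot hκ' (F m)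
      have b2 := map_comm_phi_bot hκ' (F (m+1))
      have q1 := hFi m (by omega)
      have q2 := hFi (m+1) hm
      have r1 := ha m (by omega)
      have r2 := ha (m+1) hm
      have r3 := hb m (by omega)
      have r4 := hb (m+1) hm
      have mT : phi T ⊥ (F m) ≤ phi T ⊥ (F (m+1)) := phi_mono T ⊥ (hF.mono (Nat.le_succ m))
      have main2 : ∃ κ : U ≃ₗ[k] U, (∀ x, κ (T x) = T (κ x)) ∧
            ∀ i ≤ m+1, G i = Submodule.map (κ : U →ₗ[k] U) (F' i) := by
        by_cases hj : phi T ⊥ (F m) < phi T ⊥ (F (m+1))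
        · exact gen T T' hT hFi' hGi (by simp only [hF'def]; omega) (by omega)
        · obtain ⟨κ2, k1, k2⟩ := gen T' T hT.symm
            (fun i hi => by rw [add_comm]; exact hFi' i hi)
            (fun i hi => by rw [add_comm]; exact hGi i hi)
            (by simp only [hF'def]; omega) (by omega)
          exact ⟨κ2, comm_symm hT.symm k1, k2⟩
      obtain ⟨κ2, k1, k2⟩ := main2
      refine ⟨κ.trans κ2, fun x => ?_, fun i hi => ?_⟩
      · simp only [LinearEquiv.trans_apply]; rw [hκ, k1]
      · rw [k2 i hi, hF'def]
        simp only
        rw [← Submodule.map_comp]; rfl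
  obtain ⟨κ, h1, h2⟩ := main _ le_rfl
  refine ⟨κ, h1, fun i => ?_⟩
  rcases Nat.lt_or_ge (finrank k U) i with h | h
  · rw [hF.top h.le, hG.top h.le, Submodule.map_top, LinearMap.range_eq_top.2 κ.surjective]
  · exact h2 i h

noncomputable def meas (T T' : U →ₗ[k] U) (F : ℕ → Submodule k U) : ℕ :=
  ∑ i ∈ Finset.range (finrank k U + 1), (phi T ⊥ (F i) + phi T' ⊥ (F i))

lemma meas_symm (T T' : U →ₗ[k] U) (F : ℕ → Submodule k U) : meas T' T F = meas T T' F := by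
  unfold meas; exact Finset.sum_congr rfl (fun i _ => add_comm _ _)

lemma Step.meas_lt {T T' : U →ₗ[k] U} (hT : Pr T T') {F : ℕ → Submodule k U} {t : ℕ} {w : U}
    (s : Step T T' F t w) (hF : IsFlag F) :
    meas T T' (Function.update F (t+1) (F t ⊔ span k {w})) < meas T T' F := by
  unfold meas
  have ht := s.ht
  have lt1 : phi T ⊥ (F t ⊔ span k {w}) + phi T' ⊥ (F t ⊔ span k {w}) <
      phi T ⊥ (F (t+1)) + phi T' ⊥ (F (t+1)) := by
    have h1 : phi T' ⊥ (F t ⊔ span k {w}) = phi T' ⊥ (F t) := by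
      rw [phi_bot, phi_bot, s.bE]
    have h2 := phi_inc T ⊥ (le_sup_left : F t ≤ F t ⊔ span k {w})
    rw [s.dimE hF, hF.dim t (by omega)] at h2
    have h3 := s.ja
    have h4 := s.jb
    omega
  apply Finset.sum_lt_sum
  · intro i hi
    by_cases h : i = t + 1
    · subst h; rw [Function.update_self]; exact lt1.le
    · rw [Function.update_of_ne h]
  · exact ⟨t+1, by simp; omega, by rw [Function.update_self]; exact lt1⟩

lemma Step.flag {T T' : U →ₗ[k] U} {F : ℕ → Submodule k U} {t : ℕ} {w : U}
    (s : Step T T' F t w) (hF : IsFlag F) :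
    IsFlag (Function.update F (t+1) (F t ⊔ span k {w})) :=
  hF.update le_sup_left (s.leE hF) (s.dimE hF)

lemma FLe_update {T T' : U →ₗ[k] U} {F G : ℕ → Submodule k U} {t : ℕ} {E E' : Submodule k U}
    (h : FLeOn (Set.Iic (finrank k U)) T T' G F)
    (h1 : phi T' ⊥ E ≤ phi T' ⊥ E') (h2 : phi T ⊥ E ≤ phi T ⊥ E')
    (h3 : ∀ j ≤ finrank k U, t + 2 ≤ j → phi T (G j) E ≤ phi T (F j) E')
    (h4 : ∀ i ≤ t, phi T E (G i) ≤ phi T E' (F i)) :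
    FLeOn (Set.Iic (finrank k U)) T T' (Function.update G (t+1) E) (Function.update F (t+1) E') := by
  refine ⟨fun i hi => ?_, fun i hi => ?_, fun i hi j hj hij => ?_⟩
  · by_cases e : i = t + 1
    · subst e; simpa using h2
    · simpa [Function.update_of_ne e] using h.a i hi
  · by_cases e : i = t + 1
    · subst e; simpa using h1
    · simpa [Function.update_of_ne e] using h.b i hi
  · by_cases e : i = t + 1
    · subst e
      rw [Function.update_self, Function.update_self, Function.update_of_ne (by omega),
        Function.update_of_ne (by omega)]
      exact h3 j hj (by omega)
    · by_cases e' : j = t + 1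
      · subst e'
        rw [Function.update_self, Function.update_self, Function.update_of_ne (by omega),
          Function.update_of_ne (by omega)]
        exact h4 i (by omega)
      · simpa [Function.update_of_ne e, Function.update_of_ne e'] using h.c i hi j hj hij

lemma Step.FLe_update {T T' : U →ₗ[k] U} (hT : Pr T T') {F G : ℕ → Submodule k U} {t : ℕ} {w w' : U}
    (hF : IsFlag F) (hG : IsFlag G)
    (s : Step T T' F t w) (s' : Step T T' G t w') (h : FLeOn (Set.Iic (finrank k U)) T T' G F)
    (h' : FLeOn (Set.Iic (finrank k U)) T T' F G) :
    FLeOn (Set.Iic (finrank k U)) T T' (Function.update G (t+1) (G t ⊔ span k {w'}))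
      (Function.update F (t+1) (F t ⊔ span k {w})) := by
  have ht := s.ht
  have all : ∀ i ≤ finrank k U, ∀ j ≤ finrank k U, phi T (G j) (G i) ≤ phi T (F j) (F i) :=
    fun i hi j hj => h.all hT hG.mono hF.mono hi hj
  have b1 : phi T' ⊥ (G t ⊔ span k {w'}) = phi T' ⊥ (G t) := by rw [phi_bot, phi_bot, s'.bE]
  have b2 : phi T' ⊥ (F t ⊔ span k {w}) = phi T' ⊥ (F t) := by rw [phi_bot, phi_bot, s.bE]
  have hb : phi T' ⊥ (G t) ≤ phi T' ⊥ (F t) := h.b t (by simp; omega)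
  have hb' : phi T' ⊥ (F t) ≤ phi T' ⊥ (G t) := h'.b t (by simp; omega)
  apply FC.FLe_update h
  · rw [b1, b2]; exact hb
  · have h1 := s.aE2 hT hF
    have h2 := s'.aE2 hT hG
    have h3 := all t (by omega) (t+2) ht
    omega
  · intro j hj hj2
    rw [s.cE hT (hF.mono hj2 s.w2), s'.cE hT (hG.mono hj2 s'.w2)]
    exact all t (by omega) j hj
  · intro i hi
    have h1 := s.cE2 hT hF (hF.mono hi)
    have h2 := s'.cE2 hT hG (hG.mono hi)
    have h3 := all i (by omega) (t+2) ht
    omega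

theorem thmC (m : ℕ) : ∀ {T T' : U →ₗ[k] U} (hT : Pr T T') {F G : ℕ → Submodule k U}
    (hF : IsFlag F) (hG : IsFlag G) (hm : meas T T' F ≤ m)
    (h : FLeOn (Set.Iic (finrank k U)) T T' G F) (h' : FLeOn (Set.Iic (finrank k U)) T T' F G),
    ∃ κ : U ≃ₗ[k] U, (∀ x, κ (T x) = T (κ x)) ∧ ∀ i, G i = Submodule.map (κ : U →ₗ[k] U) (F i) := by
  induction m using Nat.strong_induction_on with
  | _ m ih =>
  intro T T' hT F G hF hG hm h h'
  have step : ∀ {T T' : U →ₗ[k] U} (hT : Pr T T') (hm : meas T T' F ≤ m)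
    (h : FLeOn (Set.Iic (finrank k U)) T T' G F) (h' : FLeOn (Set.Iic (finrank k U)) T T' F G)
    {t : ℕ} {w : U} (s : Step T T' F t w), 
    ∃ κ : U ≃ₗ[k] U, (∀ x, κ (T x) = T (κ x)) ∧ ∀ i, G i = Submodule.map (κ : U →ₗ[k] U) (F i) := by
    intro T T' hT hm h h' t w s
    have ht := s.ht
    have ea : ∀ i ≤ finrank k U, phi T ⊥ (G i) = phi T ⊥ (F i) := fun i hi =>
      le_antisymm (h.a i hi) (h'.a i hi)
    have eb : ∀ i ≤ finrank k U, phi T' ⊥ (G i) = phi T' ⊥ (F i) := fun i hi =>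
      le_antisymm (h.b i hi) (h'.b i hi)
    obtain ⟨w', s'⟩ := exists_step (T := T) (T' := T') hG ht
      (by rw [ea _ (by omega), ea _ (by omega)]; exact s.ja)
      (by rw [eb _ (by omega), eb _ (by omega)]; exact s.jb)
      (by rw [eb _ (by omega), eb _ (by omega)]; exact s.nb)
    have hlt := s.meas_lt hT hF
    obtain ⟨κ, hκ, hi⟩ := ih _ (lt_of_lt_of_le hlt hm) hT (s.flag hF) (s'.flag hG) le_rfl
      (s.FLe_update hT hF hG s' h h') (s'.FLe_update hT hG hF s h' h)
    have hκ' := comm_symm hT hκ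
    have hF' := hF.map κ
    obtain ⟨κ2, k1, k2⟩ := adj hT hF' hG (t := t) (w := κ w) ht (fun i hne => by
        have := hi i
        rw [Function.update_of_ne hne, Function.update_of_ne hne] at this
        exact this.symm)
      (by rw [map_comm_phi_bot hκ, map_comm_phi_bot hκ]; exact s.ja) s'.ja
      (mem_map_of_mem s.w2)
      (fun hh => by
        obtain ⟨x, hx, hxe⟩ := hh
        have : x = w := κ.injective hxe
        exact s.w1 (this ▸ hx))
      (fun hh => by
        have e := hi (t+1)
        rw [Function.update_self, Function.update_self] at e
        have e0 := hi t
        rw [Function.update_of_ne (by omega), Function.update_of_ne (by omega)] at e0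
        have l : G t ⊔ span k {w'} ≤ G (t+1) := by
          rw [e, Submodule.map_sup, ← e0, Submodule.map_span, Set.image_singleton]
          exact sup_le (hG.mono (by omega)) ((span_singleton_le_iff_mem _ _).2 hh)
        have e2 := Submodule.eq_of_le_of_finrank_eq l
          (by rw [s'.dimE hG, hG.dim _ (by omega)])
        have j := s'.jb
        rw [phi_bot, phi_bot, ← e2, s'.bE] at j
        exact lt_irrefl _ j)
      (by rw [← hκ', s.tw, map_zero])
    refine ⟨κ.trans κ2, fun x => ?_, fun i => ?_⟩
    · simp only [LinearEquiv.trans_apply]; rw [hκ, k1]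
    · rw [k2 i, ← Submodule.map_comp]; rfl
  rcases exists_step_or hT hF with ⟨t, w, s⟩ | ⟨t, w, s⟩ | hb
  · exact step hT hm h h' s
  · obtain ⟨κ, k1, k2⟩ := step hT.symm (by rw [meas_symm]; exact hm) (h.symm hT hG.mono hF.mono)
      (h'.symm hT hF.mono hG.mono) s
    exact ⟨κ, comm_symm hT.symm k1, k2⟩
  · exact base hT hF hG hb (fun i hi => le_antisymm (h.a i hi) (h'.a i hi))
      (fun i hi => le_antisymm (h.b i hi) (h'.b i hi))

end core2
end FC

set_option linter.unusedSectionVars false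
set_option linter.unusedVariables false
set_option maxHeartbeats 1000000
namespace FC
open Submodule Module
section core3
variable {k U : Type} [Field k] [Infinite k] [AddCommGroup U] [Module k U] [FiniteDimensional k U]

lemma avoid {P : Submodule k U} {Zf : Set (Submodule k U)} (hfin : Zf.Finite)
    (h : ∀ Z ∈ Zf, ¬ P ≤ Z) : ∃ v ∈ P, ∀ Z ∈ Zf, v ∉ Z := by
  classical
  set s : Finset (Subspace k P) := hfin.toFinset.image (fun Z => comap P.subtype Z) with hs
  have ht : (⊤ : Subspace k P) ∉ s := by
    rw [hs, Finset.mem_image]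
    rintro ⟨Z, hZ, hZt⟩
    rw [hfin.mem_toFinset] at hZ
    apply h Z hZ
    intro x hx
    have : (⟨x, hx⟩ : P) ∈ comap P.subtype Z := by rw [hZt]; trivial
    exact this
  have := Subspace.biUnion_ne_univ_of_top_notMem ht
  rw [Ne, Set.eq_univ_iff_forall] at this
  push Not at this
  obtain ⟨⟨v, hv⟩, hvn⟩ := this
  refine ⟨v, hv, fun Z hZ hvZ => hvn ?_⟩
  simp only [Set.mem_iUnion]
  exact ⟨comap P.subtype Z, by rw [hs, Finset.mem_image]; exact ⟨Z, by simpa using hZ, rfl⟩, hvZ⟩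

structure FlagOn (C : Set ℕ) (F : ℕ → Submodule k U) : Prop where
  mono : ∀ i ∈ C, ∀ j ∈ C, i ≤ j → F i ≤ F j
  dim : ∀ i ∈ C, finrank k (F i) = i

lemma phi_gen (f : U →ₗ[k] U) (S : Submodule k U) {F0 F1 : Submodule k U} {v : U}
    (h01 : F0 ≤ F1)
    (h : ¬ (F1 ≤ Zs f S F0) → v ∉ Zs f S F0) :
    phi f S F1 ≤ phi f S (F0 ⊔ span k {v}) ∨ phi f S F0 + 1 ≤ phi f S (F0 ⊔ span k {v}) := by
  by_cases hle : F1 ≤ Zs f S F0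
  · left
    have e := phi_formula f S h01
    rw [inf_eq_left.2 hle] at e
    have := phi_mono f S (le_sup_left : F0 ≤ F0 ⊔ span k {v})
    omega
  · right
    have hv := h hle
    unfold phi
    rw [Submodule.map_sup, Submodule.map_span, Set.image_singleton, sup_right_comm,
      finrank_sup_span (show f v ∉ Submodule.map f F0 ⊔ S from hv)]

lemma refine_step {T T' : U →ₗ[k] U} (hT : Pr T T') {C : Set ℕ} {F : ℕ → Submodule k U}
    (hF : FlagOn C F) (hC : C ⊆ Set.Iic (finrank k U)) (hN : finrank k U ∈ C) {c : ℕ} (hc : c ∈ C)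
    (hcN : c < finrank k U) (hc1 : c + 1 ∉ C) :
    ∃ E, FlagOn (insert (c+1) C) (Function.update F (c+1) E) ∧
      ∀ G : ℕ → Submodule k U, IsFlag G → FLeOn C T T' G F →
        FLeOn (insert (c+1) C) T T' G (Function.update F (c+1) E) := by
  classical
  have hex : ∃ c', c' ∈ C ∧ c < c' := ⟨_, hN, hcN⟩
  obtain ⟨hc'C, hcc'⟩ := Nat.find_spec hex
  have hmin : ∀ j ∈ C, c < j → Nat.find hex ≤ j := fun j hj h => Nat.find_min' hex ⟨hj, h⟩
  generalize Nat.find hex = c' at hc'C hcc' hmin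
  have hc'2 : c + 2 ≤ c' := by
    rcases Nat.lt_or_ge (c+1) c' with h | h
    · omega
    · have : c' = c + 1 := by omega
      subst this; exact absurd hc'C hc1
  have hc'N : c' ≤ finrank k U := hC hc'C
  have hle : F c ≤ F c' := hF.mono c hc c' hc'C (by omega)
  have dc := hF.dim c hc
  have dc' := hF.dim c' hc'C
  let Zf : Set (Submodule k U) := {Z | (Z = F c ∨ Z = Zs T ⊥ (F c) ∨ Z = Zs T' ⊥ (F c) ∨
    (∃ i ∈ C, Z = Zs LinearMap.id (Submodule.map T (F i)) (F c)) ∨ ∃ j ∈ C, Z = Zs T (F j) (F c)) ∧ ¬ F c' ≤ Z}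
  have hCf : C.Finite := (Set.finite_Iic _).subset hC
  have hfin : Zf.Finite := by
    have hf2 : (({F c, Zs T ⊥ (F c), Zs T' ⊥ (F c)} : Set (Submodule k U)) ∪
      ((fun i => Zs LinearMap.id (Submodule.map T (F i)) (F c)) '' C) ∪
      ((fun i => Zs T (F i) (F c)) '' C)).Finite :=
      ((Set.toFinite _).union (hCf.image _)).union (hCf.image _)
    apply hf2.subset
    rintro Z ⟨rfl | rfl | rfl | ⟨i, hi, rfl⟩ | ⟨j, hj, rfl⟩, -⟩
    · left; left; simp
    · left; left; simp
    · left; left; simp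
    · left; right; exact ⟨i, hi, rfl⟩
    · right; exact ⟨j, hj, rfl⟩
  obtain ⟨v, hv, hvZ⟩ := avoid hfin (P := F c') (fun Z hZ => hZ.2)
  have hvc : v ∉ F c := hvZ _ ⟨Or.inl rfl, fun h => by
    have := finrank_mono h; omega⟩
  set E := F c ⊔ span k {v} with hE
  have dE : finrank k E = c + 1 := by rw [hE, finrank_sup_span hvc, dc]
  have lE0 : F c ≤ E := le_sup_left
  have lE1 : E ≤ F c' := sup_le hle ((span_singleton_le_iff_mem _ _).2 hv)
  refine ⟨E, ⟨?_, ?_⟩, ?_⟩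
  · intro i hi j hj hij
    by_cases ei : i = c + 1 <;> by_cases ej : j = c + 1
    · subst ei; subst ej; exact le_rfl
    · subst ei
      rw [Function.update_self, Function.update_of_ne ej]
      have hj' : j ∈ C := hj.resolve_left ej
      exact lE1.trans (hF.mono _ hc'C _ hj' (hmin j hj' (by omega)))
    · subst ej
      rw [Function.update_self, Function.update_of_ne ei]
      exact (hF.mono _ (hi.resolve_left ei) _ hc (by omega)).trans lE0
    · rw [Function.update_of_ne ei, Function.update_of_ne ej]
      exact hF.mono _ (hi.resolve_left ei) _ (hj.resolve_left ej) hij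
  · intro i hi
    by_cases ei : i = c + 1
    · subst ei; rw [Function.update_self]; exact dE
    · rw [Function.update_of_ne ei]; exact hF.dim _ (hi.resolve_left ei)
  · intro G hG h
    have lG0 : G c ≤ G (c+1) := hG.mono (by omega)
    have lG1 : G (c+1) ≤ G c' := hG.mono (by omega)
    have dG0 := hG.dim c (by omega)
    have dG1 := hG.dim (c+1) (by omega)
    have all : ∀ i ∈ C, ∀ j ∈ C, i ≤ j → phi T (G j) (G i) ≤ phi T (F j) (F i) := by
      intro i hi j hj hij
      rcases hij.lt_or_eq with h1 | rfl
      · exact h.c i hi j hj h1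
      · rw [hT.phi_ge le_rfl, hT.phi_ge le_rfl]
        exact Nat.add_le_add (h.a i hi) (h.b i hi)
    -- general principle
    have key : ∀ (f : U →ₗ[k] U) (S S' : Submodule k U),
        (¬ (F c' ≤ Zs f S (F c)) → Zs f S (F c) ∈ Zf) →
        phi f S' (G c) ≤ phi f S (F c) → phi f S' (G c') ≤ phi f S (F c') →
        phi f S' (G (c+1)) ≤ phi f S E := by
      intro f S S' hZ h0 h1
      have i0 := phi_inc f S' lG0
      have i1 := phi_mono f S' lG1
      rcases phi_gen f S (v := v) hle (fun hh => hvZ _ (hZ hh)) with h2 | h2 <;> rw [← hE] at h2 <;> omega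
    refine ⟨fun i hi => ?_, fun i hi => ?_, fun i hi j hj hij => ?_⟩
    · by_cases ei : i = c + 1
      · subst ei; rw [Function.update_self]
        exact key T ⊥ ⊥ (fun hh => ⟨Or.inr (Or.inl rfl), hh⟩) (h.a _ hc) (h.a _ hc'C)
      · rw [Function.update_of_ne ei]; exact h.a _ (hi.resolve_left ei)
    · by_cases ei : i = c + 1
      · subst ei; rw [Function.update_self]
        exact key T' ⊥ ⊥ (fun hh => ⟨Or.inr (Or.inr (Or.inl rfl)), hh⟩) (h.b _ hc) (h.b _ hc'C)
      · rw [Function.update_of_ne ei]; exact h.b _ (hi.resolve_left ei)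
    · by_cases ei : i = c + 1
      · subst ei
        rw [Function.update_self, Function.update_of_ne (by omega)]
        have hj' : j ∈ C := hj.resolve_left (by omega)
        exact key T (F j) (G j) (fun hh => ⟨Or.inr (Or.inr (Or.inr (Or.inr ⟨j, hj', rfl⟩))), hh⟩)
          (all _ hc _ hj' (by omega)) (all _ hc'C _ hj' (hmin j hj' (by omega)))
      · have hi' : i ∈ C := hi.resolve_left ei
        by_cases ej : j = c + 1
        · subst ej
          rw [Function.update_self, Function.update_of_ne ei, phi_id T (G i), phi_id T (F i)]
          refine key LinearMap.id _ _
            (fun hh => ⟨Or.inr (Or.inr (Or.inr (Or.inl ⟨i, hi', rfl⟩))), hh⟩) ?_ ?_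
          · rw [← phi_id, ← phi_id]; exact all _ hi' _ hc (by omega)
          · rw [← phi_id, ← phi_id]; exact all _ hi' _ hc'C (by omega)
        · rw [Function.update_of_ne ei, Function.update_of_ne ej]
          exact h.c _ hi' _ (hj.resolve_left ej) hij

lemma refine_all {T T' : U →ₗ[k] U} (hT : Pr T T') (m : ℕ) : ∀ {C : Set ℕ} {F : ℕ → Submodule k U}
    (hF : FlagOn C F) (hC : C ⊆ Set.Iic (finrank k U)) (h0 : 0 ∈ C) (hN : finrank k U ∈ C)
    (hm : (Set.Iic (finrank k U) \ C).ncard ≤ m),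
    ∃ F', FlagOn (Set.Iic (finrank k U)) F' ∧ (∀ i ∈ C, F' i = F i) ∧
      ∀ G : ℕ → Submodule k U, IsFlag G → FLeOn C T T' G F →
        FLeOn (Set.Iic (finrank k U)) T T' G F' := by
  classical
  induction m with
  | zero =>
    intro C F hF hC h0 hN hm
    have he : Set.Iic (finrank k U) \ C = ∅ := by
      rw [← Set.ncard_eq_zero ((Set.finite_Iic _).subset Set.sdiff_subset)]; omega
    have : C = Set.Iic (finrank k U) := Set.Subset.antisymm hC (Set.sdiff_eq_empty.1 he)
    subst this
    exact ⟨F, hF, fun i _ => rfl, fun G hG h => h⟩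
  | succ m ih =>
    intro C F hF hC h0 hN hm
    by_cases hex : ∃ c, c ∉ C ∧ c ≤ finrank k U
    · obtain ⟨h1, h2⟩ := Nat.find_spec hex
      have hmin : ∀ j, j < Nat.find hex → j ≤ finrank k U → j ∈ C := fun j hj hjN => by
        by_contra hn; exact Nat.find_min hex hj ⟨hn, hjN⟩
      generalize Nat.find hex = c1 at h1 h2 hmin
      obtain ⟨c, rfl⟩ : ∃ c, c1 = c + 1 := Nat.exists_eq_succ_of_ne_zero (by rintro rfl; exact h1 h0)
      obtain ⟨E, hE, hG⟩ := refine_step hT hF hC hN (hmin c (by omega) (by omega)) (by omega) h1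
      obtain ⟨F', f1, f2, f3⟩ := ih hE (by
          intro x hx; rcases hx with rfl | hx
          · exact h2
          · exact hC hx) (Or.inr h0) (Or.inr hN) (by
          have e : Set.Iic (finrank k U) \ insert (c+1) C = (Set.Iic (finrank k U) \ C) \ {c+1} := by
            ext x; simp only [Set.mem_sdiff, Set.mem_insert_iff, Set.mem_singleton_iff]; tauto
          have := Set.ncard_sdiff_singleton_lt_of_mem
            (show c + 1 ∈ Set.Iic (finrank k U) \ C from ⟨h2, h1⟩)
            ((Set.finite_Iic _).subset Set.sdiff_subset)
          rw [e]; omega)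
      refine ⟨F', f1, fun i hi => ?_, fun G hGf h => f3 G hGf (hG G hGf h)⟩
      rw [f2 i (Or.inr hi), Function.update_of_ne (by rintro rfl; exact h1 hi)]
    · push Not at hex
      have : C = Set.Iic (finrank k U) := Set.Subset.antisymm hC (fun x hx => by
        by_contra hn; have := hex x hn; simp only [Set.mem_Iic] at hx; omega)
      subst this
      exact ⟨F, hF, fun i _ => rfl, fun G hG h => h⟩

lemma FLeOn.congr {C : Set ℕ} {T T' : U →ₗ[k] U} {G F G' F' : ℕ → Submodule k U}
    (h : FLeOn C T T' G F) (hG : ∀ i ∈ C, G' i = G i) (hF : ∀ i ∈ C, F' i = F i) :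
    FLeOn C T T' G' F' :=
  ⟨fun i hi => by rw [hG i hi, hF i hi]; exact h.a i hi,
   fun i hi => by rw [hG i hi, hF i hi]; exact h.b i hi,
   fun i hi j hj hij => by rw [hG i hi, hF i hi, hG j hj, hF j hj]; exact h.c i hi j hj hij⟩

lemma refine_flag {T T' : U →ₗ[k] U} (hT : Pr T T') {C : Set ℕ} {F : ℕ → Submodule k U}
    (hF : IsFlag F) (hC : C ⊆ Set.Iic (finrank k U)) (h0 : 0 ∈ C) (hN : finrank k U ∈ C) :
    ∃ F', IsFlag F' ∧ (∀ i ∈ C, F' i = F i) ∧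
      ∀ G : ℕ → Submodule k U, IsFlag G → FLeOn C T T' G F →
        FLeOn (Set.Iic (finrank k U)) T T' G F' := by
  classical
  obtain ⟨F', f1, f2, f3⟩ := refine_all hT _ (C := C) (F := F)
    ⟨fun i _ j _ hij => hF.mono hij, fun i hi => hF.dim i (hC hi)⟩ hC h0 hN le_rfl
  have e : ∀ i ∈ Set.Iic (finrank k U), (fun i => if i ≤ finrank k U then F' i else ⊤) i = F' i :=
    fun i hi => if_pos hi
  refine ⟨fun i => if i ≤ finrank k U then F' i else ⊤, ⟨?_, ?_⟩, ?_, ?_⟩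
  · intro i j hij
    by_cases hj : j ≤ finrank k U
    · simp only [hj, hij.trans hj, if_true]
      exact f1.mono _ (hij.trans hj) _ hj hij
    · simp [hj]
  · intro i hi
    exact (congrArg (fun S : Submodule k U => finrank k S) (e i hi)).trans (f1.dim i hi)
  · intro i hi
    rw [e i (hC hi), f2 i hi]
  · intro G hG h
    exact (f3 G hG h).congr (fun i _ => rfl) e

theorem coreC {T T' : U →ₗ[k] U} (hT : Pr T T') {C : Set ℕ} {F G : ℕ → Submodule k U}
    (hF : IsFlag F) (hG : IsFlag G) (hC : C ⊆ Set.Iic (finrank k U)) (h0 : 0 ∈ C)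
    (hN : finrank k U ∈ C) (h : FLeOn C T T' G F) (h' : FLeOn C T T' F G) :
    ∃ κ : U ≃ₗ[k] U, (∀ x, κ (T x) = T (κ x)) ∧ ∀ i ∈ C, G i = Submodule.map (κ : U →ₗ[k] U) (F i) := by
  obtain ⟨F', f1, f2, f3⟩ := refine_flag hT hF hC h0 hN
  obtain ⟨G', g1, g2, g3⟩ := refine_flag hT hG hC h0 hN
  obtain ⟨κ, k1, k2⟩ := thmC _ hT f1 g1 le_rfl
    (f3 G' g1 (h.congr g2 (fun i _ => rfl))) (g3 F' f1 (h'.congr f2 (fun i _ => rfl)))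
  exact ⟨κ, k1, fun i hi => by rw [← g2 i hi, k2 i, f2 i hi]⟩

end core3
end FC

set_option linter.unusedSectionVars false
set_option linter.unusedVariables false
set_option maxHeartbeats 1000000
namespace FC
open Submodule Module
section core4
variable {k : Type} [Field k] {N : ℕ}

def Est (k : Type) [Field k] (N : ℕ) (i : ℕ) : Submodule k (Fin N → k) where
  carrier := {v | ∀ j : Fin N, i ≤ j → v j = 0}
  add_mem' := fun {a b} ha hb j hj => by simp [ha j hj, hb j hj]
  zero_mem' := fun j _ => rfl
  smul_mem' := fun c x hx j hj => by simp [hx j hj]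

lemma mem_Est {i : ℕ} {v : Fin N → k} : v ∈ Est k N i ↔ ∀ j : Fin N, i ≤ j → v j = 0 := Iff.rfl

def Fl (g : Matrix (Fin N) (Fin N) k) (i : ℕ) : Submodule k (Fin N → k) :=
  Submodule.map g.mulVecLin (Est k N i)

lemma Fl_eq_span (g : Matrix (Fin N) (Fin N) k) (i : ℕ) :
    Fl g i = span k ((fun j => g.col j) '' {j : Fin N | (j : ℕ) < i}) := by
  apply le_antisymm
  · rintro _ ⟨v, hv, rfl⟩
    rw [Matrix.mulVecLin_apply, Matrix.mulVec_eq_sum]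
    simp only [op_smul_eq_smul]
    refine sum_mem (fun j _ => ?_)
    by_cases hj : (j : ℕ) < i
    · exact smul_mem _ _ (subset_span ⟨j, hj, rfl⟩)
    · have := hv j (by omega)
      rw [this]; simp
  · rw [span_le]
    rintro _ ⟨j, hj, rfl⟩
    refine ⟨Pi.single j 1, fun l hl => ?_, ?_⟩
    · rw [Pi.single_eq_of_ne]
      rintro rfl
      have : (l : ℕ) < i := hj
      omega
    · rw [Matrix.mulVecLin_apply, Matrix.mulVec_single_one]

lemma Fl_one (i : ℕ) : Fl (1 : Matrix (Fin N) (Fin N) k) i = Est k N i := by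
  unfold Fl; rw [Matrix.mulVecLin_one, Submodule.map_id]

lemma Fl_mul (g h : Matrix (Fin N) (Fin N) k) (i : ℕ) :
    Fl (g * h) i = Submodule.map g.mulVecLin (Fl h i) := by
  unfold Fl; rw [Matrix.mulVecLin_mul, Submodule.map_comp]

lemma Fl_mul' (g h : Matrix (Fin N) (Fin N) k) (i : ℕ) (hh : Fl h i = Est k N i) :
    Fl (g * h) i = Fl g i := by
  rw [Fl_mul, hh]; rfl

lemma Fl_succ (g : Matrix (Fin N) (Fin N) k) (t : Fin N) :
    Fl g (t + 1) = Fl g t ⊔ span k {g.col t} := by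
  rw [Fl_eq_span, Fl_eq_span, ← span_union]
  congr 1
  ext v
  simp only [Set.mem_image, Set.mem_ofPred_eq, Set.mem_union, Set.mem_singleton_iff]
  constructor
  · rintro ⟨j, hj, rfl⟩
    rcases Nat.lt_succ_iff_lt_or_eq.1 hj with h | h
    · exact Or.inl ⟨j, h, rfl⟩
    · right; rw [Fin.ext h]
  · rintro (⟨j, hj, rfl⟩ | rfl)
    · exact ⟨j, by omega, rfl⟩
    · exact ⟨t, by omega, rfl⟩

lemma Fl_mono (g : Matrix (Fin N) (Fin N) k) : Monotone (Fl g) := fun i j hij =>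
  Submodule.map_mono (fun v hv l hl => hv l (hij.trans hl))

lemma Fl_zero (g : Matrix (Fin N) (Fin N) k) : Fl g 0 = ⊥ := by
  rw [Fl_eq_span]; simp

lemma Est_finrank : ∀ i ≤ N, finrank k (Est k N i) = i := by
  intro i
  induction i with
  | zero => intro _; rw [← Fl_one, Fl_zero, finrank_bot]
  | succ i ih =>
    intro hi
    have h := Fl_succ (1 : Matrix (Fin N) (Fin N) k) ⟨i, hi⟩
    rw [Fl_one, Fl_one] at h
    simp only at h
    rw [h, finrank_sup_span, ih (by omega)]
    intro hm
    have := hm ⟨i, hi⟩ le_rfl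
    simp [Matrix.col_apply] at this

lemma inj_of_unit {g : Matrix (Fin N) (Fin N) k} (hg : IsUnit g) :
    Function.Injective g.mulVecLin := Matrix.mulVec_injective_iff_isUnit.2 hg

lemma surj_of_unit {g : Matrix (Fin N) (Fin N) k} (hg : IsUnit g) :
    Function.Surjective g.mulVecLin := Matrix.mulVec_surjective_iff_isUnit.2 hg

lemma Fl_flag {g : Matrix (Fin N) (Fin N) k} (hg : IsUnit g) : IsFlag (Fl g) := by
  refine ⟨Fl_mono g, fun i hi => ?_⟩
  rw [finrank_fin_fun] at hi
  rw [Fl, (Submodule.equivMapOfInjective _ (inj_of_unit hg) _).symm.finrank_eq, Est_finrank i hi]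

lemma exists_mat {F : ℕ → Submodule k (Fin N → k)} (hF : IsFlag F) :
    ∃ γ : Matrix (Fin N) (Fin N) k, IsUnit γ ∧ ∀ i, Fl γ i = F i := by
  have hN := finrank_fin_fun k (n := N)
  have h : ∀ t : Fin N, ∃ v ∈ F (t+1), v ∉ F t := fun t => exists_new hF (by rw [hN]; exact t.2)
  choose v v1 v2 using h
  let γ : Matrix (Fin N) (Fin N) k := Matrix.of (fun j t => v t j)
  have hcol : ∀ t, γ.col t = v t := fun t => rfl
  have h0 : F 0 = ⊥ := by
    have := hF.dim 0 (Nat.zero_le _); rwa [Submodule.finrank_eq_zero] at this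
  have key : ∀ i ≤ N, Fl γ i = F i := by
    intro i
    induction i with
    | zero => intro _; rw [Fl_zero, h0]
    | succ i ih =>
      intro hi
      rw [Fl_succ γ ⟨i, hi⟩]
      simp only
      rw [ih (by omega), hcol, span_step hF (by rw [hN]; exact hi) (v1 ⟨i, hi⟩) (v2 ⟨i, hi⟩)]
  have hFN : F N = ⊤ := hF.top (by rw [hN])
  have hsurj : Function.Surjective γ.mulVecLin := by
    rw [← LinearMap.range_eq_top, eq_top_iff, ← hFN, ← key N le_rfl]
    exact LinearMap.map_le_range
  refine ⟨γ, Matrix.mulVec_surjective_iff_isUnit.1 hsurj, fun i => ?_⟩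
  rcases le_total i N with hi | hi
  · exact key i hi
  · rw [hF.top (by rw [hN]; exact hi), eq_top_iff, ← hFN, ← key N le_rfl]
    exact Fl_mono γ hi

noncomputable def matE (κ : (Fin N → k) ≃ₗ[k] (Fin N → k)) : Matrix (Fin N) (Fin N) k :=
  LinearMap.toMatrix' (κ : (Fin N → k) →ₗ[k] (Fin N → k))

lemma matE_lin (κ : (Fin N → k) ≃ₗ[k] (Fin N → k)) : (matE κ).mulVecLin = κ := by
  have := Matrix.toLin'_toMatrix' (κ : (Fin N → k) →ₗ[k] (Fin N → k))
  exact this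

lemma matE_unit (κ : (Fin N → k) ≃ₗ[k] (Fin N → k)) : IsUnit (matE κ) := by
  apply Matrix.mulVec_injective_iff_isUnit.1
  have : Function.Injective (matE κ).mulVecLin := by rw [matE_lin]; exact κ.injective
  exact this

lemma matE_symm_mul (κ : (Fin N → k) ≃ₗ[k] (Fin N → k)) : matE κ * matE κ.symm = 1 := by
  unfold matE
  rw [← LinearMap.toMatrix'_mul]
  convert LinearMap.toMatrix'_one
  ext; simp

noncomputable def linE {g : Matrix (Fin N) (Fin N) k} (hg : IsUnit g) :
    (Fin N → k) ≃ₗ[k] (Fin N → k) :=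
  LinearEquiv.ofBijective g.mulVecLin ⟨inj_of_unit hg, surj_of_unit hg⟩

lemma linE_lin {g : Matrix (Fin N) (Fin N) k} (hg : IsUnit g) :
    ((linE hg : (Fin N → k) ≃ₗ[k] (Fin N → k)) : (Fin N → k) →ₗ[k] (Fin N → k)) = g.mulVecLin := by
  ext; rfl

/-! Zariski closure -/
lemma subset_Zcl (S : Set (Matrix (Fin N) (Fin N) k)) : S ⊆ Zcl S := fun x hx f hf => hf x hx

lemma Zcl_map {S S' : Set (Matrix (Fin N) (Fin N) k)}
    (φ : Matrix (Fin N) (Fin N) k → Matrix (Fin N) (Fin N) k)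
    (q : Fin N × Fin N → MvPolynomial (Fin N × Fin N) k)
    (hq : ∀ y pr, MvPolynomial.eval (fun pr : Fin N × Fin N => y pr.1 pr.2) (q pr) = φ y pr.1 pr.2)
    (h : ∀ y ∈ S, φ y ∈ Zcl S') {x} (hx : x ∈ Zcl S) : φ x ∈ Zcl S' := by
  intro f hf
  have key : ∀ y, MvPolynomial.eval (fun pr : Fin N × Fin N => y pr.1 pr.2) (MvPolynomial.bind₁ q f)
      = MvPolynomial.eval (fun pr : Fin N × Fin N => φ y pr.1 pr.2) f := by
    intro y
    rw [MvPolynomial.eval, MvPolynomial.eval₂Hom_bind₁]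
    congr 2
    funext pr
    exact hq y pr
  rw [← key]
  apply hx
  intro y hy
  rw [key]
  exact h y hy f hf

lemma Zcl_mono {S S' : Set (Matrix (Fin N) (Fin N) k)} (h : S ⊆ Zcl S') {x} (hx : x ∈ Zcl S) :
    x ∈ Zcl S' :=
  fun f hf => hx f (fun y hy => h hy f hf)

lemma Zcl_mul {S S' : Set (Matrix (Fin N) (Fin N) k)} (κ p : Matrix (Fin N) (Fin N) k)
    (h : ∀ y ∈ S, κ * y * p ∈ Zcl S') {x} (hx : x ∈ Zcl S) : κ * x * p ∈ Zcl S' := by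
  refine Zcl_map (fun y => κ * y * p)
    (fun pr => ∑ j, (∑ i, MvPolynomial.C (κ pr.1 i) * MvPolynomial.X (i, j)) *
      MvPolynomial.C (p j pr.2)) (fun y pr => ?_) h hx
  simp [Matrix.mul_apply]

lemma Zcl_line [Infinite k] {S : Set (Matrix (Fin N) (Fin N) k)} {x m : Matrix (Fin N) (Fin N) k}
    {B : Set k} (hB : B.Finite) (h : ∀ c, c ∉ B → x + c • m ∈ S) : x ∈ Zcl S := by
  intro f hf
  let p : Polynomial k := MvPolynomial.aeval
    (fun pr : Fin N × Fin N => Polynomial.C (x pr.1 pr.2) + Polynomial.X * Polynomial.C (m pr.1 pr.2)) f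
  have hp : ∀ c, p.eval c = MvPolynomial.eval (fun pr : Fin N × Fin N => (x + c • m) pr.1 pr.2) f := by
    intro c
    have h1 : p.eval c = (Polynomial.aeval c) p := by rw [Polynomial.coe_aeval_eq_eval]
    rw [h1]
    show (Polynomial.aeval c) (MvPolynomial.aeval _ f) = _
    rw [← AlgHom.comp_apply, MvPolynomial.comp_aeval]
    rw [MvPolynomial.aeval_def, MvPolynomial.eval, MvPolynomial.coe_eval₂Hom]
    congr 1
    funext pr
    simp
    ring
  have hp0 : p = 0 := by
    apply Polynomial.eq_zero_of_infinite_isRoot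
    refine Set.Infinite.mono ?_ hB.infinite_compl
    intro c hc
    show p.eval c = 0
    rw [hp]
    exact hf _ (h c hc)
  have := hp 0
  rw [hp0] at this
  simpa using this.symm

end core4
end FC

set_option linter.unusedSectionVars false
set_option linter.unusedVariables false
set_option maxHeartbeats 1000000
namespace FC
open Submodule Module
section core5
variable {k : Type} [Field k] {N : ℕ}

def Orb (T : (Fin N → k) →ₗ[k] (Fin N → k)) (F : ℕ → Submodule k (Fin N → k)) :
    Set (Matrix (Fin N) (Fin N) k) :=
  {x | IsUnit x ∧ ∃ κ : (Fin N → k) ≃ₗ[k] (Fin N → k), (∀ v, κ (T v) = T (κ v)) ∧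
    ∀ i, Fl x i = Submodule.map (κ : (Fin N → k) →ₗ[k] (Fin N → k)) (F i)}

lemma Orb_symm {T T' : (Fin N → k) →ₗ[k] (Fin N → k)} (hT : Pr T T')
    (F : ℕ → Submodule k (Fin N → k)) : Orb T' F ⊆ Orb T F := by
  rintro x ⟨hx, κ, h1, h2⟩
  exact ⟨hx, κ, comm_symm hT.symm h1, h2⟩

lemma subsing_line {U : Type} [AddCommGroup U] [Module k U] {S : Submodule k U} {u v : U}
    (hv : v ∉ S) : {c : k | u + c • v ∈ S}.Subsingleton := by
  intro a ha b hb
  by_contra hab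
  apply hv
  have h1 : (a - b) • v ∈ S := by
    have := S.sub_mem ha hb
    rwa [add_sub_add_left_eq_sub, ← sub_smul] at this
  exact (S.smul_mem_iff (sub_ne_zero.2 hab)).1 h1

lemma claim1 [Infinite k] {T T' : (Fin N → k) →ₗ[k] (Fin N → k)} (hT : Pr T T')
    {F : ℕ → Submodule k (Fin N → k)} (hF : IsFlag F) {t : ℕ} {w : Fin N → k}
    (s : Step T T' F t w) {x : Matrix (Fin N) (Fin N) k} (hx : IsUnit x)
    (hxF : ∀ i, i ≠ t + 1 → Fl x i = F i) : x ∈ Zcl (Orb T F) := by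
  classical
  have hN := finrank_fin_fun k (n := N)
  have ht := s.ht
  obtain ⟨v, v1, v2⟩ := exists_new hF (t := t) (by omega)
  have htN : t < N := by omega
  let τ : Fin N := ⟨t, htN⟩
  let m : Matrix (Fin N) (Fin N) k := Matrix.of fun i j => if j = τ then v i else 0
  let u := x.col τ
  have hcolne : ∀ (c : k) (j : Fin N), j ≠ τ → (x + c • m).col j = x.col j := by
    intro c j hj; ext i; simp [m, Matrix.col_apply, hj]
  have hcol : ∀ (c : k), (x + c • m).col τ = u + c • v := by
    intro c; ext i; simp [m, u, Matrix.col_apply]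
  have hdet : ∀ c : k, (x + c • m).det = x.det + c * (x.updateCol τ v).det := by
    intro c
    have : x + c • m = x.updateCol τ (x.col τ + c • v) := by
      ext i j
      by_cases hj : j = τ
      · subst hj; simp [m, Matrix.col_apply]
      · simp [m, hj]
    rw [this, Matrix.det_updateCol_add, Matrix.det_updateCol_smul]
    congr 1
    congr 1
    ext i j
    by_cases hj : j = τ
    · subst hj; simp [Matrix.col_apply]
    · simp [hj]
  have hxdet : x.det ≠ 0 := (Matrix.isUnit_iff_isUnit_det x).1 hx |>.ne_zero
  have hB1 : {c : k | u + c • v ∈ comap T (Submodule.map T (F t))}.Subsingleton :=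
    subsing_line (jump_notMem hF (by omega) s.ja v1 v2)
  have hB2 : {c : k | u + c • v ∈ F t ⊔ span k {w}}.Subsingleton := by
    apply subsing_line
    intro hh
    have : F t ⊔ span k {w} ≤ comap T' (Submodule.map T' (F t)) := by
      refine sup_le (le_comap_map _ _) ((span_singleton_le_iff_mem _ _).2 ?_)
      rw [mem_comap, s.tw]; exact zero_mem _
    exact jump_notMem hF (by omega) s.jb v1 v2 (this hh)
  have hB3 : {c : k | x.det + c * (x.updateCol τ v).det = 0}.Subsingleton := by
    intro a ha b hb
    simp only [Set.mem_ofPred_eq] at ha hb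
    have h1 : (a - b) * (x.updateCol τ v).det = 0 := by linear_combination ha - hb
    rcases mul_eq_zero.1 h1 with h | h
    · exact sub_eq_zero.1 h
    · rw [h] at ha; simp at ha; exact absurd ha hxdet
  refine Zcl_line (m := m) ((hB1.finite.union hB2.finite).union hB3.finite) (fun c hc => ?_)
  simp only [Set.mem_union, not_or] at hc
  obtain ⟨⟨c1, c2⟩, c3⟩ := hc
  have hy : IsUnit (x + c • m) := by
    rw [Matrix.isUnit_iff_isUnit_det, hdet]
    exact isUnit_iff_ne_zero.2 c3
  have hyF := Fl_flag hy
  have hlow : ∀ i ≤ t, Fl (x + c • m) i = F i := by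
    intro i hi
    rw [← hxF i (by omega), Fl_eq_span, Fl_eq_span]
    congr 1
    apply Set.image_congr
    intro j hj
    have : (j : ℕ) < i := hj
    exact hcolne c j (by rintro rfl; simp only [τ] at this; omega)
  have hx2 : u ∈ F (t+2) := by
    rw [← hxF (t+2) (by omega), Fl_eq_span]
    exact subset_span ⟨τ, by simp [τ], rfl⟩
  have hhigh : ∀ i, t + 2 ≤ i → Fl (x + c • m) i = F i := by
    intro i hi
    have hle : Fl (x + c • m) i ≤ F i := by
      rw [Fl_eq_span, span_le]
      rintro _ ⟨j, hj, rfl⟩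
      by_cases hjt : j = τ
      · subst hjt
        simp only
        rw [hcol]
        exact hF.mono hi (add_mem hx2 (smul_mem _ _ (hF.mono (by omega) v1)))
      · simp only
        rw [hcolne c j hjt, ← hxF i (by omega), Fl_eq_span]
        exact subset_span ⟨j, hj, rfl⟩
    rcases le_total i (finrank k (Fin N → k)) with h | h
    · exact Submodule.eq_of_le_of_finrank_eq hle (by rw [hyF.dim i h, hF.dim i h])
    · rw [hyF.top h, hF.top h]
  have h1 : Fl (x + c • m) (t+1) = F t ⊔ span k {u + c • v} := by
    have := Fl_succ (x + c • m) τ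
    rw [hcol] at this
    simp only [τ] at this
    rw [this, hlow t le_rfl]
  obtain ⟨κ, k1, k2⟩ := adj hT hF hyF ht (w := w) (fun i hi => by
      rcases Nat.lt_or_ge i (t+1) with h | h
      · rw [hlow i (by omega)]
      · rw [hhigh i (by omega)]) s.ja (by
      rw [phi_bot, phi_bot, h1, hlow t le_rfl, Submodule.map_sup, Submodule.map_span, Set.image_singleton,
        finrank_sup_span c1]
      omega) s.w2 s.w1 (by
      rw [h1]
      intro hw
      obtain ⟨f, hf, z, hz, hfz⟩ := Submodule.mem_sup.1 hw
      obtain ⟨a, rfl⟩ := mem_span_singleton.1 hz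
      by_cases ha : a = 0
      · rw [ha, zero_smul, add_zero] at hfz
        exact s.w1 (hfz ▸ hF.mono (by omega) hf)
      · apply c2
        have : a • (u + c • v) ∈ F t ⊔ span k {w} := by
          have e : a • (u + c • v) = w - f := by rw [← hfz]; abel
          rw [e]
          exact sub_mem (mem_sup_right (mem_span_singleton_self w)) (mem_sup_left hf)
        exact (smul_mem_iff _ ha).1 this) s.tw
  exact ⟨hy, κ, k1, k2⟩

lemma Orb_mul {T : (Fin N → k) →ₗ[k] (Fin N → k)} {F : ℕ → Submodule k (Fin N → k)}
    {κ : (Fin N → k) ≃ₗ[k] (Fin N → k)} (hκ : ∀ v, κ (T v) = T (κ v)) {y} (hy : y ∈ Orb T F) :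
    matE κ * y ∈ Orb T F := by
  obtain ⟨hu, κ', h1, h2⟩ := hy
  refine ⟨(matE_unit κ).mul hu, κ'.trans κ, fun v => ?_, fun i => ?_⟩
  · simp only [LinearEquiv.trans_apply]; rw [h1, hκ]
  · rw [Fl_mul, h2, matE_lin, ← Submodule.map_comp]; rfl

theorem thmB [Infinite k] (m : ℕ) : ∀ {T T' : (Fin N → k) →ₗ[k] (Fin N → k)} (hT : Pr T T')
    {F : ℕ → Submodule k (Fin N → k)} (hF : IsFlag F) (hm : meas T T' F ≤ m)
    {γ : Matrix (Fin N) (Fin N) k} (hγ : IsUnit γ)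
    (h : FLeOn (Set.Iic (finrank k (Fin N → k))) T T' (Fl γ) F), γ ∈ Zcl (Orb T F) := by
  induction m using Nat.strong_induction_on with
  | _ m ih =>
  intro T T' hT F hF hm γ hγ h
  have hG := Fl_flag hγ
  have step : ∀ {T T' : (Fin N → k) →ₗ[k] (Fin N → k)} (hT : Pr T T') (hm : meas T T' F ≤ m)
    (h : FLeOn (Set.Iic (finrank k (Fin N → k))) T T' (Fl γ) F)
    {t : ℕ} {w : Fin N → k} (s : Step T T' F t w), γ ∈ Zcl (Orb T F) := by
    intro T T' hT hm h t w s
    obtain ⟨E, E0, E2, Ed, eb, ea, e1, e2⟩ := lifting hT hF hG s h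
    have hup := FLe_update h eb ea e1 e2
    have hGf := hG.update E0 E2 Ed
    obtain ⟨γ', g1, g2⟩ := exists_mat hGf
    have hG' : Fl γ' = Function.update (Fl γ) (t+1) E := funext g2
    have hlt := s.meas_lt hT hF
    have hin := ih _ (lt_of_lt_of_le hlt hm) hT (s.flag hF) le_rfl g1 (by rw [hG']; exact hup)
    have hdet := (Matrix.isUnit_iff_isUnit_det γ').1 g1
    set p := γ'⁻¹ * γ with hp
    have hpu : IsUnit p := ((Matrix.isUnit_nonsing_inv_iff).2 g1).mul hγ
    have hγp : γ' * p = γ := by rw [hp, ← mul_assoc, Matrix.mul_nonsing_inv _ hdet, one_mul]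
    have hpE : ∀ i, i ≠ t + 1 → Fl p i = Est k N i := by
      intro i hi
      have e := g2 i
      rw [Function.update_of_ne hi, ← hγp, Fl_mul] at e
      exact (Submodule.map_injective_of_injective (inj_of_unit g1) e).symm
    have := Zcl_mul (S' := Orb T F) 1 p (fun y hy => ?_) hin
    · rwa [one_mul, hγp] at this
    · obtain ⟨yu, κ, k1, k2⟩ := hy
      have hκ' : ∀ v, κ.symm (T v) = T (κ.symm v) := fun v => by
        apply κ.injective; rw [k1]; simp
      have hz : matE κ.symm * (y * p) ∈ Zcl (Orb T F) := by
        refine claim1 hT hF s ((matE_unit _).mul (yu.mul hpu)) (fun i hi => ?_)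
        rw [Fl_mul, Fl_mul' _ _ _ (hpE i hi), k2 i, Function.update_of_ne hi, matE_lin, ← Submodule.map_comp]
        have e : (κ.symm : (Fin N → k) →ₗ[k] (Fin N → k)) ∘ₗ (κ : (Fin N → k) →ₗ[k] (Fin N → k)) =
            LinearMap.id := by ext; simp
        rw [e, Submodule.map_id]
      have hw := Zcl_mul (S' := Orb T F) (matE κ) 1 (fun z hz => by
        rw [mul_one]; exact subset_Zcl _ (Orb_mul k1 hz)) hz
      rwa [← mul_assoc, matE_symm_mul, one_mul, mul_one, ← one_mul y] at hw
  rcases exists_step_or hT hF with ⟨t, w, s⟩ | ⟨t, w, s⟩ | hb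
  · exact step hT hm h s
  · have := step hT.symm (by rw [meas_symm]; exact hm) (h.symm hT hG.mono hF.mono) s
    exact Zcl_mono (fun x hx => subset_Zcl _ (Orb_symm hT F hx)) this
  · have h1 : ∀ i ≤ finrank k (Fin N → k), phi T ⊥ (Fl γ i) = phi T ⊥ (F i) ∧
        phi T' ⊥ (Fl γ i) = phi T' ⊥ (F i) := by
      intro i hi
      have := h.a i hi
      have := h.b i hi
      have := hb i hi
      have := hG.AB_ge hT hi
      omega
    obtain ⟨κ, k1, k2⟩ := base hT hF hG hb (fun i hi => (h1 i hi).1) (fun i hi => (h1 i hi).2)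
    exact subset_Zcl _ ⟨hγ, κ, k1, k2⟩

def KP (T : (Fin N → k) →ₗ[k] (Fin N → k)) (C : Set ℕ) (h : Matrix (Fin N) (Fin N) k) :
    Set (Matrix (Fin N) (Fin N) k) :=
  {y | ∃ κ p : Matrix (Fin N) (Fin N) k, IsUnit κ ∧ (∀ v, κ.mulVecLin (T v) = T (κ.mulVecLin v)) ∧
    IsUnit p ∧ (∀ i ∈ C, Fl p i = Est k N i) ∧ y = κ * h * p}

lemma mem_KP {T : (Fin N → k) →ₗ[k] (Fin N → k)} {C : Set ℕ} {h x : Matrix (Fin N) (Fin N) k}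
    (hh : IsUnit h) (hx : IsUnit x) {κ : (Fin N → k) ≃ₗ[k] (Fin N → k)}
    (hκ : ∀ v, κ (T v) = T (κ v))
    (hi : ∀ i ∈ C, Fl x i = Submodule.map (κ : (Fin N → k) →ₗ[k] (Fin N → k)) (Fl h i)) : x ∈ KP T C h := by
  have hu := (matE_unit κ).mul hh
  have hdet := (Matrix.isUnit_iff_isUnit_det _).1 hu
  have e : matE κ * h * ((matE κ * h)⁻¹ * x) = x := by
    rw [← mul_assoc, Matrix.mul_nonsing_inv _ hdet, one_mul]
  refine ⟨matE κ, (matE κ * h)⁻¹ * x, matE_unit κ, fun v => ?_,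
    ((Matrix.isUnit_nonsing_inv_iff).2 hu).mul hx, fun i hiC => ?_, e.symm⟩
  · rw [matE_lin]; exact hκ v
  · have := hi i hiC
    rw [← e, ← matE_lin, ← Fl_mul, Fl_mul] at this
    exact Submodule.map_injective_of_injective (inj_of_unit hu) this

theorem core_b [Infinite k] {T T' : (Fin N → k) →ₗ[k] (Fin N → k)} (hT : Pr T T') {C : Set ℕ}
    (hC : C ⊆ Set.Iic N) (h0 : 0 ∈ C) (hN : N ∈ C) {g h : Matrix (Fin N) (Fin N) k}
    (hg : IsUnit g) (hh : IsUnit h) (hle : FLeOn C T T' (Fl g) (Fl h)) : g ∈ Zcl (KP T C h) := by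
  have hf := finrank_fin_fun k (n := N)
  obtain ⟨F', f1, f2, f3⟩ := refine_flag hT (Fl_flag hh) (C := C) (by rw [hf]; exact hC) h0
    (by rw [hf]; exact hN)
  have := thmB _ hT f1 le_rfl hg (f3 _ (Fl_flag hg) hle)
  refine Zcl_mono (fun x hx => subset_Zcl _ ?_) this
  obtain ⟨hx, κ, k1, k2⟩ := hx
  exact mem_KP hh hx k1 (fun i hi => by rw [k2 i, f2 i hi])

theorem core_c [Infinite k] {T T' : (Fin N → k) →ₗ[k] (Fin N → k)} (hT : Pr T T') {C : Set ℕ}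
    (hC : C ⊆ Set.Iic N) (h0 : 0 ∈ C) (hN : N ∈ C) {g h : Matrix (Fin N) (Fin N) k}
    (hg : IsUnit g) (hh : IsUnit h) (hle : FLeOn C T T' (Fl g) (Fl h))
    (hle' : FLeOn C T T' (Fl h) (Fl g)) : g ∈ KP T C h := by
  have hf := finrank_fin_fun k (n := N)
  obtain ⟨κ, k1, k2⟩ := coreC hT (Fl_flag hh) (Fl_flag hg) (C := C) (by rw [hf]; exact hC) h0
    (by rw [hf]; exact hN) hle hle'
  exact mem_KP hh hg k1 k2

/-! necessity -/
lemma lin_poly (L : Matrix (Fin N) (Fin N) k →ₗ[k] k) :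
    ∃ q : MvPolynomial (Fin N × Fin N) k, ∀ y : Matrix (Fin N) (Fin N) k,
      MvPolynomial.eval (fun pr : Fin N × Fin N => y pr.1 pr.2) q = L y := by
  refine ⟨∑ i, ∑ j, MvPolynomial.C (L (Matrix.single i j 1)) * MvPolynomial.X (i, j), fun y => ?_⟩
  conv_rhs => rw [Matrix.matrix_eq_sum_single y]
  simp only [map_sum, map_mul, MvPolynomial.eval_C, MvPolynomial.eval_X]
  refine Finset.sum_congr rfl (fun i _ => Finset.sum_congr rfl (fun j _ => ?_))
  have : Matrix.single i j (y i j) = y i j • Matrix.single i j (1 : k) := by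
    rw [Matrix.smul_single, smul_eq_mul, mul_one]
  rw [this, map_smul, smul_eq_mul, mul_comm]

lemma semicont {A U : Type} [AddCommGroup A] [Module k A] [AddCommGroup U] [Module k U]
    [FiniteDimensional k U] (L : Matrix (Fin N) (Fin N) k →ₗ[k] (A →ₗ[k] U))
    {S : Set (Matrix (Fin N) (Fin N) k)} {r : ℕ}
    (hS : ∀ y ∈ S, finrank k (LinearMap.range (L y)) ≤ r) {x} (hx : x ∈ Zcl S) :
    finrank k (LinearMap.range (L x)) ≤ r := by
  classical
  by_contra hlt
  push Not at hlt
  set s := finrank k (LinearMap.range (L x)) with hs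
  let b := finBasis k (LinearMap.range (L x))
  have hc : ∀ m, ∃ c, L x c = b m := fun m => (b m).2
  choose c hc using hc
  obtain ⟨g, hg⟩ := LinearMap.exists_leftInverse_of_injective (LinearMap.range (L x)).subtype
    (ker_subtype _)
  let Ψ : U →ₗ[k] (Fin s → k) := (b.equivFun : _ →ₗ[k] _) ∘ₗ g
  have hΨ : ∀ m l, Ψ (L x (c m)) l = if l = m then 1 else 0 := by
    intro m l
    have : g (L x (c m)) = b m := by
      rw [hc]; exact LinearMap.congr_fun hg (b m)
    show b.equivFun (g (L x (c m))) l = _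
    rw [this, Basis.equivFun_apply, Basis.repr_self, Finsupp.single_apply]
    simp only [eq_comm]
  have hq : ∀ l m, ∃ q : MvPolynomial (Fin N × Fin N) k, ∀ y : Matrix (Fin N) (Fin N) k,
      MvPolynomial.eval (fun pr : Fin N × Fin N => y pr.1 pr.2) q = Ψ (L y (c m)) l := by
    intro l m
    exact lin_poly ((LinearMap.proj l : (Fin s → k) →ₗ[k] k) ∘ₗ Ψ ∘ₗ (LinearMap.applyₗ (c m)) ∘ₗ L)
  choose q hq using hq
  have hev : ∀ y : Matrix (Fin N) (Fin N) k,
      MvPolynomial.eval (fun pr : Fin N × Fin N => y pr.1 pr.2) (Matrix.of q).det =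
      (Matrix.of fun l m => Ψ (L y (c m)) l).det := by
    intro y
    rw [RingHom.map_det]
    congr 1
    ext l m
    simp [hq]
  have hzero := hx (Matrix.of q).det (fun y hy => by
    rw [hev]
    by_contra hne
    have hu : IsUnit (Matrix.of fun l m => Ψ (L y (c m)) l) :=
      (Matrix.isUnit_iff_isUnit_det _).2 (isUnit_iff_ne_zero.2 hne)
    have hle : (⊤ : Submodule k (Fin s → k)) ≤ Submodule.map Ψ (LinearMap.range (L y)) := by
      intro z _
      obtain ⟨a, rfl⟩ := surj_of_unit hu z
      refine ⟨L y (∑ m, a m • c m), ⟨_, rfl⟩, ?_⟩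
      ext l
      simp [Matrix.mulVec, dotProduct, mul_comm]
    have h1 := finrank_mono hle
    have h2 := finrank_map_le Ψ (LinearMap.range (L y))
    have h3 := hS y hy
    rw [finrank_top, finrank_fin_fun] at h1
    omega)
  rw [hev] at hzero
  have : (Matrix.of fun l m => Ψ (L x (c m)) l) = 1 := by
    ext l m; rw [Matrix.of_apply, hΨ, Matrix.one_apply]
  rw [this, Matrix.det_one] at hzero
  exact one_ne_zero hzero

def Lphi (T : (Fin N → k) →ₗ[k] (Fin N → k)) (i j : ℕ) :
    Matrix (Fin N) (Fin N) k →ₗ[k] ((Est k N i × Est k N j) →ₗ[k] (Fin N → k)) where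
  toFun y := (T ∘ₗ y.mulVecLin ∘ₗ (Est k N i).subtype).coprod (y.mulVecLin ∘ₗ (Est k N j).subtype)
  map_add' y z := by
    ext v l <;> simp
  map_smul' a y := by
    ext v l <;> simp

lemma Lphi_range (T : (Fin N → k) →ₗ[k] (Fin N → k)) (i j : ℕ) (y : Matrix (Fin N) (Fin N) k) :
    finrank k (LinearMap.range (Lphi T i j y)) = phi T (Fl y j) (Fl y i) := by
  have e : LinearMap.range (Lphi T i j y) = Submodule.map T (Fl y i) ⊔ Fl y j := by
    show LinearMap.range (LinearMap.coprod _ _) = _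
    rw [LinearMap.range_coprod, LinearMap.range_comp, LinearMap.range_comp, LinearMap.range_comp,
      range_subtype, range_subtype]
    rfl
  rw [e]; rfl

lemma semicont_phi (T : (Fin N → k) →ₗ[k] (Fin N → k)) (i j : ℕ)
    {S : Set (Matrix (Fin N) (Fin N) k)} {r : ℕ}
    (hS : ∀ y ∈ S, phi T (Fl y j) (Fl y i) ≤ r) {x} (hx : x ∈ Zcl S) :
    phi T (Fl x j) (Fl x i) ≤ r := by
  rw [← Lphi_range]
  exact semicont (Lphi T i j) (fun y hy => by rw [Lphi_range]; exact hS y hy) hx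

lemma phi_KP {T : (Fin N → k) →ₗ[k] (Fin N → k)} {C : Set ℕ}
    {h : Matrix (Fin N) (Fin N) k} {i j : ℕ} (hi : i ∈ C) (hj : j ∈ C) {y} (hy : y ∈ KP T C h) :
    phi T (Fl y j) (Fl y i) = phi T (Fl h j) (Fl h i) := by
  obtain ⟨κ, p, ku, kc, pu, pf, rfl⟩ := hy
  rw [Fl_mul' _ _ _ (pf i hi), Fl_mul' _ _ _ (pf j hj), Fl_mul, Fl_mul, ← linE_lin ku]
  exact map_comm_phi (fun x => kc x) _ _

lemma KP_symm {T T' : (Fin N → k) →ₗ[k] (Fin N → k)} (hT : Pr T T') {C : Set ℕ}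
    {h : Matrix (Fin N) (Fin N) k} : KP T C h ⊆ KP T' C h := by
  rintro y ⟨κ, p, ku, kc, r⟩
  exact ⟨κ, p, ku, comm_symm hT (κ := linE ku) kc, r⟩

theorem necessity {T T' : (Fin N → k) →ₗ[k] (Fin N → k)} (hT : Pr T T') {C : Set ℕ} (h0 : 0 ∈ C)
    {h x : Matrix (Fin N) (Fin N) k} (hx : x ∈ Zcl (KP T C h)) :
    FLeOn C T T' (Fl x) (Fl h) := by
  have key : ∀ i ∈ C, ∀ j ∈ C, phi T (Fl x j) (Fl x i) ≤ phi T (Fl h j) (Fl h i) :=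
    fun i hi j hj => semicont_phi T i j (fun y hy => (phi_KP hi hj hy).le) hx
  have key' : ∀ i ∈ C, ∀ j ∈ C, phi T' (Fl x j) (Fl x i) ≤ phi T' (Fl h j) (Fl h i) :=
    fun i hi j hj => semicont_phi T' i j (fun y hy => (phi_KP hi hj hy).le)
      (Zcl_mono (fun y hy => subset_Zcl _ (KP_symm hT hy)) hx)
  refine ⟨fun i hi => ?_, fun i hi => ?_, fun i hi j hj _ => key i hi j hj⟩
  · have := key i hi 0 h0; rwa [Fl_zero, Fl_zero] at this
  · have := key' i hi 0 h0; rwa [Fl_zero, Fl_zero] at this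

end core5
end FC

set_option linter.unusedSectionVars false
set_option linter.unusedVariables false
set_option maxHeartbeats 1000000
namespace FC
open Submodule Module
section tup
variable {k : Type} [Field k]

def Cs {ι : Type} (P : ι → Prop) : Submodule k (ι → k) where
  carrier := {v | ∀ j, ¬ P j → v j = 0}
  add_mem' := fun {a b} ha hb j hj => by simp [ha j hj, hb j hj]
  zero_mem' := fun j _ => rfl
  smul_mem' := fun c x hx j hj => by simp [hx j hj]

lemma mem_Cs {ι : Type} {P : ι → Prop} {v : ι → k} : v ∈ Cs P ↔ ∀ j, ¬ P j → v j = 0 := Iff.rfl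

lemma ker_count {A B C D : Type} [AddCommGroup A] [Module k A] [AddCommGroup B] [Module k B]
    [AddCommGroup C] [Module k C] [AddCommGroup D] [Module k D] [FiniteDimensional k A]
    [FiniteDimensional k C]
    (L : A →ₗ[k] B) (L' : C →ₗ[k] D) (SA : Submodule k A) (SC : Submodule k C) (g : A →ₗ[k] C)
    (h1 : ∀ a ∈ SA, L a = 0 → g a ∈ SC ∧ L' (g a) = 0)
    (h2 : ∀ a ∈ SA, L a = 0 → g a = 0 → a = 0)
    (h3 : ∀ c ∈ SC, L' c = 0 → ∃ a ∈ SA, L a = 0 ∧ g a = c) :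
    finrank k (Submodule.map L SA) + finrank k SC = finrank k (Submodule.map L' SC) + finrank k SA := by
  have e1 := finrank_map_add_inf_ker L SA
  have e2 := finrank_map_add_inf_ker L' SC
  have e3 : SC ⊓ LinearMap.ker L' = Submodule.map g (SA ⊓ LinearMap.ker L) := by
    apply le_antisymm
    · rintro c ⟨c1, c2⟩
      obtain ⟨a, a1, a2, a3⟩ := h3 c c1 c2
      exact ⟨a, ⟨a1, a2⟩, a3⟩
    · rintro _ ⟨a, ⟨a1, a2⟩, rfl⟩
      exact ⟨(h1 a a1 a2).1, (h1 a a1 a2).2⟩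
  have e4 : finrank k (Submodule.map g (SA ⊓ LinearMap.ker L)) = finrank k ↥(SA ⊓ LinearMap.ker L) := by
    have hinj : Function.Injective (g.domRestrict (SA ⊓ LinearMap.ker L)) := by
      rw [← LinearMap.ker_eq_bot, LinearMap.ker_eq_bot']
      rintro ⟨a, a1, a2⟩ ha
      exact Subtype.ext (h2 a a1 a2 ha)
    rw [← LinearMap.finrank_range_of_inj hinj, LinearMap.range_domRestrict]
  rw [e3, e4] at e2
  omega

lemma rank_of_supp {ι κ : Type} [Fintype κ] (M : Matrix ι κ k) (Q : κ → Prop)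
    (hM : ∀ r c, ¬ Q c → M r c = 0) : finrank k (Submodule.map M.mulVecLin (Cs Q)) = M.rank := by
  classical
  have : Submodule.map M.mulVecLin (Cs Q) = LinearMap.range M.mulVecLin := by
    apply le_antisymm LinearMap.map_le_range
    rintro _ ⟨v, rfl⟩
    refine ⟨fun c => if Q c then v c else 0, fun c hc => by simp [hc], ?_⟩
    ext r
    simp only [Matrix.mulVecLin_apply, Matrix.mulVec, dotProduct]
    refine Finset.sum_congr rfl (fun c _ => ?_)
    by_cases hc : Q c
    · simp [hc]
    · simp [hc, hM r c hc]
  rw [this]; rfl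

lemma rank_submatrix_of_zero {ι κ ι' κ' : Type} [Fintype κ] [Fintype κ'] [Fintype ι] [Fintype ι']
    (M : Matrix ι κ k) (M' : Matrix ι' κ' k)
    (r : ι' → ι) (c : κ' → κ) (hM : ∀ p q, M' p q = M (r p) (c q))
    (hr : ∀ i, (∃ p, r p = i) ∨ ∀ q, M i q = 0)
    (hc : ∀ j, (∃ q, c q = j) ∨ ∀ p, M p j = 0) : M'.rank = M.rank := by
  have key : ∀ {ι κ κ' : Type} [Fintype κ] [Fintype κ'] (M : Matrix ι κ k) (c : κ' → κ)
    (hc : ∀ j, (∃ q, c q = j) ∨ ∀ p, M p j = 0), (M.submatrix id c).rank = M.rank := by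
    intro ι κ κ' _ _ M c hc
    rw [Matrix.rank_eq_finrank_span_cols, Matrix.rank_eq_finrank_span_cols]
    have : span k (Set.range (M.submatrix id c).col) = span k (Set.range M.col) := by
      apply le_antisymm
      · apply span_mono
        rintro _ ⟨q, rfl⟩
        exact ⟨c q, rfl⟩
      · rw [span_le]
        rintro _ ⟨j, rfl⟩
        rcases hc j with ⟨q, rfl⟩ | h
        · exact subset_span ⟨q, rfl⟩
        · have : M.col j = 0 := by ext p; exact h p
          rw [this]; exact zero_mem _
    rw [this]
  have e : M' = ((M.submatrix id c).transpose.submatrix id r).transpose := by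
    ext p q; exact hM p q
  rw [e, Matrix.rank_transpose, key, Matrix.rank_transpose, key _ _ hc]
  intro j
  rcases hr j with h | h
  · exact Or.inl h
  · exact Or.inr (fun p => h (c p))

open Classical in
lemma rank_dict {ι κ ι' κ' : Type} [Fintype κ] [Fintype κ'] [Fintype ι] [Fintype ι']
    (M : Matrix ι κ k) (Q : κ → Prop) (M' : Matrix ι' κ' k)
    (r : ι' → ι) (c : κ' → κ) (hM : ∀ p q, M' p q = M (r p) (c q))
    (hQ : ∀ q, Q (c q))
    (hr : ∀ i, (∃ p, r p = i) ∨ ∀ q, Q q → M i q = 0)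
    (hc : ∀ j, Q j → (∃ q, c q = j) ∨ ∀ p, M p j = 0) :
    finrank k (Submodule.map M.mulVecLin (Cs Q)) = M'.rank := by
  let M₁ : Matrix ι κ k := Matrix.of fun i j => if Q j then M i j else 0
  have h1 : Submodule.map M.mulVecLin (Cs Q) = Submodule.map M₁.mulVecLin (Cs Q) := by
    apply SetLike.coe_injective
    rw [map_coe, map_coe]
    refine Set.image_congr (fun v hv => ?_)
    ext i
    simp only [Matrix.mulVecLin_apply, Matrix.mulVec, dotProduct]
    refine Finset.sum_congr rfl (fun j _ => ?_)
    by_cases h : Q j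
    · simp [M₁, h]
    · rw [hv j h]; simp
  rw [h1, rank_of_supp M₁ Q (fun i j h => by simp [M₁, h])]
  symm
  refine rank_submatrix_of_zero M₁ M' r c (fun p q => by simp [M₁, hQ, hM]) (fun i => ?_)
    (fun j => ?_)
  · rcases hr i with h | h
    · exact Or.inl h
    · right; intro q; by_cases hq : Q q
      · simp [M₁, hq, h]
      · simp [M₁, hq]
  · by_cases hj : Q j
    · rcases hc j hj with h | h
      · exact Or.inl h
      · right; intro q; simp [M₁, hj, h]
    · right; intro q; simp [M₁, hj]

end tup
end FC

set_option linter.unusedSectionVars false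
set_option linter.unusedVariables false
set_option linter.unusedSimpArgs false
set_option maxHeartbeats 1000000
namespace FC
open Submodule Module
section tup2
variable {k : Type} [Field k] {X Y Z Z' : Type} [Fintype X] [Fintype Y] [Fintype Z] [Fintype Z']

abbrev Rw (k X Y Z Z' : Type) := ((Z → k) × (Y → k) × (X → k)) × ((Z' → k) × (Y → k) × (X → k))
abbrev Tp (k X Y Z Z' : Type) :=
  (X → k) × (X → k) × (Y → k) × (Z → k) × (Z' → k) × (Y → k)

def T0 : Rw k X Y Z Z' →ₗ[k] Rw k X Y Z Z' := LinearMap.inl k _ _ ∘ₗ LinearMap.fst k _ _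
def T0' : Rw k X Y Z Z' →ₗ[k] Rw k X Y Z Z' := LinearMap.inr k _ _ ∘ₗ LinearMap.snd k _ _

/-- the full matrix acting on tuples -/
def FL (A0 : Matrix Z X k) (A1 : Matrix Y X k) (B0 : Matrix Z' X k) (B1 : Matrix Y X k) :
    Tp k X Y Z Z' →ₗ[k] Rw k X Y Z Z' where
  toFun t := ((t.2.2.2.1 + A0.mulVec t.2.1, t.2.2.1 + A1.mulVec t.2.1, t.1),
    (t.2.2.2.2.1 + B0.mulVec t.2.1, t.2.2.1 + B1.mulVec t.2.1 + t.2.2.2.2.2, t.1 + t.2.1))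
  map_add' s t := by
    simp only [Prod.fst_add, Prod.snd_add, Matrix.mulVec_add, Prod.mk_add_mk, Prod.mk.injEq]
    refine ⟨⟨?_, ?_, ?_⟩, ?_, ?_, ?_⟩ <;> first | trivial | abel
  map_smul' c t := by
    simp only [Prod.smul_fst, Prod.smul_snd, Matrix.mulVec_smul, Prod.smul_mk, RingHom.id_apply,
      smul_add]

def FD : (X → k) →ₗ[k] Rw k X Y Z Z' where
  toFun d := ((0, 0, d), (0, 0, d))
  map_add' s t := by simp
  map_smul' c t := by simp

def FG (A0 : Matrix Z X k) (A1 : Matrix Y X k) (B0 : Matrix Z' X k) :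
    (X → k) × (X → k) × (Y → k) →ₗ[k] Rw k X Y Z Z' where
  toFun t := ((A0.mulVec t.2.1, t.2.2 + A1.mulVec t.2.1, t.1),
    (B0.mulVec t.2.1, t.2.2 + A1.mulVec t.2.1, t.1 + t.2.1))
  map_add' s t := by
    simp only [Prod.fst_add, Prod.snd_add, Matrix.mulVec_add, Prod.mk_add_mk, Prod.mk.injEq]
    refine ⟨⟨?_, ?_, ?_⟩, ?_, ?_, ?_⟩ <;> first | trivial | abel
  map_smul' c t := by
    simp only [Prod.smul_fst, Prod.smul_snd, Matrix.mulVec_smul, Prod.smul_mk, RingHom.id_apply,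
      smul_add]

/-- row mask -/
def rm (P : Y → Prop) [DecidablePred P] (A : Matrix Y X k) : Matrix Y X k :=
  Matrix.of fun i c => if P i then A i c else 0

lemma rm_mulVec (P : Y → Prop) [DecidablePred P] (A : Matrix Y X k) (v : X → k) (i : Y) :
    (rm P A).mulVec v i = if P i then A.mulVec v i else 0 := by
  simp only [rm, Matrix.mulVec, dotProduct, Matrix.of_apply]
  split_ifs <;> simp

lemma rm_eq_zero (P : Y → Prop) [DecidablePred P] (A : Matrix Y X k) (v : X → k) :
    (rm P A).mulVec v = 0 ↔ ∀ i, P i → A.mulVec v i = 0 := by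
  constructor
  · intro h i hi
    have := congrFun h i
    rw [rm_mulVec, if_pos hi] at this; exact this
  · intro h; ext i; rw [rm_mulVec]; split_ifs with hi
    · exact h i hi
    · rfl

lemma sum_elim_zero {α β : Type} (u : α → k) (v : β → k) :
    Sum.elim u v = 0 ↔ u = 0 ∧ v = 0 := by
  constructor
  · intro h
    exact ⟨funext fun a => congrFun h (Sum.inl a), funext fun a => congrFun h (Sum.inr a)⟩
  · rintro ⟨rfl, rfl⟩; ext (a|a) <;> rfl

lemma phi_param {U A1 A2 : Type} [AddCommGroup U] [Module k U] [AddCommGroup A1] [Module k A1]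
    [AddCommGroup A2] [Module k A2] (T : U →ₗ[k] U) (F : A1 →ₗ[k] U) (F' : A2 →ₗ[k] U)
    (S : Submodule k A1) (S' : Submodule k A2) :
    phi T (Submodule.map F' S') (Submodule.map F S) = finrank k (Submodule.map ((T ∘ₗ F).coprod F') (S.prod S')) := by
  unfold phi
  rw [LinearMap.coprod_map_prod, Submodule.map_comp]

def SGF (Ps : X → Prop) (Pu : Y → Prop) : Submodule k ((X → k) × (X → k) × (Y → k)) :=
  Submodule.prod ⊤ ((Cs Ps).prod (Cs Pu))

def SL (Pq : Y → Prop) : Submodule k (Tp k X Y Z Z') :=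
  Submodule.prod ⊤ (Submodule.prod ⊤ (Submodule.prod ⊤ (Submodule.prod ⊤ (Submodule.prod ⊤ (Cs Pq)))))

lemma mem_SGF (Ps : X → Prop) (Pu : Y → Prop) (t : (X → k) × (X → k) × (Y → k)) :
    t ∈ SGF Ps Pu ↔ (∀ j, ¬ Ps j → t.2.1 j = 0) ∧ (∀ j, ¬ Pu j → t.2.2 j = 0) := by
  simp [SGF, Submodule.mem_prod, mem_Cs]

lemma mem_SL (Pq : Y → Prop) (t : Tp k X Y Z Z') :
    t ∈ SL Pq ↔ (∀ j, ¬ Pq j → t.2.2.2.2.2 j = 0) := by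
  simp [SL, Submodule.mem_prod, mem_Cs]

variable (A0 : Matrix Z X k) (A1 : Matrix Y X k) (B0 : Matrix Z' X k) (B1 : Matrix Y X k)

open Classical in
lemma f_A (Ps : X → Prop) (Pu : Y → Prop) :
    phi T0 ⊥ (Submodule.map (FG A0 A1 B0) (SGF Ps Pu)) + finrank k (Cs (k := k) Ps) =
    finrank k (Submodule.map (Matrix.fromRows A0 (rm (fun j => ¬ Pu j) A1)).mulVecLin (Cs Ps))
      + finrank k (SGF (k := k) Ps Pu) := by
  rw [phi_bot, ← Submodule.map_comp]
  refine ker_count _ _ _ _ (LinearMap.fst k _ _ ∘ₗ LinearMap.snd k _ _) ?_ ?_ ?_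
  · rintro ⟨d, x, e⟩ ha h
    rw [mem_SGF] at ha
    simp only [FG, T0, LinearMap.comp_apply, LinearMap.coe_mk, AddHom.coe_mk, LinearMap.fst_apply,
      LinearMap.inl_apply, Prod.mk_eq_zero, LinearMap.snd_apply] at h ha ⊢
    obtain ⟨⟨h1, h2, h3⟩, -⟩ := h
    refine ⟨ha.1, ?_⟩
    rw [Matrix.mulVecLin_apply, Matrix.fromRows_mulVec, sum_elim_zero, rm_eq_zero]
    refine ⟨h1, fun j hj => ?_⟩
    have := congrFun h2 j
    simpa [ha.2 j hj] using this
  · rintro ⟨d, x, e⟩ ha h hx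
    rw [mem_SGF] at ha
    simp only [FG, T0, LinearMap.comp_apply, LinearMap.coe_mk, AddHom.coe_mk, LinearMap.fst_apply,
      LinearMap.inl_apply, Prod.mk_eq_zero, LinearMap.snd_apply] at h ha hx ⊢
    obtain ⟨⟨h1, h2, h3⟩, -⟩ := h
    subst hx
    simpa [h3] using h2
  · intro c hc h
    rw [Matrix.mulVecLin_apply, Matrix.fromRows_mulVec, sum_elim_zero, rm_eq_zero] at h
    refine ⟨(0, c, - A1.mulVec c), ?_, ?_, rfl⟩
    · rw [mem_SGF]
      exact ⟨hc, fun j hj => by simp [h.2 j hj]⟩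
    · simp [FG, T0, h.1]

open Classical in
lemma f_B (Ps : X → Prop) (Pu : Y → Prop) :
    phi T0' ⊥ (Submodule.map (FG A0 A1 B0) (SGF Ps Pu)) + finrank k (Cs (k := k) Ps) =
    finrank k (Submodule.map (Matrix.fromRows B0 (rm (fun j => ¬ Pu j) A1)).mulVecLin (Cs Ps))
      + finrank k (SGF (k := k) Ps Pu) := by
  rw [phi_bot, ← Submodule.map_comp]
  refine ker_count _ _ _ _ (LinearMap.fst k _ _ ∘ₗ LinearMap.snd k _ _) ?_ ?_ ?_
  · rintro ⟨d, x, e⟩ ha h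
    rw [mem_SGF] at ha
    simp only [FG, T0', LinearMap.comp_apply, LinearMap.coe_mk, AddHom.coe_mk, LinearMap.fst_apply,
      LinearMap.inr_apply, Prod.mk_eq_zero, LinearMap.snd_apply] at h ha ⊢
    obtain ⟨-, ⟨h1, h2, h3⟩⟩ := h
    refine ⟨ha.1, ?_⟩
    rw [Matrix.mulVecLin_apply, Matrix.fromRows_mulVec, sum_elim_zero, rm_eq_zero]
    refine ⟨h1, fun j hj => ?_⟩
    have := congrFun h2 j
    simpa [ha.2 j hj] using this
  · rintro ⟨d, x, e⟩ ha h hx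
    rw [mem_SGF] at ha
    simp only [FG, T0', LinearMap.comp_apply, LinearMap.coe_mk, AddHom.coe_mk, LinearMap.fst_apply,
      LinearMap.inr_apply, Prod.mk_eq_zero, LinearMap.snd_apply] at h ha hx ⊢
    obtain ⟨-, ⟨h1, h2, h3⟩⟩ := h
    subst hx
    simp only [Matrix.mulVec_zero, add_zero] at h2 h3
    exact ⟨h3, rfl, h2⟩
  · intro c hc h
    rw [Matrix.mulVecLin_apply, Matrix.fromRows_mulVec, sum_elim_zero, rm_eq_zero] at h
    refine ⟨(-c, c, - A1.mulVec c), ?_, ?_, rfl⟩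
    · rw [mem_SGF]
      exact ⟨hc, fun j hj => by simp [h.2 j hj]⟩
    · simp [FG, T0', h.1]

open Classical in
lemma f_D (Pd Ps : X → Prop) (Pu : Y → Prop) :
    phi T0 (Submodule.map (FG A0 A1 B0) (SGF Ps Pu)) (Submodule.map FD (Cs Pd))
      + finrank k (Cs (k := k) (fun j => Pd j ∧ Ps j)) =
    finrank k (Submodule.map (Matrix.fromRows A0 (Matrix.fromRows B0 (rm (fun j => ¬ Pu j) A1))).mulVecLin
      (Cs (fun j => Pd j ∧ Ps j)))
      + finrank k ((Cs (k := k) Pd).prod (SGF (k := k) Ps Pu)) := by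
  rw [phi_param]
  refine ker_count _ _ _ _ (LinearMap.fst k _ _) ?_ ?_ ?_
  · rintro ⟨d', d, x, e⟩ ha h
    rw [Submodule.mem_prod, mem_SGF] at ha
    simp only [LinearMap.coprod_apply, FG, FD, T0, LinearMap.comp_apply, LinearMap.coe_mk,
      AddHom.coe_mk, LinearMap.fst_apply, Prod.mk_add_mk,
      LinearMap.inl_apply, Prod.mk_eq_zero, LinearMap.snd_apply, Prod.fst_zero, Prod.snd_zero,
      zero_add] at h ha ⊢
    obtain ⟨⟨h1, h2, h3⟩, h4, h5, h6⟩ := h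
    have hd : d' = x := by
      rw [add_eq_zero_iff_eq_neg] at h3 h6; rw [h3, h6, neg_neg]
    subst hd
    refine ⟨fun j hj => ?_, ?_⟩
    · rw [not_and_or] at hj
      rcases hj with hj | hj
      · exact ha.1 j hj
      · exact ha.2.1 j hj
    rw [Matrix.mulVecLin_apply, Matrix.fromRows_mulVec, sum_elim_zero, Matrix.fromRows_mulVec,
      sum_elim_zero, rm_eq_zero]
    refine ⟨h1, h4, fun j hj => ?_⟩
    have := congrFun h2 j
    simpa [ha.2.2 j hj] using this
  · rintro ⟨d', d, x, e⟩ ha h hx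
    rw [Submodule.mem_prod, mem_SGF] at ha
    simp only [LinearMap.coprod_apply, FG, FD, T0, LinearMap.comp_apply, LinearMap.coe_mk,
      AddHom.coe_mk, LinearMap.fst_apply, Prod.mk_add_mk,
      LinearMap.inl_apply, Prod.mk_eq_zero, LinearMap.snd_apply, Prod.fst_zero, Prod.snd_zero,
      zero_add] at h ha hx ⊢
    obtain ⟨⟨h1, h2, h3⟩, h4, h5, h6⟩ := h
    subst hx
    rw [zero_add] at h3; subst h3; rw [zero_add] at h6; subst h6
    simpa using h2
  · intro c hc h
    rw [Matrix.mulVecLin_apply, Matrix.fromRows_mulVec, sum_elim_zero, Matrix.fromRows_mulVec,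
      sum_elim_zero, rm_eq_zero] at h
    refine ⟨(c, -c, c, - A1.mulVec c), ?_, ?_, rfl⟩
    · rw [Submodule.mem_prod, mem_SGF]
      exact ⟨fun j hj => hc j (fun h => hj h.1), fun j hj => hc j (fun h => hj h.2),
        fun j hj => by simp [h.2.2 j hj]⟩
    · simp [FG, FD, T0, h.1, h.2.1]

lemma f_bad :
    phi T0 (Submodule.map (FL A0 A1 B0 B1) (SL (fun _ => False))) (Submodule.map FD (Cs (fun _ => True)))
      + finrank k (X → k) =
    (A1 - B1).rank
      + finrank k ((Cs (k := k) (fun _ : X => True)).prod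
        (SL (k := k) (X := X) (Z := Z) (Z' := Z') (fun _ : Y => False))) := by
  rw [phi_param, ← finrank_top k (X → k)]
  have : (A1 - B1).rank = finrank k (Submodule.map (A1 - B1).mulVecLin ⊤) := by
    rw [Submodule.map_top]; rfl
  rw [this]
  refine ker_count _ _ _ _ (LinearMap.fst k _ _) ?_ ?_ ?_
  · rintro ⟨d', d, x, e, p, p', q⟩ ha h
    rw [Submodule.mem_prod, mem_SL] at ha
    simp only [LinearMap.coprod_apply, FL, FD, T0, LinearMap.comp_apply, LinearMap.coe_mk,
      AddHom.coe_mk, LinearMap.fst_apply, Prod.mk_add_mk,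
      LinearMap.inl_apply, Prod.mk_eq_zero, LinearMap.snd_apply, Prod.fst_zero, Prod.snd_zero,
      zero_add] at h ha ⊢
    obtain ⟨⟨h1, h2, h3⟩, h4, h5, h6⟩ := h
    have hd : d' = x := by
      rw [add_eq_zero_iff_eq_neg] at h3 h6; rw [h3, h6, neg_neg]
    subst hd
    refine ⟨trivial, ?_⟩
    have hq : q = 0 := funext fun j => ha.2 j not_false
    rw [hq, add_zero] at h5
    rw [Matrix.mulVecLin_apply, Matrix.sub_mulVec, sub_eq_zero]
    exact add_left_cancel (h2.trans h5.symm)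
  · rintro ⟨d', d, x, e, p, p', q⟩ ha h hx
    rw [Submodule.mem_prod, mem_SL] at ha
    simp only [LinearMap.coprod_apply, FL, FD, T0, LinearMap.comp_apply, LinearMap.coe_mk,
      AddHom.coe_mk, LinearMap.fst_apply, Prod.mk_add_mk,
      LinearMap.inl_apply, Prod.mk_eq_zero, LinearMap.snd_apply, Prod.fst_zero, Prod.snd_zero,
      zero_add] at h ha hx ⊢
    obtain ⟨⟨h1, h2, h3⟩, h4, h5, h6⟩ := h
    subst hx
    rw [zero_add] at h3; subst h3; rw [zero_add] at h6; subst h6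
    have hq : q = 0 := funext fun j => ha.2 j not_false
    simp only [Matrix.mulVec_zero, add_zero] at h1 h2 h4
    exact ⟨rfl, rfl, rfl, h2, h1, h4, hq⟩
  · intro c hc h
    rw [Matrix.mulVecLin_apply, Matrix.sub_mulVec, sub_eq_zero] at h
    refine ⟨(c, -c, c, - A1.mulVec c, - A0.mulVec c, - B0.mulVec c, 0), ?_, ?_, rfl⟩
    · rw [Submodule.mem_prod, mem_SL]
      exact ⟨fun j hj => absurd trivial hj, fun j hj => rfl⟩
    · simp [FL, FD, T0, h]

lemma SL_indep (Pq : Y → Prop) (C0 : Matrix Z X k) (C1 : Matrix Y X k) (D0 : Matrix Z' X k) :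
    Submodule.map (FL A0 A1 B0 A1) (SL Pq) ≤ Submodule.map (FL C0 C1 D0 C1) (SL Pq) := by
  rintro _ ⟨⟨d, x, e, p, p', q⟩, h, rfl⟩
  refine ⟨(d, x, e + A1.mulVec x - C1.mulVec x, p + A0.mulVec x - C0.mulVec x,
    p' + B0.mulVec x - D0.mulVec x, q), ?_, ?_⟩
  · exact (mem_SL _ _).2 ((mem_SL _ _).1 h)
  · simp [FL]

end tup2
end FC

set_option linter.unusedSectionVars false
set_option linter.unusedVariables false
set_option linter.unusedSimpArgs false
set_option maxHeartbeats 1000000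
namespace FC
open Submodule Module
section tup3
variable {k : Type} [Field k] {X Y Z Z' : Type} [Fintype X] [Fintype Y] [Fintype Z] [Fintype Z']
variable (A0 : Matrix Z X k) (A1 : Matrix Y X k) (B0 : Matrix Z' X k) (B1 : Matrix Y X k)

/-- coordinate mask as a linear map -/
def cm {ι : Type} (P : ι → Prop) [DecidablePred P] : (ι → k) →ₗ[k] (ι → k) where
  toFun v i := if P i then v i else 0
  map_add' u v := by ext i; simp only [Pi.add_apply]; split_ifs <;> simp
  map_smul' c v := by ext i; simp only [Pi.smul_apply, RingHom.id_apply]; split_ifs <;> simp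

lemma cm_apply {ι : Type} (P : ι → Prop) [DecidablePred P] (v : ι → k) (i : ι) :
    cm P v i = if P i then v i else 0 := rfl

def sel {α β γ M : Type} [AddCommGroup M] [Module k M] (f : M →ₗ[k] (α → k)) (g : M →ₗ[k] (β → k))
    (h : M →ₗ[k] (γ → k)) : M →ₗ[k] (α ⊕ (β ⊕ γ) → k) where
  toFun m := Sum.elim (f m) (Sum.elim (g m) (h m))
  map_add' u v := by ext (i|i|i) <;> simp
  map_smul' c v := by ext (i|i|i) <;> simp

lemma sel_apply {α β γ M : Type} [AddCommGroup M] [Module k M] (f : M →ₗ[k] (α → k))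
    (g : M →ₗ[k] (β → k)) (h : M →ₗ[k] (γ → k)) (m : M) :
    sel f g h m = Sum.elim (f m) (Sum.elim (g m) (h m)) := rfl

lemma mem_Cs3 {α β γ : Type} (P : α → Prop) (Q : β → Prop) (R : γ → Prop)
    (v : α ⊕ (β ⊕ γ) → k) : v ∈ Cs (Sum.elim P (Sum.elim Q R)) ↔
    (v ∘ Sum.inl) ∈ Cs (k := k) P ∧ (v ∘ Sum.inr ∘ Sum.inl) ∈ Cs (k := k) Q ∧
      (v ∘ Sum.inr ∘ Sum.inr) ∈ Cs (k := k) R := by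
  simp [mem_Cs]

lemma elim3 {α β γ : Type} (v : α ⊕ (β ⊕ γ) → k) :
    v = Sum.elim (v ∘ Sum.inl) (Sum.elim (v ∘ Sum.inr ∘ Sum.inl) (v ∘ Sum.inr ∘ Sum.inr)) := by
  ext (i|i|i) <;> rfl

open Classical in
noncomputable def matMA (Pv : Y → Prop) : Matrix ((Z ⊕ Y) ⊕ (Z' ⊕ Y)) (X ⊕ (X ⊕ X)) k :=
  Matrix.fromRows
    (Matrix.fromCols (Matrix.fromRows A0 (rm (fun j => ¬ Pv j) A1))
      (Matrix.fromCols 0 (Matrix.fromRows A0 (rm (fun j => ¬ Pv j) A1))))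
    (Matrix.fromCols 0 (Matrix.fromCols (Matrix.fromRows B0 (rm (fun j => ¬ Pv j) A1))
      (Matrix.fromRows B0 (rm (fun j => ¬ Pv j) A1))))

lemma matMA_zero (Pv : Y → Prop) (z x w : X → k) :
    (matMA A0 A1 B0 Pv).mulVec (Sum.elim z (Sum.elim x w)) = 0 ↔
    A0.mulVec (z + w) = 0 ∧ (∀ j, ¬ Pv j → A1.mulVec (z + w) j = 0) ∧
    B0.mulVec (x + w) = 0 ∧ (∀ j, ¬ Pv j → A1.mulVec (x + w) j = 0) := by
  classical
  unfold matMA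
  simp only [Matrix.fromRows_mulVec, Matrix.fromCols_mulVec, sum_elim_zero, Sum.elim_comp_inl,
    Sum.elim_comp_inr, Matrix.zero_mulVec, zero_add]
  rw [← Matrix.fromRows_mulVec, ← Matrix.fromRows_mulVec, ← Matrix.fromRows_mulVec,
    ← Matrix.fromRows_mulVec, ← Matrix.mulVec_add, ← Matrix.mulVec_add]
  simp only [Matrix.fromRows_mulVec, sum_elim_zero, rm_eq_zero, and_assoc]

open Classical in
lemma f_MA (Ps : X → Prop) (Pu : Y → Prop) (Pt : X → Prop) (Pv : Y → Prop)
    (hst : ∀ j, Ps j → Pt j) (huv : ∀ j, Pu j → Pv j)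
    (hA : ∀ x ∈ Cs (k := k) Ps, ∀ j, Pv j → ¬ Pu j → A1.mulVec x j = 0) :
    phi T0 (Submodule.map (FG A0 A1 B0) (SGF Pt Pv)) (Submodule.map (FG A0 A1 B0) (SGF Ps Pu))
      + finrank k (Cs (k := k) (Sum.elim Ps (Sum.elim Ps (fun j => Pt j ∧ ¬ Ps j)))) =
    finrank k (Submodule.map (matMA A0 A1 B0 Pv).mulVecLin
       (Cs (Sum.elim Ps (Sum.elim Ps (fun j => Pt j ∧ ¬ Ps j)))))
      + finrank k ((SGF (k := k) Ps Pu).prod (SGF (k := k) Pt Pv)) := by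
  rw [phi_param]
  let px : ((X → k) × (X → k) × (Y → k)) →ₗ[k] (X → k) :=
    LinearMap.fst k _ _ ∘ₗ LinearMap.snd k _ _
  let p1 := px ∘ₗ LinearMap.fst k ((X → k) × (X → k) × (Y → k)) ((X → k) × (X → k) × (Y → k))
  let p2 := px ∘ₗ LinearMap.snd k ((X → k) × (X → k) × (Y → k)) ((X → k) × (X → k) × (Y → k))
  have key : ∀ d x e d' x' e', ((T0 ∘ₗ FG A0 A1 B0).coprod (FG A0 A1 B0))
      ((d, x, e), (d', x', e')) = 0 ↔ A0.mulVec (x + x') = 0 ∧ e = - A1.mulVec x ∧ d = - d' ∧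
        B0.mulVec x' = 0 ∧ e' = - A1.mulVec x' ∧ d' = - x' := by
    intro d x e d' x' e'
    simp only [LinearMap.coprod_apply, FG, T0, LinearMap.comp_apply, LinearMap.coe_mk,
      AddHom.coe_mk, LinearMap.fst_apply, Prod.mk_add_mk,
      LinearMap.inl_apply, Prod.mk_eq_zero, Prod.fst_zero, Prod.snd_zero,
      zero_add, Matrix.mulVec_add, ← add_eq_zero_iff_eq_neg]
    constructor
    · rintro ⟨⟨h1, h2, h3⟩, h4, h5, h6⟩
      rw [h5, add_zero] at h2
      exact ⟨h1, h2, h3, h4, h5, h6⟩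
    · rintro ⟨h1, h2, h3, h4, h5, h6⟩
      rw [h5, add_zero]
      exact ⟨⟨h1, h2, h3⟩, h4, rfl, h6⟩
  have comb : ∀ x y : X → k, (∀ j, ¬ Ps j → x j = 0) → cm Ps (x + y) + cm (fun j => ¬ Ps j) y = x + y := by
    intro x y hx
    ext j
    simp only [Pi.add_apply, cm_apply]
    by_cases h : Ps j
    · simp [h]
    · simp [h, hx j h]
  refine ker_count _ _ _ _ (sel (cm Ps ∘ₗ (p1 + p2)) (cm Ps ∘ₗ p2) (cm (fun j => ¬ Ps j) ∘ₗ p2)) ?_ ?_ ?_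
  · rintro ⟨⟨d, x, e⟩, d', x', e'⟩ ha h
    rw [key] at h
    rw [Submodule.mem_prod, mem_SGF, mem_SGF] at ha
    obtain ⟨⟨hx, he⟩, hx', he'⟩ := ha
    simp only at hx he hx' he'
    obtain ⟨h1, h2, h3, h4, h5, h6⟩ := h
    rw [sel_apply]
    have e1 : (cm Ps ∘ₗ (p1 + p2)) ((d, x, e), d', x', e') = cm Ps (x + x') := rfl
    have e2 : (cm Ps ∘ₗ p2) ((d, x, e), d', x', e') = cm Ps x' := rfl
    have e3 : (cm (fun j => ¬ Ps j) ∘ₗ p2) ((d, x, e), d', x', e') = cm (fun j => ¬ Ps j) x' := rfl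
    rw [e1, e2, e3]
    have c1 := comb x x' hx
    have c2 := comb 0 x' (fun _ _ => rfl)
    rw [zero_add] at c2
    refine ⟨?_, ?_⟩
    · rw [mem_Cs3]
      refine ⟨fun j hj => ?_, fun j hj => ?_, fun j hj => ?_⟩
      · simp [cm_apply, hj]
      · simp [cm_apply, hj]
      · simp only [Function.comp_apply, Sum.elim_inr, cm_apply]
        by_cases h : Ps j
        · simp [h]
        · rw [if_pos h]
          exact hx' j (fun h' => hj ⟨h', h⟩)
    · rw [Matrix.mulVecLin_apply, matMA_zero, c1, c2]
      refine ⟨h1, fun j hj => ?_, h4, fun j hj => ?_⟩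
      · have a1 := he j (fun h => hj (huv j h))
        have a2 := he' j hj
        rw [h2] at a1; rw [h5] at a2
        rw [Matrix.mulVec_add, Pi.add_apply, neg_eq_zero.1 a1, neg_eq_zero.1 a2, add_zero]
      · have a2 := he' j hj
        rw [h5] at a2
        exact neg_eq_zero.1 a2
  · rintro ⟨⟨d, x, e⟩, d', x', e'⟩ ha h hg
    rw [key] at h
    rw [Submodule.mem_prod, mem_SGF, mem_SGF] at ha
    obtain ⟨⟨hx, he⟩, hx', he'⟩ := ha
    simp only at hx he hx' he'
    obtain ⟨h1, h2, h3, h4, h5, h6⟩ := h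
    rw [sel_apply, sum_elim_zero, sum_elim_zero] at hg
    have e1 : (cm Ps ∘ₗ (p1 + p2)) ((d, x, e), d', x', e') = cm Ps (x + x') := rfl
    have e2 : (cm Ps ∘ₗ p2) ((d, x, e), d', x', e') = cm Ps x' := rfl
    have e3 : (cm (fun j => ¬ Ps j) ∘ₗ p2) ((d, x, e), d', x', e') = cm (fun j => ¬ Ps j) x' := rfl
    rw [e1, e2, e3] at hg
    have c1 := comb x x' hx
    have c2 := comb 0 x' (fun _ _ => rfl)
    rw [zero_add] at c2
    rw [hg.1, hg.2.2, add_zero] at c1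
    rw [hg.2.1, hg.2.2, add_zero] at c2
    subst c2
    rw [add_zero] at c1
    subst c1
    simp only [Matrix.mulVec_zero, neg_zero] at h2 h5 h6
    subst h6; rw [neg_zero] at h3
    subst h3 h2 h5; rfl
  · intro c hc h
    rw [elim3 c, Matrix.mulVecLin_apply, matMA_zero] at h
    rw [mem_Cs3] at hc
    set z := c ∘ Sum.inl with hz
    set x := c ∘ Sum.inr ∘ Sum.inl with hx
    set w := c ∘ Sum.inr ∘ Sum.inr with hw
    obtain ⟨h1, h2, h3, h4⟩ := h
    obtain ⟨c1, c2, c3⟩ := hc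
    refine ⟨((x + w, z - x, - A1.mulVec (z - x)), (- (x + w), x + w, - A1.mulVec (x + w))), ?_, ?_, ?_⟩
    · rw [Submodule.mem_prod, mem_SGF, mem_SGF]
      have hzx : ∀ j, ¬ Ps j → (z - x) j = 0 := fun j hj => by
        rw [Pi.sub_apply, c1 j hj, c2 j hj, sub_zero]
      refine ⟨⟨hzx, fun j hj => ?_⟩, fun j hj => ?_, fun j hj => ?_⟩
      · simp only [Pi.neg_apply, neg_eq_zero]
        by_cases hv : Pv j
        · exact hA _ hzx j hv hj
        · have : z - x = (z + w) - (x + w) := by abel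
          rw [this, Matrix.mulVec_sub, Pi.sub_apply, h2 j hv, h4 j hv, sub_zero]
      · have hs : ¬ Ps j := fun h => hj (hst j h)
        simp only [Pi.add_apply]
        rw [c2 j hs, c3 j (fun h => hj h.1), add_zero]
      · simp only [Pi.neg_apply, neg_eq_zero]
        exact h4 j hj
    · rw [key]
      refine ⟨?_, rfl, by rw [neg_neg], h3, rfl, rfl⟩
      rw [show z - x + (x + w) = z + w by abel]
      exact h1
    · rw [elim3 c, ← hz, ← hx, ← hw]
      rw [sel_apply]
      have e1 : cm Ps ((z - x) + (x + w)) = z := by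
        ext j
        rw [cm_apply]; split_ifs with h
        · simp [c3 j (fun h' => h'.2 h)]
        · exact (c1 j h).symm
      have e2 : cm Ps (x + w) = x := by
        ext j
        rw [cm_apply]; split_ifs with h
        · simp [c3 j (fun h' => h'.2 h)]
        · exact (c2 j h).symm
      have e3 : cm (fun j => ¬ Ps j) (x + w) = w := by
        ext j
        rw [cm_apply]; split_ifs with h
        · exact (c3 j (fun h' => h'.2 h)).symm
        · simp [c2 j h]
      change Sum.elim (cm Ps ((z - x) + (x + w))) (Sum.elim (cm Ps (x + w)) (cm (fun j => ¬ Ps j) (x + w))) = _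
      rw [e1, e2, e3]

open Classical in
noncomputable def matMB (Pu Pv : Y → Prop) :
    Matrix ((Z ⊕ Y) ⊕ ((Z' ⊕ Y) ⊕ Y)) (X ⊕ (X ⊕ X)) k :=
  Matrix.fromRows
    (Matrix.fromCols (Matrix.fromRows A0 (rm (fun j => ¬ Pv j) A1)) 0)
    (Matrix.fromRows
      (Matrix.fromCols 0 (Matrix.fromCols (Matrix.fromRows B0 (rm (fun j => ¬ Pv j) A1)) 0))
      (Matrix.fromCols (rm (fun j => Pv j ∧ ¬ Pu j) A1)
        (Matrix.fromCols (rm (fun j => Pv j ∧ ¬ Pu j) A1) 0)))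

lemma matMB_zero (Pu Pv : Y → Prop) (z x w : X → k) :
    (matMB A0 A1 B0 Pu Pv).mulVec (Sum.elim z (Sum.elim x w)) = 0 ↔
    A0.mulVec z = 0 ∧ (∀ j, ¬ Pv j → A1.mulVec z j = 0) ∧
    B0.mulVec x = 0 ∧ (∀ j, ¬ Pv j → A1.mulVec x j = 0) ∧
    (∀ j, Pv j ∧ ¬ Pu j → A1.mulVec (z + x) j = 0) := by
  classical
  unfold matMB
  simp only [Matrix.fromRows_mulVec, Matrix.fromCols_mulVec, sum_elim_zero, Sum.elim_comp_inl,
    Sum.elim_comp_inr, Matrix.zero_mulVec, zero_add, add_zero]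
  rw [← Matrix.mulVec_add]
  simp only [Matrix.fromRows_mulVec, sum_elim_zero, rm_eq_zero, and_assoc]

open Classical in
lemma f_MB (Ps : X → Prop) (Pu : Y → Prop) (Pv : Y → Prop)
    (huv : ∀ j, Pu j → Pv j)
    (hA0 : ∀ x ∈ Cs (k := k) (fun j => ¬ Ps j), A0.mulVec x = 0)
    (hB0 : ∀ x ∈ Cs (k := k) (fun j => ¬ Ps j), B0.mulVec x = 0)
    (hA1 : ∀ x ∈ Cs (k := k) (fun j => ¬ Ps j), ∀ j, ¬ Pv j → A1.mulVec x j = 0) :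
    phi T0 (Submodule.map (FG A0 A1 B0) (SGF (fun _ => True) Pv)) (Submodule.map (FG A0 A1 B0) (SGF Ps Pu))
      + finrank k (Cs (k := k) (Sum.elim Ps (Sum.elim Ps (fun j => ¬ Ps j)))) =
    finrank k (Submodule.map (matMB A0 A1 B0 Pu Pv).mulVecLin
       (Cs (Sum.elim Ps (Sum.elim Ps (fun j => ¬ Ps j)))))
      + finrank k ((SGF (k := k) Ps Pu).prod (SGF (k := k) (fun _ : X => True) Pv)) := by
  rw [phi_param]
  let px : ((X → k) × (X → k) × (Y → k)) →ₗ[k] (X → k) :=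
    LinearMap.fst k _ _ ∘ₗ LinearMap.snd k _ _
  let p1 := px ∘ₗ LinearMap.fst k ((X → k) × (X → k) × (Y → k)) ((X → k) × (X → k) × (Y → k))
  let p2 := px ∘ₗ LinearMap.snd k ((X → k) × (X → k) × (Y → k)) ((X → k) × (X → k) × (Y → k))
  have key : ∀ d x e d' x' e', ((T0 ∘ₗ FG A0 A1 B0).coprod (FG A0 A1 B0))
      ((d, x, e), (d', x', e')) = 0 ↔ A0.mulVec (x + x') = 0 ∧ e = - A1.mulVec x ∧ d = - d' ∧
        B0.mulVec x' = 0 ∧ e' = - A1.mulVec x' ∧ d' = - x' := by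
    intro d x e d' x' e'
    simp only [LinearMap.coprod_apply, FG, T0, LinearMap.comp_apply, LinearMap.coe_mk,
      AddHom.coe_mk, LinearMap.fst_apply, Prod.mk_add_mk,
      LinearMap.inl_apply, Prod.mk_eq_zero, Prod.fst_zero, Prod.snd_zero,
      zero_add, Matrix.mulVec_add, ← add_eq_zero_iff_eq_neg]
    constructor
    · rintro ⟨⟨h1, h2, h3⟩, h4, h5, h6⟩
      rw [h5, add_zero] at h2
      exact ⟨h1, h2, h3, h4, h5, h6⟩
    · rintro ⟨h1, h2, h3, h4, h5, h6⟩
      rw [h5, add_zero]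
      exact ⟨⟨h1, h2, h3⟩, h4, rfl, h6⟩
  refine ker_count _ _ _ _ (sel (cm Ps ∘ₗ (p1 + p2)) (- (cm Ps ∘ₗ p2))
    (cm (fun j => ¬ Ps j) ∘ₗ p2)) ?_ ?_ ?_
  · rintro ⟨⟨d, x, e⟩, d', x', e'⟩ ha h
    rw [key] at h
    rw [Submodule.mem_prod, mem_SGF, mem_SGF] at ha
    obtain ⟨⟨hx, he⟩, hx', he'⟩ := ha
    simp only at hx he hx' he'
    obtain ⟨h1, h2, h3, h4, h5, h6⟩ := h
    rw [sel_apply]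
    have e1 : (cm Ps ∘ₗ (p1 + p2)) ((d, x, e), d', x', e') = cm Ps (x + x') := rfl
    have e2 : (-(cm Ps ∘ₗ p2)) ((d, x, e), d', x', e') = - cm Ps x' := rfl
    have e3 : (cm (fun j => ¬ Ps j) ∘ₗ p2) ((d, x, e), d', x', e') = cm (fun j => ¬ Ps j) x' := rfl
    rw [e1, e2, e3]
    have hsp : x' = cm Ps x' + cm (fun j => ¬ Ps j) x' := by
      ext j; simp only [Pi.add_apply, cm_apply]; by_cases h : Ps j <;> simp [h]
    have hwm : cm (fun j => ¬ Ps j) x' ∈ Cs (k := k) (fun j => ¬ Ps j) := fun j hj => by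
      rw [cm_apply, if_neg hj]
    have hz : cm Ps (x + x') = x + cm Ps x' := by
      ext j; simp only [Pi.add_apply, cm_apply]; by_cases h : Ps j
      · simp [h]
      · simp [h, hx j h]
    refine ⟨?_, ?_⟩
    · rw [mem_Cs3]
      refine ⟨fun j hj => ?_, fun j hj => ?_, fun j hj => ?_⟩
      · simp [cm_apply, hj]
      · simp [cm_apply, hj]
      · exact hwm j hj
    · rw [Matrix.mulVecLin_apply, matMB_zero]
      have q1 := hA0 _ hwm
      have q2 := hB0 _ hwm
      have q3 := hA1 _ hwm
      have r1 : ∀ j, ¬ Pv j → A1.mulVec (cm Ps x') j = 0 := by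
        intro j hj
        have := he' j hj
        rw [h5, Pi.neg_apply, neg_eq_zero, hsp, Matrix.mulVec_add, Pi.add_apply, q3 j hj,
          add_zero] at this
        exact this
      have r2 : ∀ j, ¬ Pu j → A1.mulVec x j = 0 := by
        intro j hj
        have := he j hj
        rwa [h2, Pi.neg_apply, neg_eq_zero] at this
      refine ⟨?_, fun j hj => ?_, ?_, fun j hj => ?_, fun j hj => ?_⟩
      · rw [hz]
        rw [hsp, ← add_assoc, Matrix.mulVec_add, q1, add_zero] at h1
        exact h1
      · rw [hz, Matrix.mulVec_add, Pi.add_apply, r1 j hj, r2 j (fun h => hj (huv j h)), add_zero]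
      · rw [hsp, Matrix.mulVec_add, q2, add_zero] at h4
        rw [Matrix.mulVec_neg, h4, neg_zero]
      · rw [Matrix.mulVec_neg, Pi.neg_apply, r1 j hj, neg_zero]
      · rw [hz, add_neg_cancel_right]
        exact r2 j hj.2
  · rintro ⟨⟨d, x, e⟩, d', x', e'⟩ ha h hg
    rw [key] at h
    rw [Submodule.mem_prod, mem_SGF, mem_SGF] at ha
    obtain ⟨⟨hx, he⟩, hx', he'⟩ := ha
    simp only at hx he hx' he'
    obtain ⟨h1, h2, h3, h4, h5, h6⟩ := h
    rw [sel_apply, sum_elim_zero, sum_elim_zero] at hg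
    have e1 : (cm Ps ∘ₗ (p1 + p2)) ((d, x, e), d', x', e') = cm Ps (x + x') := rfl
    have e2 : (-(cm Ps ∘ₗ p2)) ((d, x, e), d', x', e') = - cm Ps x' := rfl
    have e3 : (cm (fun j => ¬ Ps j) ∘ₗ p2) ((d, x, e), d', x', e') = cm (fun j => ¬ Ps j) x' := rfl
    rw [e1, e2, e3, neg_eq_zero] at hg
    have hsp : x' = cm Ps x' + cm (fun j => ¬ Ps j) x' := by
      ext j; simp only [Pi.add_apply, cm_apply]; by_cases h : Ps j <;> simp [h]
    have hz : cm Ps (x + x') = x + cm Ps x' := by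
      ext j; simp only [Pi.add_apply, cm_apply]; by_cases h : Ps j
      · simp [h]
      · simp [h, hx j h]
    rw [hg.2.1, hg.2.2, add_zero] at hsp
    rw [hg.1, hg.2.1, add_zero] at hz
    subst hsp hz
    simp only [Matrix.mulVec_zero, neg_zero] at h2 h5 h6
    subst h6; rw [neg_zero] at h3
    subst h3 h2 h5; rfl
  · intro c hc h
    rw [elim3 c, Matrix.mulVecLin_apply, matMB_zero] at h
    rw [mem_Cs3] at hc
    set z := c ∘ Sum.inl with hz
    set x := c ∘ Sum.inr ∘ Sum.inl with hx
    set w := c ∘ Sum.inr ∘ Sum.inr with hw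
    obtain ⟨h1, h2, h3, h4, h5⟩ := h
    obtain ⟨c1, c2, c3⟩ := hc
    have q1 := hA0 _ c3
    have q2 := hB0 _ c3
    have q3 := hA1 _ c3
    refine ⟨((- x + w, z + x, - A1.mulVec (z + x)), (- (- x + w), - x + w, - A1.mulVec (- x + w))), ?_, ?_, ?_⟩
    · rw [Submodule.mem_prod, mem_SGF, mem_SGF]
      refine ⟨⟨fun j hj => ?_, fun j hj => ?_⟩, fun j hj => absurd trivial hj, fun j hj => ?_⟩
      · simp only [Pi.add_apply]; rw [c1 j hj, c2 j hj, add_zero]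
      · simp only [Pi.neg_apply, neg_eq_zero]
        by_cases hv : Pv j
        · exact h5 j ⟨hv, hj⟩
        · rw [Matrix.mulVec_add, Pi.add_apply, h2 j hv, h4 j hv, add_zero]
      · simp only [Pi.neg_apply, neg_eq_zero]
        rw [Matrix.mulVec_add, Pi.add_apply, q3 j hj, Matrix.mulVec_neg, Pi.neg_apply, h4 j hj,
          neg_zero, add_zero]
    · rw [key]
      refine ⟨?_, rfl, by rw [neg_neg], ?_, rfl, rfl⟩
      · rw [show z + x + (-x + w) = z + w by abel, Matrix.mulVec_add, h1, q1, add_zero]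
      · rw [Matrix.mulVec_add, q2, Matrix.mulVec_neg, h3, neg_zero, add_zero]
    · rw [elim3 c, ← hz, ← hx, ← hw]
      rw [sel_apply]
      have e1 : cm Ps ((z + x) + (-x + w)) = z := by
        ext j
        rw [cm_apply]; split_ifs with h
        · simp [c3 j (fun h' => h' h)]
        · exact (c1 j h).symm
      have e2 : - cm Ps (-x + w) = x := by
        ext j
        rw [Pi.neg_apply, cm_apply]; split_ifs with h
        · simp [c3 j (fun h' => h' h)]
        · rw [neg_zero]; exact (c2 j h).symm
      have e3 : cm (fun j => ¬ Ps j) (-x + w) = w := by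
        ext j
        rw [cm_apply]; split_ifs with h
        · exact (c3 j (fun h' => h' h)).symm
        · simp [c2 j h]
      change Sum.elim (cm Ps ((z + x) + (-x + w))) (Sum.elim (- cm Ps (-x + w)) (cm (fun j => ¬ Ps j) (-x + w))) = _
      rw [e1, e2, e3]

open Classical in
lemma f_L (Ps : X → Prop) (Pu Pq : Y → Prop) :
    phi T0 (Submodule.map (FL A0 A1 B0 A1) (SL Pq)) (Submodule.map (FG A0 A1 B0) (SGF Ps Pu))
      + finrank k (Cs (k := k) (Sum.elim Ps (Sum.elim (fun _ : X => True)
          (fun j : Y => Pu j ∧ Pq j)))) =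
    finrank k (Submodule.map (Matrix.fromCols (rm (fun j => ¬ Pu j ∧ ¬ Pq j) A1)
        (0 : Matrix Y (X ⊕ Y) k)).mulVecLin
       (Cs (Sum.elim Ps (Sum.elim (fun _ : X => True) (fun j : Y => Pu j ∧ Pq j)))))
      + finrank k ((SGF (k := k) Ps Pu).prod
          (SL (k := k) (X := X) (Z := Z) (Z' := Z') Pq)) := by
  rw [phi_param]
  let px : ((X → k) × (X → k) × (Y → k)) × Tp k X Y Z Z' →ₗ[k] (X → k) :=
    LinearMap.fst k _ _ ∘ₗ LinearMap.snd k _ _ ∘ₗ LinearMap.fst k _ _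
  let pe : ((X → k) × (X → k) × (Y → k)) × Tp k X Y Z Z' →ₗ[k] (Y → k) :=
    LinearMap.snd k _ _ ∘ₗ LinearMap.snd k _ _ ∘ₗ LinearMap.fst k _ _
  let px' : ((X → k) × (X → k) × (Y → k)) × Tp k X Y Z Z' →ₗ[k] (X → k) :=
    LinearMap.fst k _ _ ∘ₗ LinearMap.snd k _ _ ∘ₗ LinearMap.snd k _ _
  have key : ∀ d x e d' x' e' p p' q, ((T0 ∘ₗ FG A0 A1 B0).coprod (FL A0 A1 B0 A1))
      ((d, x, e), (d', x', e', p, p', q)) = 0 ↔ p = - A0.mulVec (x + x') ∧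
        e + A1.mulVec x = q ∧ d = - d' ∧
        p' = - B0.mulVec x' ∧ e' = - A1.mulVec x' - q ∧ d' = - x' := by
    intro d x e d' x' e' p p' q
    simp only [LinearMap.coprod_apply, FG, FL, T0, LinearMap.comp_apply, LinearMap.coe_mk,
      AddHom.coe_mk, LinearMap.fst_apply, Prod.mk_add_mk,
      LinearMap.inl_apply, Prod.mk_eq_zero, Prod.fst_zero, Prod.snd_zero,
      zero_add, Matrix.mulVec_add, ← add_eq_zero_iff_eq_neg]
    have r1 : p + (A0.mulVec x + A0.mulVec x') = A0.mulVec x + (p + A0.mulVec x') := by abel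
    rw [r1]
    constructor
    · rintro ⟨⟨h1, h2, h3⟩, h4, h5, h6⟩
      have h5' : e' + A1.mulVec x' = - q := by rw [← add_eq_zero_iff_eq_neg]; exact h5
      refine ⟨h1, ?_, h3, h4, ?_, h6⟩
      · rw [h5', ← sub_eq_add_neg, sub_eq_zero] at h2; exact h2
      · rw [eq_sub_iff_add_eq, eq_neg_iff_add_eq_zero, ← h5]; abel
    · rintro ⟨h1, h2, h3, h4, h5, h6⟩
      refine ⟨⟨h1, ?_, h3⟩, h4, ?_, h6⟩
      · rw [h5, h2]; abel
      · rw [h5]; abel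
  refine ker_count _ _ _ _ (sel px px' (cm (fun j => Pu j ∧ Pq j) ∘ₗ pe)) ?_ ?_ ?_
  · rintro ⟨⟨d, x, e⟩, d', x', e', p, p', q⟩ ha h
    rw [key] at h
    rw [Submodule.mem_prod, mem_SGF, mem_SL] at ha
    obtain ⟨⟨hx, he⟩, hq⟩ := ha
    simp only at hx he hq
    obtain ⟨h1, h2, h3, h4, h5, h6⟩ := h
    rw [sel_apply]
    change Sum.elim x (Sum.elim x' (cm (fun j => Pu j ∧ Pq j) e)) ∈ _ ∧ _
    refine ⟨?_, ?_⟩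
    · rw [mem_Cs3]
      refine ⟨hx, fun j hj => absurd trivial hj, fun j hj => ?_⟩
      exact if_neg hj
    · change (Matrix.fromCols _ _).mulVec (Sum.elim x _) = 0
      rw [Matrix.fromCols_mulVec, Matrix.zero_mulVec, add_zero, Sum.elim_comp_inl, rm_eq_zero]
      rintro j ⟨hu, hj⟩
      have := congrFun h2 j
      rw [Pi.add_apply, he j hu, hq j hj, zero_add] at this
      exact this
  · rintro ⟨⟨d, x, e⟩, d', x', e', p, p', q⟩ ha h hg
    rw [key] at h
    rw [Submodule.mem_prod, mem_SGF, mem_SL] at ha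
    obtain ⟨⟨hx, he⟩, hq⟩ := ha
    simp only at hx he hq
    obtain ⟨h1, h2, h3, h4, h5, h6⟩ := h
    rw [sel_apply] at hg
    change Sum.elim x (Sum.elim x' (cm (fun j => Pu j ∧ Pq j) e)) = 0 at hg
    rw [sum_elim_zero, sum_elim_zero] at hg
    obtain ⟨rfl, rfl, g3⟩ := hg
    rw [Matrix.mulVec_zero, add_zero] at h2
    subst h2
    have he0 : e = 0 := by
      ext j
      by_cases hu : Pu j
      · by_cases hj : Pq j
        · have := congrFun g3 j
          rwa [cm_apply, if_pos ⟨hu, hj⟩] at this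
        · exact hq j hj
      · exact he j hu
    subst he0
    simp only [Matrix.mulVec_zero, neg_zero, add_zero, sub_zero] at h1 h4 h5 h6
    subst h1 h4 h5 h6
    rw [neg_zero] at h3
    subst h3; rfl
  · intro c hc h
    rw [elim3 c, Matrix.mulVecLin_apply, Matrix.fromCols_mulVec, Matrix.zero_mulVec, add_zero,
      Sum.elim_comp_inl, rm_eq_zero] at h
    rw [mem_Cs3] at hc
    set x := c ∘ Sum.inl with hx
    set x' := c ∘ Sum.inr ∘ Sum.inl with hx'
    set f := c ∘ Sum.inr ∘ Sum.inr with hf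
    obtain ⟨c1, c2, c3⟩ := hc
    let e : Y → k := fun j => if Pu j then (if Pq j then f j else - A1.mulVec x j) else 0
    refine ⟨((x', x, e), (- x', x', - A1.mulVec x' - (e + A1.mulVec x), - A0.mulVec (x + x'),
      - B0.mulVec x', e + A1.mulVec x)), ?_, ?_, ?_⟩
    · rw [Submodule.mem_prod, mem_SGF, mem_SL]
      refine ⟨⟨c1, fun j hj => if_neg hj⟩, fun j hj => ?_⟩
      simp only [Pi.add_apply, e]
      by_cases hu : Pu j
      · simp [hu, hj]
      · simp [hu, h j ⟨hu, hj⟩]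
    · rw [key]
      exact ⟨rfl, rfl, by rw [neg_neg], rfl, rfl, rfl⟩
    · rw [elim3 c, ← hx, ← hx', ← hf]
      rw [sel_apply]
      have e1 : cm (fun j => Pu j ∧ Pq j) e = f := by
        ext j
        rw [cm_apply]; split_ifs with h
        · simp [e, h.1, h.2]
        · exact (c3 j h).symm
      change Sum.elim x (Sum.elim x' (cm (fun j => Pu j ∧ Pq j) e)) = _
      rw [e1]

end tup3
end FC

set_option linter.unusedSectionVars false
set_option linter.unusedVariables false
set_option linter.unusedSimpArgs false
set_option maxHeartbeats 1000000
namespace FC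
open Submodule Module
section coord
variable {k : Type} [Field k] {x y z z' N : ℕ}

abbrev ColI (x y z z' : ℕ) := Fin x ⊕ Fin x ⊕ Fin y ⊕ Fin z ⊕ Fin z' ⊕ Fin y
abbrev RowI (x y z z' : ℕ) := (Fin z ⊕ Fin y ⊕ Fin x) ⊕ (Fin z' ⊕ Fin y ⊕ Fin x)

def colN : ColI x y z z' → ℕ
  | .inl p => x - 1 - p
  | .inr (.inl p) => x + p
  | .inr (.inr (.inl p)) => 2 * x + (y - 1 - p)
  | .inr (.inr (.inr (.inl p))) => 2 * x + y + (z - 1 - p)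
  | .inr (.inr (.inr (.inr (.inl p)))) => 2 * x + y + z + p
  | .inr (.inr (.inr (.inr (.inr p)))) => 2 * x + y + z + z' + p

def rowN : RowI x y z z' → ℕ
  | .inl (.inl p) => p
  | .inl (.inr (.inl p)) => z + p
  | .inl (.inr (.inr p)) => z + y + p
  | .inr (.inl p) => z + y + x + p
  | .inr (.inr (.inl p)) => z + y + x + z' + p
  | .inr (.inr (.inr p)) => z + y + x + z' + y + p

lemma colN_lt (hN : N = z + y + x + (z' + y + x)) (c : ColI x y z z') : colN c < N := by
  rcases c with p | p | p | p | p | p <;> simp only [colN] <;> omega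

lemma rowN_lt (hN : N = z + y + x + (z' + y + x)) (c : RowI x y z z') : rowN c < N := by
  rcases c with (p | p | p) | (p | p | p) <;> simp only [rowN] <;> omega

lemma colN_inj : Function.Injective (colN (x := x) (y := y) (z := z) (z' := z')) := by
  rintro (p | p | p | p | p | p) (q | q | q | q | q | q) h <;> simp only [colN] at h <;>
    first
    | (exfalso; omega)
    | (have : p = q := Fin.ext (by omega)
       rw [this])

lemma rowN_inj : Function.Injective (rowN (x := x) (y := y) (z := z) (z' := z')) := by
  rintro ((p | p | p) | (p | p | p)) ((q | q | q) | (q | q | q)) h <;> simp only [rowN] at h <;>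
    first
    | (exfalso; omega)
    | (have : p = q := Fin.ext (by omega)
       rw [this])

noncomputable def colE (hN : N = z + y + x + (z' + y + x)) : ColI x y z z' ≃ Fin N :=
  Equiv.ofBijective (fun c => ⟨colN c, colN_lt hN c⟩) (by
    rw [Fintype.bijective_iff_injective_and_card]
    refine ⟨fun a b h => colN_inj (Fin.mk.inj_iff.1 h), ?_⟩
    simp; omega)

noncomputable def rowE (hN : N = z + y + x + (z' + y + x)) : RowI x y z z' ≃ Fin N :=
  Equiv.ofBijective (fun c => ⟨rowN c, rowN_lt hN c⟩) (by
    rw [Fintype.bijective_iff_injective_and_card]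
    refine ⟨fun a b h => rowN_inj (Fin.mk.inj_iff.1 h), ?_⟩
    simp; omega)

lemma colE_val (hN : N = z + y + x + (z' + y + x)) (c : ColI x y z z') :
    ((colE hN c : Fin N) : ℕ) = colN c := rfl
lemma rowE_val (hN : N = z + y + x + (z' + y + x)) (c : RowI x y z z') :
    ((rowE hN c : Fin N) : ℕ) = rowN c := rfl

def tupEl (t : Tp k (Fin x) (Fin y) (Fin z) (Fin z')) : ColI x y z z' → k :=
  Sum.elim t.1 (Sum.elim t.2.1 (Sum.elim t.2.2.1 (Sum.elim t.2.2.2.1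
    (Sum.elim t.2.2.2.2.1 t.2.2.2.2.2))))

def rowEl (t : Rw k (Fin x) (Fin y) (Fin z) (Fin z')) : RowI x y z z' → k :=
  Sum.elim (Sum.elim t.1.1 (Sum.elim t.1.2.1 t.1.2.2)) (Sum.elim t.2.1 (Sum.elim t.2.2.1 t.2.2.2))

noncomputable def cE (hN : N = z + y + x + (z' + y + x)) :
    Tp k (Fin x) (Fin y) (Fin z) (Fin z') →ₗ[k] (Fin N → k) where
  toFun t j := tupEl t ((colE hN).symm j)
  map_add' s t := by
    ext j
    simp only [Pi.add_apply]
    rcases (colE hN).symm j with p | p | p | p | p | p <;> simp [tupEl]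
  map_smul' s t := by
    ext j
    simp only [Pi.smul_apply, RingHom.id_apply]
    rcases (colE hN).symm j with p | p | p | p | p | p <;> simp [tupEl]

noncomputable def rE (hN : N = z + y + x + (z' + y + x)) :
    Rw k (Fin x) (Fin y) (Fin z) (Fin z') →ₗ[k] (Fin N → k) where
  toFun t j := rowEl t ((rowE hN).symm j)
  map_add' s t := by
    ext j
    simp only [Pi.add_apply]
    rcases (rowE hN).symm j with (p | p | p) | (p | p | p) <;> simp [rowEl]
  map_smul' s t := by
    ext j
    simp only [Pi.smul_apply, RingHom.id_apply]
    rcases (rowE hN).symm j with (p | p | p) | (p | p | p) <;> simp [rowEl]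

lemma cE_apply (hN : N = z + y + x + (z' + y + x)) (t : Tp k (Fin x) (Fin y) (Fin z) (Fin z'))
    (c : ColI x y z z') : cE hN t (colE hN c) = tupEl t c := by
  simp [cE]

lemma rE_apply (hN : N = z + y + x + (z' + y + x)) (t : Rw k (Fin x) (Fin y) (Fin z) (Fin z'))
    (c : RowI x y z z') : rE hN t (rowE hN c) = rowEl t c := by
  simp [rE]

lemma cE_surj (hN : N = z + y + x + (z' + y + x)) :
    Function.Surjective (cE (k := k) (x := x) (y := y) (z := z) (z' := z') hN) := by
  intro v
  let w : ColI x y z z' → k := fun c => v (colE hN c)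
  refine ⟨(fun p => w (.inl p), fun p => w (.inr (.inl p)), fun p => w (.inr (.inr (.inl p))),
    fun p => w (.inr (.inr (.inr (.inl p)))), fun p => w (.inr (.inr (.inr (.inr (.inl p))))),
    fun p => w (.inr (.inr (.inr (.inr (.inr p)))))), ?_⟩
  ext j
  obtain ⟨c, rfl⟩ := (colE hN).surjective j
  rw [cE_apply]
  rcases c with p | p | p | p | p | p <;> rfl

lemma rE_inj (hN : N = z + y + x + (z' + y + x)) :
    Function.Injective (rE (k := k) (x := x) (y := y) (z := z) (z' := z') hN) := by
  intro s t h
  have h' : ∀ c, rowEl s c = rowEl t c := fun c => by rw [← rE_apply hN, ← rE_apply hN, h]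
  refine Prod.ext (Prod.ext ?_ (Prod.ext ?_ ?_)) (Prod.ext ?_ (Prod.ext ?_ ?_)) <;> funext p
  · exact h' (.inl (.inl p))
  · exact h' (.inl (.inr (.inl p)))
  · exact h' (.inl (.inr (.inr p)))
  · exact h' (.inr (.inl p))
  · exact h' (.inr (.inr (.inl p)))
  · exact h' (.inr (.inr (.inr p)))

/-- the expected entries -/
def ent (A0 : Matrix (Fin z) (Fin x) k) (A1 : Matrix (Fin y) (Fin x) k)
    (B0 : Matrix (Fin z') (Fin x) k) (B1 : Matrix (Fin y) (Fin x) k) :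
    RowI x y z z' → ColI x y z z' → k
  | .inl (.inl i), .inr (.inl q) => A0 i q
  | .inl (.inl i), .inr (.inr (.inr (.inl q))) => if i = q then 1 else 0
  | .inl (.inr (.inl i)), .inr (.inl q) => A1 i q
  | .inl (.inr (.inl i)), .inr (.inr (.inl q)) => if i = q then 1 else 0
  | .inl (.inr (.inr i)), .inl q => if i = q then 1 else 0
  | .inr (.inl i), .inr (.inl q) => B0 i q
  | .inr (.inl i), .inr (.inr (.inr (.inr (.inl q)))) => if i = q then 1 else 0
  | .inr (.inr (.inl i)), .inr (.inl q) => B1 i q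
  | .inr (.inr (.inl i)), .inr (.inr (.inl q)) => if i = q then 1 else 0
  | .inr (.inr (.inl i)), .inr (.inr (.inr (.inr (.inr q)))) => if i = q then 1 else 0
  | .inr (.inr (.inr i)), .inl q => if i = q then 1 else 0
  | .inr (.inr (.inr i)), .inr (.inl q) => if i = q then 1 else 0
  | _, _ => 0

def Shape (hN : N = z + y + x + (z' + y + x)) (m : Matrix (Fin N) (Fin N) k)
    (A0 : Matrix (Fin z) (Fin x) k) (A1 : Matrix (Fin y) (Fin x) k)
    (B0 : Matrix (Fin z') (Fin x) k) (B1 : Matrix (Fin y) (Fin x) k) : Prop :=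
  ∀ r c, m (rowE hN r) (colE hN c) = ent A0 A1 B0 B1 r c

variable {A0 : Matrix (Fin z) (Fin x) k} {A1 : Matrix (Fin y) (Fin x) k}
    {B0 : Matrix (Fin z') (Fin x) k} {B1 : Matrix (Fin y) (Fin x) k} {m : Matrix (Fin N) (Fin N) k}

lemma Shape.mul {hN : N = z + y + x + (z' + y + x)} (h : Shape hN m A0 A1 B0 B1)
    (t : Tp k (Fin x) (Fin y) (Fin z) (Fin z')) :
    m.mulVecLin (cE hN t) = rE hN (FL A0 A1 B0 B1 t) := by
  ext i
  obtain ⟨r, rfl⟩ := (rowE hN).surjective i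
  rw [rE_apply, Matrix.mulVecLin_apply, Matrix.mulVec, dotProduct,
    ← Fintype.sum_equiv (colE hN) (fun c => ent A0 A1 B0 B1 r c * tupEl t c) _
      (fun c => by rw [h r c, cE_apply])]
  simp only [Fintype.sum_sum_type]
  rcases r with (p | p | p) | (p | p | p) <;>
    simp [ent, tupEl, rowEl, FL, Matrix.mulVec, dotProduct, add_comm, add_left_comm, add_assoc]

lemma FL_inj : Function.Injective (FL A0 A1 B0 B1) := by
  rw [← LinearMap.ker_eq_bot, LinearMap.ker_eq_bot']
  rintro ⟨d, x, e, p, p', q⟩ h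
  simp only [FL, LinearMap.coe_mk, AddHom.coe_mk, Prod.mk_eq_zero] at h
  obtain ⟨⟨h1, h2, h3⟩, h4, h5, h6⟩ := h
  subst h3; rw [zero_add] at h6; subst h6
  simp only [Matrix.mulVec_zero, add_zero] at h1 h2 h4 h5
  subst h1 h2 h4; rw [zero_add] at h5; subst h5; rfl

lemma Shape.unit {hN : N = z + y + x + (z' + y + x)} (h : Shape hN m A0 A1 B0 B1) :
    IsUnit m := by
  rw [← Matrix.mulVec_injective_iff_isUnit]
  intro u v huv
  obtain ⟨s, rfl⟩ := cE_surj hN u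
  obtain ⟨t, rfl⟩ := cE_surj hN v
  have : m.mulVecLin (cE hN s) = m.mulVecLin (cE hN t) := huv
  rw [h.mul, h.mul] at this
  rw [FL_inj (rE_inj hN this)]

lemma Shape.Fl {hN : N = z + y + x + (z' + y + x)} (h : Shape hN m A0 A1 B0 B1) (i : ℕ)
    (S : Submodule k (Tp k (Fin x) (Fin y) (Fin z) (Fin z')))
    (hS : ∀ t, t ∈ S ↔ ∀ c, i ≤ colN c → tupEl t c = 0) :
    Fl m i = Submodule.map (rE hN) (Submodule.map (FL A0 A1 B0 B1) S) := by
  have e : Est k N i = Submodule.map (cE hN) S := by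
    ext v
    rw [mem_Est]
    constructor
    · intro hv
      obtain ⟨t, rfl⟩ := cE_surj hN v
      refine ⟨t, (hS t).2 fun c hc => ?_, rfl⟩
      rw [← cE_apply hN]; exact hv _ hc
    · rintro ⟨t, ht, rfl⟩ j hj
      obtain ⟨c, rfl⟩ := (colE hN).surjective j
      rw [cE_apply]
      exact (hS t).1 ht c hj
  rw [FC.Fl, e, ← Submodule.map_comp, ← Submodule.map_comp]
  congr 1
  exact LinearMap.ext fun t => h.mul t

lemma map_inclD (Pd : Fin x → Prop) : Submodule.map (FL A0 A1 B0 B1)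
    (Submodule.map (LinearMap.inl k _ _) (Cs Pd)) = Submodule.map FD (Cs Pd) := by
  rw [← Submodule.map_comp]; congr 1
  refine LinearMap.ext fun t => ?_
  simp [FL, FD]

def inclG : (Fin x → k) × (Fin x → k) × (Fin y → k) →ₗ[k]
    Tp k (Fin x) (Fin y) (Fin z) (Fin z') where
  toFun t := (t.1, t.2.1, t.2.2, 0, 0, 0)
  map_add' s t := by simp
  map_smul' s t := by simp

lemma map_inclG (Ps : Fin x → Prop) (Pu : Fin y → Prop) : Submodule.map (FL A0 A1 B0 A1)
    (Submodule.map inclG (SGF Ps Pu)) = Submodule.map (FG A0 A1 B0) (SGF Ps Pu) := by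
  rw [← Submodule.map_comp]; congr 1
  refine LinearMap.ext fun t => ?_
  simp [FL, FG, inclG]

lemma Shape.FlD {hN : N = z + y + x + (z' + y + x)} (h : Shape hN m A0 A1 B0 B1) (s : ℕ) :
    FC.Fl m (x - s) = Submodule.map (rE hN) (Submodule.map FD (Cs (fun p : Fin x => s ≤ p))) := by
  rw [h.Fl (x - s) (Submodule.map (LinearMap.inl k _ _) (Cs (fun p : Fin x => s ≤ p))), map_inclD]
  intro t
  constructor
  · rintro ⟨d, hd, rfl⟩ c hc
    rcases c with p | p | p | p | p | p <;> simp only [colN] at hc <;>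
      simp only [tupEl, LinearMap.inl_apply, Sum.elim_inl, Sum.elim_inr, Pi.zero_apply,
        Prod.fst_zero, Prod.snd_zero]
    exact hd p (by omega)
  · intro ht
    refine ⟨t.1, fun p hp => ht (.inl p) (by simp only [colN]; omega), ?_⟩
    obtain ⟨d, x, e, p, p', q⟩ := t
    simp only [LinearMap.inl_apply, Prod.mk.injEq, true_and, Prod.zero_eq_mk]
    refine ⟨?_, ?_, ?_, ?_, ?_⟩ <;> funext j <;> symm
    · exact ht (.inr (.inl j)) (by simp only [colN]; omega)
    · exact ht (.inr (.inr (.inl j))) (by simp only [colN]; omega)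
    · exact ht (.inr (.inr (.inr (.inl j)))) (by simp only [colN]; omega)
    · exact ht (.inr (.inr (.inr (.inr (.inl j))))) (by simp only [colN]; omega)
    · exact ht (.inr (.inr (.inr (.inr (.inr j))))) (by simp only [colN]; omega)

lemma Shape.FlG {hN : N = z + y + x + (z' + y + x)} (h : Shape hN m A0 A1 B0 A1) (s : ℕ)
    (hs : s ≤ x) :
    FC.Fl m (x + s) = Submodule.map (rE hN) (Submodule.map (FG A0 A1 B0)
      (SGF (fun p : Fin x => (p : ℕ) < s) (fun p : Fin y => False))) := by
  rw [h.Fl (x + s) (Submodule.map inclG (SGF (fun p : Fin x => (p : ℕ) < s) (fun p : Fin y => False))),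
    map_inclG]
  intro t
  constructor
  · rintro ⟨⟨d, x, e⟩, hd, rfl⟩ c hc
    replace hd := (mem_SGF _ _ _).1 hd
    rcases c with p | p | p | p | p | p <;> simp only [colN] at hc <;>
      simp only [tupEl, inclG, LinearMap.coe_mk, AddHom.coe_mk, Sum.elim_inl, Sum.elim_inr,
        Pi.zero_apply]
    · omega
    · exact hd.1 p (by omega)
    · exact hd.2 p not_false
  · intro ht
    refine ⟨(t.1, t.2.1, t.2.2.1), (mem_SGF _ _ _).2
      ⟨fun p hp => ht (.inr (.inl p)) (by simp only [colN]; omega),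
      fun p hp => ht (.inr (.inr (.inl p))) (by simp only [colN]; omega)⟩, ?_⟩
    obtain ⟨d, x, e, p, p', q⟩ := t
    simp only [inclG, LinearMap.coe_mk, AddHom.coe_mk, Prod.mk.injEq, true_and]
    refine ⟨?_, ?_, ?_⟩ <;> funext j <;> symm
    · exact ht (.inr (.inr (.inr (.inl j)))) (by simp only [colN]; omega)
    · exact ht (.inr (.inr (.inr (.inr (.inl j))))) (by simp only [colN]; omega)
    · exact ht (.inr (.inr (.inr (.inr (.inr j))))) (by simp only [colN]; omega)

lemma Shape.FlH {hN : N = z + y + x + (z' + y + x)} (h : Shape hN m A0 A1 B0 A1) (s : ℕ)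
    (hs : s ≤ y) :
    FC.Fl m (2 * x + y - s) = Submodule.map (rE hN) (Submodule.map (FG A0 A1 B0)
      (SGF (fun p : Fin x => True) (fun p : Fin y => s ≤ (p : ℕ)))) := by
  rw [h.Fl (2 * x + y - s) (Submodule.map inclG (SGF (fun p : Fin x => True)
    (fun p : Fin y => s ≤ (p : ℕ)))), map_inclG]
  intro t
  constructor
  · rintro ⟨⟨d, x, e⟩, hd, rfl⟩ c hc
    replace hd := (mem_SGF _ _ _).1 hd
    rcases c with p | p | p | p | p | p <;> simp only [colN] at hc <;>
      simp only [tupEl, inclG, LinearMap.coe_mk, AddHom.coe_mk, Sum.elim_inl, Sum.elim_inr,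
        Pi.zero_apply]
    · omega
    · omega
    · exact hd.2 p (by omega)
  · intro ht
    refine ⟨(t.1, t.2.1, t.2.2.1), (mem_SGF _ _ _).2
      ⟨fun p hp => absurd trivial hp,
      fun p hp => ht (.inr (.inr (.inl p))) (by simp only [colN]; omega)⟩, ?_⟩
    obtain ⟨d, x, e, p, p', q⟩ := t
    simp only [inclG, LinearMap.coe_mk, AddHom.coe_mk, Prod.mk.injEq, true_and]
    refine ⟨?_, ?_, ?_⟩ <;> funext j <;> symm
    · exact ht (.inr (.inr (.inr (.inl j)))) (by simp only [colN]; omega)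
    · exact ht (.inr (.inr (.inr (.inr (.inl j))))) (by simp only [colN]; omega)
    · exact ht (.inr (.inr (.inr (.inr (.inr j))))) (by simp only [colN]; omega)

lemma Shape.FlL {hN : N = z + y + x + (z' + y + x)} (h : Shape hN m A0 A1 B0 B1) (s : ℕ) :
    FC.Fl m (2 * x + y + z + z' + s) = Submodule.map (rE hN) (Submodule.map (FL A0 A1 B0 B1)
      (SL (fun p : Fin y => (p : ℕ) < s))) := by
  refine h.Fl (2 * x + y + z + z' + s) _ (fun t => ?_)
  rw [mem_SL]
  constructor
  · intro ht c hc
    rcases c with p | p | p | p | p | p <;> simp only [colN] at hc <;> try omega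
    exact ht p (by omega)
  · intro ht p hp
    exact ht (.inr (.inr (.inr (.inr (.inr p))))) (by simp only [colN]; omega)

/-- projection to the first `s` coordinates -/
def TT (k : Type) [Field k] (N s : ℕ) : (Fin N → k) →ₗ[k] (Fin N → k) :=
  cm (fun j : Fin N => (j : ℕ) < s)
def TT' (k : Type) [Field k] (N s : ℕ) : (Fin N → k) →ₗ[k] (Fin N → k) :=
  cm (fun j : Fin N => ¬ (j : ℕ) < s)

lemma TT_Pr (s : ℕ) : Pr (TT k N s) (TT' k N s) := by
  refine ⟨fun v => ?_, fun v => ?_, fun v => ?_⟩ <;> ext j <;>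
    simp only [TT, TT', Pi.add_apply, cm_apply, Pi.zero_apply] <;> split_ifs <;> simp_all

lemma TT_rE (hN : N = z + y + x + (z' + y + x)) (t : Rw k (Fin x) (Fin y) (Fin z) (Fin z')) :
    TT k N (z + y + x) (rE hN t) = rE hN (T0 t) := by
  ext j
  obtain ⟨c, rfl⟩ := (rowE hN).surjective j
  rw [TT, cm_apply, rE_apply, rE_apply, rowE_val]
  rcases c with (p | p | p) | (p | p | p)
  · exact if_pos (show rowN _ < _ by simp only [rowN]; omega)
  · exact if_pos (show rowN _ < _ by simp only [rowN]; omega)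
  · exact if_pos (show rowN _ < _ by simp only [rowN]; omega)
  · exact if_neg (show ¬ rowN _ < _ by simp only [rowN]; omega)
  · exact if_neg (show ¬ rowN _ < _ by simp only [rowN]; omega)
  · exact if_neg (show ¬ rowN _ < _ by simp only [rowN]; omega)

lemma TT'_rE (hN : N = z + y + x + (z' + y + x)) (t : Rw k (Fin x) (Fin y) (Fin z) (Fin z')) :
    TT' k N (z + y + x) (rE hN t) = rE hN (T0' t) := by
  ext j
  obtain ⟨c, rfl⟩ := (rowE hN).surjective j
  rw [TT', cm_apply, rE_apply, rE_apply, rowE_val]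
  rcases c with (p | p | p) | (p | p | p)
  · exact if_neg (show ¬ ¬ rowN _ < _ by simp only [rowN]; omega)
  · exact if_neg (show ¬ ¬ rowN _ < _ by simp only [rowN]; omega)
  · exact if_neg (show ¬ ¬ rowN _ < _ by simp only [rowN]; omega)
  · exact if_pos (show ¬ rowN _ < _ by simp only [rowN]; omega)
  · exact if_pos (show ¬ rowN _ < _ by simp only [rowN]; omega)
  · exact if_pos (show ¬ rowN _ < _ by simp only [rowN]; omega)

lemma phi_inj {U U' : Type} [AddCommGroup U] [Module k U] [AddCommGroup U'] [Module k U']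
    (r : U →ₗ[k] U') (hr : Function.Injective r) (T : U →ₗ[k] U) (T' : U' →ₗ[k] U')
    (hT : ∀ u, T' (r u) = r (T u)) (S Q : Submodule k U) :
    phi T' (Submodule.map r S) (Submodule.map r Q) = phi T S Q := by
  unfold phi
  have : Submodule.map T' (Submodule.map r Q) = Submodule.map r (Submodule.map T Q) := by
    rw [← Submodule.map_comp, ← Submodule.map_comp]; congr 1
    exact LinearMap.ext hT
  rw [this, ← Submodule.map_sup]
  exact (Submodule.equivMapOfInjective _ hr _).symm.finrank_eq

lemma phi_rE (hN : N = z + y + x + (z' + y + x))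
    (S Q : Submodule k (Rw k (Fin x) (Fin y) (Fin z) (Fin z'))) :
    phi (TT k N (z + y + x)) (Submodule.map (rE hN) S) (Submodule.map (rE hN) Q) = phi T0 S Q :=
  phi_inj _ (rE_inj hN) _ _ (TT_rE hN) S Q

lemma phi_rE' (hN : N = z + y + x + (z' + y + x))
    (S Q : Submodule k (Rw k (Fin x) (Fin y) (Fin z) (Fin z'))) :
    phi (TT' k N (z + y + x)) (Submodule.map (rE hN) S) (Submodule.map (rE hN) Q) = phi T0' S Q :=
  phi_inj _ (rE_inj hN) _ _ (TT'_rE hN) S Q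

end coord
end FC

set_option linter.unusedSectionVars false
set_option linter.unusedVariables false
set_option linter.unusedSimpArgs false
set_option maxHeartbeats 1000000
namespace FC
open Submodule Module
section dict1
variable {k : Type} [Field k]

lemma fr_zero_iff {ι κ : Type} [Fintype ι] [Fintype κ] (M : Matrix ι κ k) (Q : κ → Prop) :
    finrank k (Submodule.map M.mulVecLin (Cs Q)) = 0 ↔ ∀ i j, Q j → M i j = 0 := by
  classical
  rw [Submodule.finrank_eq_zero]
  constructor
  · intro h i j hj
    have : M.mulVecLin (Pi.single j 1) ∈ Submodule.map M.mulVecLin (Cs Q) := by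
      refine ⟨Pi.single j 1, fun l hl => ?_, rfl⟩
      rw [Pi.single_eq_of_ne]; rintro rfl; exact hl hj
    rw [h, mem_bot] at this
    have := congrFun this i
    simpa using this
  · intro h
    rw [eq_bot_iff]
    rintro _ ⟨v, hv, rfl⟩
    rw [mem_bot]
    ext i
    rw [Matrix.mulVecLin_apply, Matrix.mulVec, dotProduct]
    refine Finset.sum_eq_zero (fun j _ => ?_)
    by_cases hj : Q j
    · rw [h i j hj, zero_mul]
    · rw [hv j hj, mul_zero]

section gen
variable {X Y Z Z' : Type} [Fintype X] [Fintype Y] [Fintype Z] [Fintype Z']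
variable (A0 : Matrix Z X k) (A1 : Matrix Y X k) (B0 : Matrix Z' X k)

open Classical in
noncomputable def RA (Ps : X → Prop) (Pu : Y → Prop) : ℕ :=
  finrank k (Submodule.map (Matrix.fromRows A0 (rm (fun j => ¬ Pu j) A1)).mulVecLin (Cs Ps))

open Classical in
noncomputable def RD (Pd Ps : X → Prop) (Pu : Y → Prop) : ℕ :=
  finrank k (Submodule.map (Matrix.fromRows A0 (Matrix.fromRows B0 (rm (fun j => ¬ Pu j) A1))).mulVecLin
      (Cs (fun j => Pd j ∧ Ps j)))

noncomputable def RMA (Ps Pt : X → Prop) (Pv : Y → Prop) : ℕ :=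
  finrank k (Submodule.map (matMA A0 A1 B0 Pv).mulVecLin
       (Cs (Sum.elim Ps (Sum.elim Ps (fun j => Pt j ∧ ¬ Ps j)))))

noncomputable def RMB (Ps : X → Prop) (Pu Pv : Y → Prop) : ℕ :=
  finrank k (Submodule.map (matMB A0 A1 B0 Pu Pv).mulVecLin
       (Cs (Sum.elim Ps (Sum.elim Ps (fun j => ¬ Ps j)))))

open Classical in
noncomputable def RL (Ps : X → Prop) (Pu Pq : Y → Prop) : ℕ :=
  finrank k (Submodule.map (Matrix.fromCols (rm (fun j => ¬ Pu j ∧ ¬ Pq j) A1)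
        (0 : Matrix Y (X ⊕ Y) k)).mulVecLin
       (Cs (Sum.elim Ps (Sum.elim (fun _ : X => True) (fun j : Y => Pu j ∧ Pq j)))))
end gen

variable {x y z z' N : ℕ} {hN : N = z + y + x + (z' + y + x)}
variable {A0 C0 : Matrix (Fin z) (Fin x) k} {A1 B1 C1 D1 : Matrix (Fin y) (Fin x) k}
    {B0 D0 : Matrix (Fin z') (Fin x) k} {m m' : Matrix (Fin N) (Fin N) k}

/-- `< s` -/
abbrev lt' (s : ℕ) {x : ℕ} : Fin x → Prop := fun p => (p : ℕ) < s
abbrev ge' (s : ℕ) {x : ℕ} : Fin x → Prop := fun p => s ≤ (p : ℕ)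

lemma Shape.FlGH (h : Shape hN m A0 A1 B0 A1) {s u : ℕ} (hs : s ≤ x) (hu : u ≤ y)
    (hsu : s = x ∨ u = y) :
    FC.Fl m (x + s + (y - u)) = Submodule.map (rE hN) (Submodule.map (FG A0 A1 B0) (SGF (lt' s) (ge' u))) := by
  rcases hsu with rfl | rfl
  · have := h.FlH u hu
    have e : s + s + (y - u) = 2 * s + y - u := by omega
    have e2 : (lt' s : Fin s → Prop) = fun _ => True := by funext p; simp [lt']
    rw [e, this, e2]
  · have := h.FlG s hs
    have e2 : (ge' u : Fin u → Prop) = fun _ => False := by funext p; simp [ge']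
    rw [Nat.sub_self, Nat.add_zero, this, e2]

lemma Shape.FlD' (h : Shape hN m A0 A1 B0 B1) (s : ℕ) :
    FC.Fl m (x - s) = Submodule.map (rE hN) (Submodule.map FD (Cs (ge' s))) := h.FlD s
lemma Shape.FlL' (h : Shape hN m A0 A1 B0 B1) (s : ℕ) :
    FC.Fl m (2 * x + y + z + z' + s) = Submodule.map (rE hN) (Submodule.map (FL A0 A1 B0 B1) (SL (lt' s))) := h.FlL s

lemma iff_A (h : Shape hN m A0 A1 B0 A1) (h' : Shape hN m' C0 C1 D0 C1) {s u : ℕ} (hs : s ≤ x)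
    (hu : u ≤ y) (hsu : s = x ∨ u = y) :
    phi (TT k N (z+y+x)) ⊥ (Fl m (x + s + (y - u))) ≤
      phi (TT k N (z+y+x)) ⊥ (Fl m' (x + s + (y - u))) ↔
    RA A0 A1 (lt' s) (ge' u) ≤ RA C0 C1 (lt' s) (ge' u) := by
  rw [h.FlGH hs hu hsu, h'.FlGH hs hu hsu, ← Submodule.map_bot (rE hN), phi_rE, phi_rE]
  have e1 := f_A A0 A1 B0 (lt' s) (ge' u)
  have e2 := f_A C0 C1 D0 (lt' s) (ge' u)
  unfold RA; omega

lemma iff_B (h : Shape hN m A0 A1 B0 A1) (h' : Shape hN m' C0 C1 D0 C1) {s u : ℕ} (hs : s ≤ x)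
    (hu : u ≤ y) (hsu : s = x ∨ u = y) :
    phi (TT' k N (z+y+x)) ⊥ (Fl m (x + s + (y - u))) ≤
      phi (TT' k N (z+y+x)) ⊥ (Fl m' (x + s + (y - u))) ↔
    RA B0 A1 (lt' s) (ge' u) ≤ RA D0 C1 (lt' s) (ge' u) := by
  rw [h.FlGH hs hu hsu, h'.FlGH hs hu hsu, ← Submodule.map_bot (rE hN), phi_rE', phi_rE']
  have e1 := f_B A0 A1 B0 (lt' s) (ge' u)
  have e2 := f_B C0 C1 D0 (lt' s) (ge' u)
  unfold RA; omega

lemma iff_D (h : Shape hN m A0 A1 B0 A1) (h' : Shape hN m' C0 C1 D0 C1) (t : ℕ) {s u : ℕ}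
    (hs : s ≤ x) (hu : u ≤ y) (hsu : s = x ∨ u = y) :
    phi (TT k N (z+y+x)) (Fl m (x + s + (y - u))) (Fl m (x - t)) ≤
      phi (TT k N (z+y+x)) (Fl m' (x + s + (y - u))) (Fl m' (x - t)) ↔
    RD A0 A1 B0 (ge' t) (lt' s) (ge' u) ≤ RD C0 C1 D0 (ge' t) (lt' s) (ge' u) := by
  rw [h.FlGH hs hu hsu, h'.FlGH hs hu hsu, h.FlD', h'.FlD', phi_rE, phi_rE]
  have e1 := f_D A0 A1 B0 (ge' t) (lt' s) (ge' u)
  have e2 := f_D C0 C1 D0 (ge' t) (lt' s) (ge' u)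
  unfold RD; omega

/-- rows `≥ v` of `A1` vanish on columns `< s` -/
def Van (A1 : Matrix (Fin y) (Fin x) k) (R : Fin y → Prop) (Q : Fin x → Prop) : Prop :=
  ∀ i j, R i → Q j → A1 i j = 0

lemma mulVec_van {w : ℕ} {A : Matrix (Fin w) (Fin x) k} {i : Fin w} {Q : Fin x → Prop}
    (h : ∀ j, Q j → A i j = 0) {v : Fin x → k} (hv : v ∈ Cs (k := k) Q) : A.mulVec v i = 0 := by
  rw [Matrix.mulVec, dotProduct]
  refine Finset.sum_eq_zero (fun j _ => ?_)
  by_cases hj : Q j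
  · rw [h j hj, zero_mul]
  · rw [hv j hj, mul_zero]

lemma iff_MA (h : Shape hN m A0 A1 B0 A1) (h' : Shape hN m' C0 C1 D0 C1) {t s u : ℕ}
    (hs : s ≤ x) (hu : u ≤ y) (hsu : s = x ∨ u = y) (ht : t ≤ s)
    (hA : Van A1 (ge' u) (lt' t)) (hC : Van C1 (ge' u) (lt' t)) :
    phi (TT k N (z+y+x)) (Fl m (x + s + (y - u))) (Fl m (x + t + (y - y))) ≤
      phi (TT k N (z+y+x)) (Fl m' (x + s + (y - u))) (Fl m' (x + t + (y - y))) ↔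
    RMA A0 A1 B0 (lt' t) (lt' s) (ge' u) ≤ RMA C0 C1 D0 (lt' t) (lt' s) (ge' u) := by
  rw [h.FlGH hs hu hsu, h'.FlGH hs hu hsu, h.FlGH (ht.trans hs) le_rfl (Or.inr rfl),
    h'.FlGH (ht.trans hs) le_rfl (Or.inr rfl), phi_rE, phi_rE]
  have e1 := f_MA A0 A1 B0 (lt' t) (ge' y) (lt' s) (ge' u) (fun j hj => lt_of_lt_of_le hj ht)
    (fun j hj => absurd hj (by simp [ge']))
    (fun v hv i hi _ => mulVec_van (fun j hj => hA i j hi hj) hv)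
  have e2 := f_MA C0 C1 D0 (lt' t) (ge' y) (lt' s) (ge' u) (fun j hj => lt_of_lt_of_le hj ht)
    (fun j hj => absurd hj (by simp [ge']))
    (fun v hv i hi _ => mulVec_van (fun j hj => hC i j hi hj) hv)
  unfold RMA; omega

lemma iff_MB (h : Shape hN m A0 A1 B0 A1) (h' : Shape hN m' C0 C1 D0 C1) {s u v : ℕ}
    (hs : s ≤ x) (hu : u ≤ y) (hsu : s = x ∨ u = y) (huv : v ≤ u)
    (hA0 : ∀ i (j : Fin x), s ≤ (j : ℕ) → A0 i j = 0) (hC0 : ∀ i (j : Fin x), s ≤ (j : ℕ) → C0 i j = 0)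
    (hB0 : ∀ i (j : Fin x), s ≤ (j : ℕ) → B0 i j = 0) (hD0 : ∀ i (j : Fin x), s ≤ (j : ℕ) → D0 i j = 0)
    (hA : Van A1 (lt' v) (ge' s)) (hC : Van C1 (lt' v) (ge' s)) :
    phi (TT k N (z+y+x)) (Fl m (x + x + (y - v))) (Fl m (x + s + (y - u))) ≤
      phi (TT k N (z+y+x)) (Fl m' (x + x + (y - v))) (Fl m' (x + s + (y - u))) ↔
    RMB A0 A1 B0 (lt' s) (ge' u) (ge' v) ≤ RMB C0 C1 D0 (lt' s) (ge' u) (ge' v) := by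
  rw [h.FlGH hs hu hsu, h'.FlGH hs hu hsu, h.FlGH le_rfl (huv.trans hu) (Or.inl rfl),
    h'.FlGH le_rfl (huv.trans hu) (Or.inl rfl), phi_rE, phi_rE]
  have e0 : (lt' x : Fin x → Prop) = fun _ => True := by funext p; simp [lt']
  have e3 : (fun j : Fin x => ¬ lt' s j) = ge' s := by funext p; simp [lt', ge']
  rw [e0]
  have e1 := f_MB A0 A1 B0 (lt' s) (ge' u) (ge' v) (fun j hj => le_trans huv hj)
    (fun w hw => funext fun i => mulVec_van (Q := ge' s) (hA0 i) (e3 ▸ hw))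
    (fun w hw => funext fun i => mulVec_van (Q := ge' s) (hB0 i) (e3 ▸ hw))
    (fun w hw i hi => mulVec_van (hA i · (by simpa [ge', lt'] using hi)) (e3 ▸ hw))
  have e2 := f_MB C0 C1 D0 (lt' s) (ge' u) (ge' v) (fun j hj => le_trans huv hj)
    (fun w hw => funext fun i => mulVec_van (Q := ge' s) (hC0 i) (e3 ▸ hw))
    (fun w hw => funext fun i => mulVec_van (Q := ge' s) (hD0 i) (e3 ▸ hw))
    (fun w hw i hi => mulVec_van (hC i · (by simpa [ge', lt'] using hi)) (e3 ▸ hw))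
  unfold RMB; omega

lemma iff_L (h : Shape hN m A0 A1 B0 A1) (h' : Shape hN m' C0 C1 D0 C1) (t : ℕ) {s u : ℕ}
    (hs : s ≤ x) (hu : u ≤ y) (hsu : s = x ∨ u = y) :
    phi (TT k N (z+y+x)) (Fl m (2 * x + y + z + z' + t)) (Fl m (x + s + (y - u))) ≤
      phi (TT k N (z+y+x)) (Fl m' (2 * x + y + z + z' + t)) (Fl m' (x + s + (y - u))) ↔
    RL A1 (lt' s) (ge' u) (lt' t) ≤ RL C1 (lt' s) (ge' u) (lt' t) := by
  rw [h.FlGH hs hu hsu, h'.FlGH hs hu hsu, h.FlL', h'.FlL', phi_rE, phi_rE]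
  have e1 := f_L A0 A1 B0 (lt' s) (ge' u) (lt' t)
  have e2 := f_L C0 C1 D0 (lt' s) (ge' u) (lt' t)
  unfold RL; omega

lemma FlD_eq (h : Shape hN m A0 A1 B0 B1) (h' : Shape hN m' C0 C1 D0 D1) (t : ℕ) :
    Fl m (x - t) = Fl m' (x - t) := by rw [h.FlD', h'.FlD']

lemma FlL_eq (h : Shape hN m A0 A1 B0 A1) (h' : Shape hN m' C0 C1 D0 C1) (t : ℕ) :
    Fl m (2 * x + y + z + z' + t) = Fl m' (2 * x + y + z + z' + t) := by
  rw [h.FlL', h'.FlL', le_antisymm (SL_indep A0 A1 B0 (lt' t) C0 C1 D0)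
    (SL_indep C0 C1 D0 (lt' t) A0 A1 B0)]

lemma rank_bad (h : Shape hN m A0 A1 B0 B1) (h' : Shape hN m' C0 C1 D0 C1)
    (hle : phi (TT k N (z+y+x)) (Fl m (2 * x + y + z + z' + 0)) (Fl m (x - 0)) ≤
      phi (TT k N (z+y+x)) (Fl m' (2 * x + y + z + z' + 0)) (Fl m' (x - 0))) : B1 = A1 := by
  rw [h.FlD', h'.FlD', h.FlL', h'.FlL', phi_rE, phi_rE] at hle
  have e0 : (ge' 0 : Fin x → Prop) = fun _ => True := by funext p; simp [ge']
  have e3 : (lt' 0 : Fin y → Prop) = fun _ => False := by funext p; simp [lt']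
  have e1 := f_bad A0 A1 B0 B1
  have e2 := f_bad C0 C1 D0 C1
  rw [← e0, ← e3] at e1 e2
  rw [sub_self, Matrix.rank_zero] at e2
  have : (A1 - B1).rank = 0 := by omega
  rw [← rank_of_supp _ (fun _ => True) (fun _ _ h => absurd trivial h), fr_zero_iff] at this
  exact (sub_eq_zero.1 (Matrix.ext fun i j => this i j trivial)).symm

end dict1
end FC

set_option linter.unusedSectionVars false
set_option linter.unusedVariables false
set_option linter.unusedSimpArgs false
set_option maxHeartbeats 1000000
namespace FC
open Submodule Module
section ent
lemma psum_succ (f : ℕ → ℕ) (m : ℕ) : psum f (m + 1) = psum f m + f m :=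
  Finset.sum_range_succ f m
lemma psum_zero (f : ℕ → ℕ) : psum f 0 = 0 := rfl
lemma psum_one (f : ℕ → ℕ) : psum f 1 = f 0 := by rw [psum_succ, psum_zero, zero_add]
lemma psum_mono (f : ℕ → ℕ) {a b : ℕ} (h : a ≤ b) : psum f a ≤ psum f b :=
  monotone_nat_of_le_succ (fun m => by rw [psum_succ]; omega) h
lemma lt_of_psum {f : ℕ → ℕ} {a b : ℕ} (h : psum f a < psum f b) : a < b := by
  by_contra hh
  have := psum_mono f (not_lt.1 hh)
  omega
lemma exists_blk (f : ℕ → ℕ) {m p : ℕ} (h : p < psum f m) :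
    ∃ i < m, psum f i ≤ p ∧ p < psum f (i + 1) := by
  induction m with
  | zero => simp [psum_zero] at h
  | succ m ih =>
    by_cases hp : p < psum f m
    · obtain ⟨i, hi, h1⟩ := ih hp
      exact ⟨i, by omega, h1⟩
    · exact ⟨m, by omega, by omega, h⟩

variable {k : Type} [Field k] {n : ℕ} {dx dy : ℕ → ℕ} {dy0 dy0' : ℕ}
  (V : QRep k n dx dy dy0 dy0')

lemma Aent_hi {p c j : ℕ} (hp : p < dy0 + psum dy j) (hc : psum dx (j + 2) ≤ c) :
    Aent V p c = 0 := by
  have h1 := psum_mono dx (show 1 ≤ j + 2 by omega)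
  have h2 := psum_mono dx (show 2 ≤ j + 2 by omega)
  have h3 := psum_one dx
  unfold Aent
  rw [dif_neg (by omega), dif_neg (by omega), Finset.sum_eq_zero, Finset.sum_eq_zero]
  · simp
  · rintro i -
    refine dif_neg ?_
    rintro ⟨e1, e2, e3, e4⟩
    have := lt_of_psum (show psum dy i < psum dy j by omega)
    have := psum_mono dx (show (i : ℕ) + 3 ≤ j + 2 by omega)
    omega
  · rintro i -
    refine dif_neg ?_
    rintro ⟨e1, e2, e3, e4⟩
    have := lt_of_psum (show psum dy i < psum dy j by omega)
    have := psum_mono dx (show (i : ℕ) + 2 ≤ j + 2 by omega)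
    omega

lemma Aent_lo {p c j : ℕ} (hp : dy0 + psum dy j ≤ p) (hc : c < psum dx (j + 1)) :
    Aent V p c = 0 := by
  unfold Aent
  rw [dif_neg (by omega), dif_neg (by omega), Finset.sum_eq_zero, Finset.sum_eq_zero]
  · simp
  · rintro i -
    refine dif_neg ?_
    rintro ⟨e1, e2, e3, e4⟩
    have := lt_of_psum (show psum dy j < psum dy (i + 1) by omega)
    have := psum_mono dx (show j + 1 ≤ (i : ℕ) + 2 by omega)
    omega
  · rintro i -
    refine dif_neg ?_
    rintro ⟨e1, e2, e3, e4⟩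
    have := lt_of_psum (show psum dy j < psum dy (i + 1) by omega)
    have := psum_mono dx (show j + 1 ≤ (i : ℕ) + 1 by omega)
    omega

lemma Bent_hi {p c j : ℕ} (hp : p < dy0' + psum dy j) (hc : psum dx (j + 2) ≤ c) :
    Bent V p c = 0 := by
  have h1 := psum_mono dx (show 1 ≤ j + 2 by omega)
  have h2 := psum_mono dx (show 2 ≤ j + 2 by omega)
  have h3 := psum_one dx
  unfold Bent
  rw [dif_neg (by omega), Finset.sum_eq_zero, Finset.sum_eq_zero]
  · simp
  · rintro i -
    refine dif_neg ?_
    rintro ⟨e1, e2, e3, e4⟩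
    have := lt_of_psum (show psum dy i < psum dy j by omega)
    have := psum_mono dx (show (i : ℕ) + 3 ≤ j + 2 by omega)
    omega
  · rintro i -
    refine dif_neg ?_
    rintro ⟨e1, e2, e3, e4⟩
    have := lt_of_psum (show psum dy i < psum dy j by omega)
    have := psum_mono dx (show (i : ℕ) + 2 ≤ j + 2 by omega)
    omega

lemma Bent_y (p c : ℕ) : Bent V (dy0' + p) c = Aent V (dy0 + p) c := by
  unfold Bent Aent
  rw [dif_neg (by omega), dif_neg (by omega), dif_neg (by omega), add_zero]
  rw [zero_add, zero_add]
  refine congrArg₂ (· + ·) ?_ ?_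
  · refine Finset.sum_congr rfl (fun i _ => ?_)
    by_cases h : dy0 + psum dy (i : ℕ) ≤ dy0 + p ∧ dy0 + p < dy0 + psum dy ((i : ℕ) + 1) ∧
        psum dx ((i : ℕ) + 1) ≤ c ∧ c < psum dx ((i : ℕ) + 2)
    · rw [dif_pos h, dif_pos (by omega)]
      congr 1; exact Fin.ext (by simp only; omega)
    · rw [dif_neg h, dif_neg (by omega)]
  · refine Finset.sum_congr rfl (fun i _ => ?_)
    by_cases h : dy0 + psum dy (i : ℕ) ≤ dy0 + p ∧ dy0 + p < dy0 + psum dy ((i : ℕ) + 1) ∧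
        psum dx ((i : ℕ) + 2) ≤ c ∧ c < psum dx ((i : ℕ) + 3)
    · rw [dif_pos h, dif_pos (by omega)]
      congr 1; exact Fin.ext (by simp only; omega)
    · rw [dif_neg h, dif_neg (by omega)]

lemma Bent_0 {p c : ℕ} (hc : c < psum dx 1) : Bent V p c = 0 := by
  unfold Bent
  rw [dif_neg (by omega), Finset.sum_eq_zero, Finset.sum_eq_zero]
  · simp
  · rintro i -
    refine dif_neg ?_
    have := psum_mono dx (show 1 ≤ (i : ℕ) + 2 by omega)
    omega
  · rintro i -
    refine dif_neg ?_
    have := psum_mono dx (show 1 ≤ (i : ℕ) + 1 by omega)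
    omega

lemma Bent_lo {p c j : ℕ} (hp : dy0' + psum dy j ≤ p) (hc : c < psum dx (j + 1)) :
    Bent V p c = 0 := by
  obtain ⟨q, rfl⟩ : ∃ q, p = dy0' + q := ⟨p - dy0', by omega⟩
  rw [Bent_y]; exact Aent_lo V (by omega) hc

lemma Aent0_eq {p c : ℕ} (h : psum dx 1 ≤ c ∨ dy0 ≤ p) : Aent0 V p c = Aent V p c := by
  have h3 := psum_one dx
  unfold Aent0 Aent
  rw [dif_neg (c := p < dy0 ∧ c < dx 0) (by omega), zero_add]

lemma Aent0_zero {p c : ℕ} (h : p < dy0) (hc : c < psum dx 1) : Aent0 V p c = 0 := by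
  unfold Aent0
  rw [dif_neg (by omega), Finset.sum_eq_zero, Finset.sum_eq_zero]
  · simp
  · rintro i -
    exact dif_neg (by omega)
  · rintro i -
    exact dif_neg (by omega)

/-! exact values -/
lemma Aent_b0 {p c : ℕ} (hp : p < dy0) (hc : c < dx 0) : Aent V p c = V.vb0 ⟨p, hp⟩ ⟨c, hc⟩ := by
  have h3 := psum_one dx
  unfold Aent
  rw [dif_pos ⟨hp, hc⟩, dif_neg (by omega), Finset.sum_eq_zero, Finset.sum_eq_zero]
  · simp
  · rintro i -
    exact dif_neg (by omega)
  · rintro i -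
    exact dif_neg (by omega)

lemma Aent_a1 {p c : ℕ} (hp : p < dy0) (hc : c < dx 1) :
    Aent V p (psum dx 1 + c) = V.va1 ⟨p, hp⟩ ⟨c, hc⟩ := by
  have h3 := psum_one dx
  have h4 : psum dx 2 = psum dx 1 + dx 1 := psum_succ dx 1
  unfold Aent
  rw [dif_neg (by omega), dif_pos (by omega), Finset.sum_eq_zero, Finset.sum_eq_zero]
  · simp only [zero_add, add_zero]
    congr 1; exact Fin.ext (by simp only; omega)
  · rintro i -
    exact dif_neg (by omega)
  · rintro i -
    exact dif_neg (by omega)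

lemma Bent_a1 {p c : ℕ} (hp : p < dy0') (hc : c < dx 1) :
    Bent V p (psum dx 1 + c) = V.va1' ⟨p, hp⟩ ⟨c, hc⟩ := by
  have h4 : psum dx 2 = psum dx 1 + dx 1 := psum_succ dx 1
  unfold Bent
  rw [dif_pos (by omega), Finset.sum_eq_zero, Finset.sum_eq_zero]
  · simp only [zero_add, add_zero]
    congr 1; exact Fin.ext (by simp only; omega)
  · rintro i -
    exact dif_neg (by omega)
  · rintro i -
    exact dif_neg (by omega)

lemma Aent_b {i p c : ℕ} (hi : i < n) (hp : p < dy i) (hc : c < dx (i + 1)) :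
    Aent V (dy0 + (psum dy i + p)) (psum dx (i + 1) + c) = V.vb ⟨i, hi⟩ ⟨p, hp⟩ ⟨c, hc⟩ := by
  have h3 := psum_succ dy i
  have h4 : psum dx (i + 2) = psum dx (i + 1) + dx (i + 1) := psum_succ dx (i + 1)
  unfold Aent
  rw [dif_neg (by omega), dif_neg (by omega), Finset.sum_eq_single ⟨i, hi⟩, Finset.sum_eq_zero]
  · simp only [zero_add, add_zero]
    rw [dif_pos (by refine ⟨?_, ?_, ?_, ?_⟩ <;> omega)]
    congr 1
    · exact Fin.ext (by simp only; omega)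
    · exact Fin.ext (by simp only; omega)
  · rintro l -
    refine dif_neg ?_
    rintro ⟨e1, e2, e3, e4⟩
    have := lt_of_psum (show psum dy i < psum dy (l + 1) by omega)
    have := lt_of_psum (show psum dx (l + 2) < psum dx (i + 2) by omega)
    omega
  · rintro l - hl
    refine dif_neg ?_
    rintro ⟨e1, e2, e3, e4⟩
    have := lt_of_psum (show psum dy i < psum dy (l + 1) by omega)
    have := lt_of_psum (show psum dy l < psum dy (i + 1) by omega)
    exact hl (Fin.ext (by simp only; omega))
  · intro h; exact absurd (Finset.mem_univ _) h

lemma Aent_a {i p c : ℕ} (hi : i < n - 1) (hp : p < dy i) (hc : c < dx (i + 2)) :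
    Aent V (dy0 + (psum dy i + p)) (psum dx (i + 2) + c) = V.va ⟨i, hi⟩ ⟨p, hp⟩ ⟨c, hc⟩ := by
  have h3 := psum_succ dy i
  have h4 : psum dx (i + 3) = psum dx (i + 2) + dx (i + 2) := psum_succ dx (i + 2)
  unfold Aent
  rw [dif_neg (by omega), dif_neg (by omega), Finset.sum_eq_zero, Finset.sum_eq_single ⟨i, hi⟩]
  · simp only [zero_add, add_zero]
    rw [dif_pos (by refine ⟨?_, ?_, ?_, ?_⟩ <;> omega)]
    congr 1
    · exact Fin.ext (by simp only; omega)
    · exact Fin.ext (by simp only; omega)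
  · rintro l - hl
    refine dif_neg ?_
    rintro ⟨e1, e2, e3, e4⟩
    have := lt_of_psum (show psum dy i < psum dy (l + 1) by omega)
    have := lt_of_psum (show psum dy l < psum dy (i + 1) by omega)
    exact hl (Fin.ext (by simp only; omega))
  · intro h; exact absurd (Finset.mem_univ _) h
  · rintro l -
    refine dif_neg ?_
    rintro ⟨e1, e2, e3, e4⟩
    have := lt_of_psum (show psum dy l < psum dy (i + 1) by omega)
    have := lt_of_psum (show psum dx (i + 2) < psum dx (l + 2) by omega)
    omega

def A0V : Matrix (Fin dy0) (Fin (dXt dx n)) k := Matrix.of fun i c => Aent V i c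
def A1V : Matrix (Fin (dYt dy n)) (Fin (dXt dx n)) k := Matrix.of fun i c => Aent V (dy0 + i) c
def B0V : Matrix (Fin dy0') (Fin (dXt dx n)) k := Matrix.of fun i c => Bent V i c

def entOne {x y z z' : ℕ} : RowI x y z z' → ColI x y z z' → Prop
  | .inl (.inl i), .inr (.inr (.inr (.inl q))) => i = q
  | .inl (.inr (.inl i)), .inr (.inr (.inl q)) => i = q
  | .inl (.inr (.inr i)), .inl q => i = q
  | .inr (.inl i), .inr (.inr (.inr (.inr (.inl q)))) => i = q
  | .inr (.inr (.inl i)), .inr (.inr (.inl q)) => i = q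
  | .inr (.inr (.inl i)), .inr (.inr (.inr (.inr (.inr q)))) => i = q
  | .inr (.inr (.inr i)), .inl q => i = q
  | .inr (.inr (.inr i)), .inr (.inl q) => i = q
  | _, _ => False

lemma cond_iff {x y z z' : ℕ} (r : RowI x y z z') (c : ColI x y z z') :
   (Jpos 0 (2 * x + y) z (rowN r) (colN c) ∨
      Jpos z (2 * x) y (rowN r) (colN c) ∨
      Jpos (z + y) 0 x (rowN r) (colN c) ∨
      Ipos (z + y + x) (2 * x + y + z) z' (rowN r) (colN c) ∨
      Jpos (z + y + x + z') (2 * x) y (rowN r) (colN c) ∨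
      Ipos (z + y + x + z') (2 * x + y + z + z') y (rowN r) (colN c) ∨
      Jpos (z + y + x + z' + y) 0 x (rowN r) (colN c) ∨
      Ipos (z + y + x + z' + y) x x (rowN r) (colN c)) ↔ entOne r c := by
  unfold Jpos Ipos inBlk
  constructor
  · rcases r with (⟨p, hp⟩ | ⟨p, hp⟩ | ⟨p, hp⟩) | (⟨p, hp⟩ | ⟨p, hp⟩ | ⟨p, hp⟩) <;>
    rcases c with ⟨q, hq⟩ | ⟨q, hq⟩ | ⟨q, hq⟩ | ⟨q, hq⟩ | ⟨q, hq⟩ | ⟨q, hq⟩ <;>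
    simp only [rowN, colN, entOne] <;>
    rintro (⟨⟨h1, h2⟩, ⟨h3, h4⟩, h5⟩ | ⟨⟨h1, h2⟩, ⟨h3, h4⟩, h5⟩ | ⟨⟨h1, h2⟩, ⟨h3, h4⟩, h5⟩ |
      ⟨⟨h1, h2⟩, ⟨h3, h4⟩, h5⟩ | ⟨⟨h1, h2⟩, ⟨h3, h4⟩, h5⟩ | ⟨⟨h1, h2⟩, ⟨h3, h4⟩, h5⟩ |
      ⟨⟨h1, h2⟩, ⟨h3, h4⟩, h5⟩ | ⟨⟨h1, h2⟩, ⟨h3, h4⟩, h5⟩) <;>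
    first | (exfalso; omega) | (rw [Fin.mk.injEq]; omega)
  · rcases r with (⟨p, hp⟩ | ⟨p, hp⟩ | ⟨p, hp⟩) | (⟨p, hp⟩ | ⟨p, hp⟩ | ⟨p, hp⟩) <;>
    rcases c with ⟨q, hq⟩ | ⟨q, hq⟩ | ⟨q, hq⟩ | ⟨q, hq⟩ | ⟨q, hq⟩ | ⟨q, hq⟩ <;>
    intro h <;> simp only [entOne, Fin.mk.injEq] at h <;> subst h <;>
    simp only [rowN, colN]
    · left; omega
    · right; left; omega
    · right; right; left; omega
    · right; right; right; left; omega
    · right; right; right; right; left; omega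
    · right; right; right; right; right; left; omega
    · right; right; right; right; right; right; left; omega
    · right; right; right; right; right; right; right; omega

def inReg {x y z z' : ℕ} : RowI x y z z' → ColI x y z z' → Prop
  | .inl (.inl i), .inr (.inl q) => True
  | .inl (.inr (.inl i)), .inr (.inl q) => True
  | .inr (.inl i), .inr (.inl q) => True
  | .inr (.inr (.inl i)), .inr (.inl q) => True
  | _, _ => False

lemma reg_iff {x y z z' : ℕ} (r : RowI x y z z') (c : ColI x y z z') :
    (((rowN r < z + y) ∨ (z + y + x ≤ rowN r ∧ rowN r < z + y + x + z' + y)) ∧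
      x ≤ colN c ∧ colN c < 2 * x) ↔ inReg r c := by
  rcases r with (⟨p, hp⟩ | ⟨p, hp⟩ | ⟨p, hp⟩) | (⟨p, hp⟩ | ⟨p, hp⟩ | ⟨p, hp⟩) <;>
    rcases c with ⟨q, hq⟩ | ⟨q, hq⟩ | ⟨q, hq⟩ | ⟨q, hq⟩ | ⟨q, hq⟩ | ⟨q, hq⟩ <;>
    simp only [rowN, colN, inReg, iff_true, iff_false] <;> omega

open Classical in
lemma ent_of_not_reg {x y z z' : ℕ} (A0 : Matrix (Fin z) (Fin x) k) (A1 : Matrix (Fin y) (Fin x) k)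
    (B0 : Matrix (Fin z') (Fin x) k) (B1 : Matrix (Fin y) (Fin x) k)
    (r : RowI x y z z') (c : ColI x y z z') (h : ¬ inReg r c) :
    ent A0 A1 B0 B1 r c = if entOne r c then 1 else 0 := by
  rcases r with (p | p | p) | (p | p | p) <;> rcases c with q | q | q | q | q | q <;>
    first
    | (exact absurd trivial h)
    | exact (if_neg (fun hh : False => hh)).symm
    | (simp only [ent, entOne, if_false]; done)
    | (simp only [ent, entOne]; congr)

noncomputable abbrev rE' (n : ℕ) (dx dy : ℕ → ℕ) (dy0 dy0' : ℕ) := rowE (x := dXt dx n) (y := dYt dy n) (z := dy0)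
  (z' := dy0') (N := NN n dx dy dy0 dy0') rfl
noncomputable abbrev cE' (n : ℕ) (dx dy : ℕ → ℕ) (dy0 dy0' : ℕ) := colE (x := dXt dx n) (y := dYt dy n) (z := dy0)
  (z' := dy0') (N := NN n dx dy dy0 dy0') rfl

open Classical in
lemma eta_not_reg (r : RowI (dXt dx n) (dYt dy n) dy0 dy0') (c) (h : ¬ inReg r c) :
    etaMat V (rE' n dx dy dy0 dy0' r) (cE' n dx dy dy0 dy0' c) = if entOne r c then 1 else 0 := by
  rw [← reg_iff] at h
  unfold etaMat
  rw [Matrix.of_apply, if_neg (fun hh => h ⟨Or.inl hh.1, hh.2⟩),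
    if_neg (fun hh => h ⟨Or.inr ⟨hh.1, hh.2.1⟩, hh.2.2⟩)]
  exact if_congr (cond_iff r c) rfl rfl

lemma eta_A {i : RowI (dXt dx n) (dYt dy n) dy0 dy0'} (hi : rowN i < dy0 + dYt dy n)
    (q : Fin (dXt dx n)) :
    etaMat V (rE' n dx dy dy0 dy0' i) (cE' n dx dy dy0 dy0' (.inr (.inl q))) =
      Aent V (rowN i) q := by
  have h : colN (x := dXt dx n) (y := dYt dy n) (z := dy0) (z' := dy0') (.inr (.inl q)) =
    dXt dx n + q := rfl
  unfold etaMat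
  have hc : ((cE' n dx dy dy0 dy0' (.inr (.inl q)) : Fin (NN n dx dy dy0 dy0')) : ℕ) = dXt dx n + q := rfl
  have hr : ((rE' n dx dy dy0 dy0' i : Fin (NN n dx dy dy0 dy0')) : ℕ) = rowN i := rfl
  rw [Matrix.of_apply, hc, hr, if_pos ⟨hi, by omega, by omega⟩, Nat.add_sub_cancel_left]

lemma eta_B {i : RowI (dXt dx n) (dYt dy n) dy0 dy0'} (hi : aD n dx dy dy0 ≤ rowN i)
    (hi' : rowN i < aD n dx dy dy0 + dy0' + dYt dy n)
    (q : Fin (dXt dx n)) :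
    etaMat V (rE' n dx dy dy0 dy0' i) (cE' n dx dy dy0 dy0' (.inr (.inl q))) =
      Bent V (rowN i - aD n dx dy dy0) q := by
  have h : colN (x := dXt dx n) (y := dYt dy n) (z := dy0) (z' := dy0') (.inr (.inl q)) =
    dXt dx n + q := rfl
  unfold etaMat
  have hc : ((cE' n dx dy dy0 dy0' (.inr (.inl q)) : Fin (NN n dx dy dy0 dy0')) : ℕ) = dXt dx n + q := rfl
  have hr : ((rE' n dx dy dy0 dy0' i : Fin (NN n dx dy dy0 dy0')) : ℕ) = rowN i := rfl
  rw [Matrix.of_apply, hc, hr, if_neg, if_pos ⟨hi, hi', by omega, by omega⟩,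
    Nat.add_sub_cancel_left]
  unfold aD at hi; omega

abbrev Sh (m : Matrix (Fin (NN n dx dy dy0 dy0')) (Fin (NN n dx dy dy0 dy0')) k) A0 A1 B0 B1 :=
  Shape (x := dXt dx n) (y := dYt dy n) (z := dy0) (z' := dy0') rfl m A0 A1 B0 B1

theorem shape_eta : Sh (etaMat V) (A0V V) (A1V V) (B0V V) (A1V V) := by
  intro r c
  by_cases h : inReg r c
  · rcases r with (p | p | p) | (p | p | p) <;> rcases c with q | q | q | q | q | q <;>
      simp only [inReg] at h
    · exact eta_A V (by simp only [rowN]; omega) q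
    · exact eta_A V (by simp only [rowN]; omega) q
    · refine (eta_B V (by simp only [rowN, aD]; omega) (by simp only [rowN, aD]; omega) q).trans ?_
      simp only [rowN, aD, Nat.add_sub_cancel_left]; rfl
    · refine (eta_B V (by simp only [rowN, aD]; omega) (by simp only [rowN, aD]; omega) q).trans ?_
      simp only [rowN, aD]
      rw [show dy0 + dYt dy n + dXt dx n + dy0' + (p : ℕ) - (dy0 + dYt dy n + dXt dx n) =
        dy0' + p by omega, Bent_y]; rfl
  · rw [ent_of_not_reg _ _ _ _ _ _ h]; exact eta_not_reg V r c h

theorem eta_sT : etaMat V ∈ sTildeD k n dx dy dy0 dy0' := by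
  intro i c h
  obtain ⟨r, rfl⟩ := (rE' n dx dy dy0 dy0').surjective i
  obtain ⟨c, rfl⟩ := (cE' n dx dy dy0 dy0').surjective c
  have h' : ¬ inReg r c := by rw [← reg_iff]; exact h
  rw [eta_not_reg V r c h', eta_not_reg _ r c h']

theorem shape_sT {m} (hm : m ∈ sTildeD k n dx dy dy0 dy0') :
    ∃ A0 A1 B0 B1, Sh m A0 A1 B0 B1 := by
  let e1 := rE' n dx dy dy0 dy0'
  let e2 := cE' n dx dy dy0 dy0'
  refine ⟨Matrix.of fun i q => m (e1 (.inl (.inl i))) (e2 (.inr (.inl q))),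
    Matrix.of fun i q => m (e1 (.inl (.inr (.inl i)))) (e2 (.inr (.inl q))),
    Matrix.of fun i q => m (e1 (.inr (.inl i))) (e2 (.inr (.inl q))),
    Matrix.of fun i q => m (e1 (.inr (.inr (.inl i)))) (e2 (.inr (.inl q))), ?_⟩
  intro r c
  by_cases h : inReg r c
  · rcases r with (p | p | p) | (p | p | p) <;> rcases c with q | q | q | q | q | q <;>
      simp only [inReg] at h <;> rfl
  · rw [ent_of_not_reg _ _ _ _ _ _ h, ← eta_not_reg (zeroRep k n dx dy dy0 dy0') r c h]
    refine hm _ _ ?_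
    rw [← reg_iff] at h; exact h

lemma Shape.ext' {m m' : Matrix (Fin (NN n dx dy dy0 dy0')) (Fin (NN n dx dy dy0 dy0')) k}
    {A0 A1 B0 B1} (h : Sh m A0 A1 B0 B1) (h' : Sh m' A0 A1 B0 B1) : m = m' := by
  ext i c
  obtain ⟨r, rfl⟩ := (rE' n dx dy dy0 dy0').surjective i
  obtain ⟨c, rfl⟩ := (cE' n dx dy dy0 dy0').surjective c
  exact (h r c).trans (h' r c).symm

end ent
end FC

set_option linter.unusedSectionVars false
set_option linter.unusedVariables false
set_option linter.unusedSimpArgs false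
set_option maxHeartbeats 1000000
namespace FC
open Submodule Module
section dict2
variable {k : Type} [Field k] {n : ℕ} {dx dy : ℕ → ℕ} {dy0 dy0' : ℕ}
  (V : QRep k n dx dy dy0 dy0')

lemma rank_dict' {ι κ ι' κ' : Type} [Fintype κ] [Fintype κ'] [Fintype ι] [Fintype ι']
    (M : Matrix ι κ k) (Q : κ → Prop) (M' : Matrix ι' κ' k) (Q' : κ' → Prop)
    (hz : ∀ p q, ¬ Q' q → M' p q = 0)
    (r : ι' → ι) (c : κ' → κ) (hM : ∀ p q, Q' q → M' p q = M (r p) (c q))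
    (hQ : ∀ q, Q' q → Q (c q))
    (hr : ∀ i, (∃ p, r p = i) ∨ ∀ q, Q q → M i q = 0)
    (hc : ∀ j, Q j → (∃ q, Q' q ∧ c q = j) ∨ ∀ p, M p j = 0) :
    finrank k (Submodule.map M.mulVecLin (Cs Q)) = M'.rank := by
  classical
  rw [← rank_of_supp M' Q' hz]
  rw [rank_dict M Q (Matrix.of fun p (q : {q // Q' q}) => M' p q) r (fun q => c q)
    (fun p q => hM p q q.2) (fun q => hQ q q.2) hr (fun j hj => by
      rcases hc j hj with ⟨q, hq, e⟩ | h
      · exact Or.inl ⟨⟨q, hq⟩, e⟩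
      · exact Or.inr h)]
  rw [rank_dict M' Q' (Matrix.of fun p (q : {q // Q' q}) => M' p q) id (fun q => q)
    (fun p q => rfl) (fun q => q.2) (fun i => Or.inl ⟨i, rfl⟩)
    (fun j hj => Or.inl ⟨⟨j, hj⟩, rfl⟩)]

def spl {a b : ℕ} (p : ℕ) (h : p < a + b) : Fin a ⊕ Fin b :=
  if h' : p < a then .inl ⟨p, h'⟩ else .inr ⟨p - a, by omega⟩

lemma spl_surj {a b : ℕ} (i : Fin a ⊕ Fin b) : ∃ p, ∃ h : p < a + b, spl p h = i := by
  rcases i with ⟨p, hp⟩ | ⟨p, hp⟩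
  · exact ⟨p, by omega, by rw [spl, dif_pos hp]⟩
  · refine ⟨a + p, by omega, ?_⟩
    rw [spl, dif_neg (by omega)]; congr 1; exact Fin.ext (by simp only; omega)

variable {X : Type}

lemma rowsA {P : Fin (dYt dy n) → Prop} {_ : DecidablePred P} {u : ℕ} (hP : ∀ j, P j ↔ (j : ℕ) < u)
    {p : ℕ} (h : p < dy0 + dYt dy n) (q : Fin (dXt dx n)) (hp : p < dy0 + u) :
    Matrix.fromRows (A0V V) (rm P (A1V V)) (spl p h) q = Aent V p q := by
  unfold spl
  split_ifs with h'
  · rfl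
  · rw [Matrix.fromRows_apply_inr, rm, Matrix.of_apply, if_pos ((hP _).2 (by simp only; omega))]
    rw [A1V, Matrix.of_apply]; simp only; rw [Nat.add_sub_cancel' (by omega)]

lemma rowsB {P : Fin (dYt dy n) → Prop} {_ : DecidablePred P} {u : ℕ} (hP : ∀ j, P j ↔ (j : ℕ) < u)
    {p : ℕ} (h : p < dy0' + dYt dy n) (q : Fin (dXt dx n)) (hp : p < dy0' + u) :
    Matrix.fromRows (B0V V) (rm P (A1V V)) (spl p h) q = Bent V p q := by
  unfold spl
  split_ifs with h'
  · rfl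
  · rw [Matrix.fromRows_apply_inr, rm, Matrix.of_apply, if_pos ((hP _).2 (by simp only; omega))]
    rw [A1V, Matrix.of_apply]; simp only; rw [← Bent_y, Nat.add_sub_cancel' (by omega)]

lemma rows0 {z : ℕ} {P : Fin (dYt dy n) → Prop} {_ : DecidablePred P} {u : ℕ}
    (hP : ∀ j, P j ↔ (j : ℕ) < u) (A : Matrix (Fin z) (Fin (dXt dx n)) k) (A' )
    {p : ℕ} (h : p < z + dYt dy n) (q : Fin (dXt dx n)) (hp : ¬ p < z + u) :
    Matrix.fromRows A (rm P A') (spl p h) q = 0 := by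
  unfold spl
  rw [dif_neg (by omega), Matrix.fromRows_apply_inr, rm, Matrix.of_apply,
    if_neg (fun hh => by have := (hP _).1 hh; simp only at this; omega)]

structure Compat (n : ℕ) (dx dy : ℕ → ℕ) (s u r c : ℕ) : Prop where
  hc : c ≤ n
  h : (r = c ∧ s = psum dx (c + 1) ∧ u = psum dy n) ∨ (c = r + 1 ∧ s = psum dx (n + 1) ∧ u = psum dy r)

variable {n' : ℕ} {s u r c : ℕ}

namespace Compat
lemma hs (H : Compat n dx dy s u r c) : s ≤ dXt dx n := by
  rcases H.h with ⟨_, h, _⟩ | ⟨_, h, _⟩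
  · rw [h]; exact psum_mono _ (by have := H.hc; omega)
  · rw [h]; rfl
lemma hu (H : Compat n dx dy s u r c) : u ≤ dYt dy n := by
  rcases H.h with ⟨_, _, h⟩ | ⟨_, _, h⟩
  · rw [h]; rfl
  · rw [h]; exact psum_mono _ (by have := H.hc; omega)
lemma hsu (H : Compat n dx dy s u r c) : s = dXt dx n ∨ u = dYt dy n := by
  rcases H.h with ⟨_, _, h⟩ | ⟨_, h, _⟩
  · exact Or.inr h
  · exact Or.inl h
lemma hcs (H : Compat n dx dy s u r c) : psum dx (c + 1) ≤ s := by
  rcases H.h with ⟨_, h, _⟩ | ⟨_, h, _⟩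
  · rw [h]
  · rw [h]; exact psum_mono _ (by have := H.hc; omega)
lemma hru (H : Compat n dx dy s u r c) : psum dy r ≤ u := by
  rcases H.h with ⟨_, _, h⟩ | ⟨_, _, h⟩
  · rw [h]; exact psum_mono _ (by have := H.hc; omega)
  · rw [h]
lemma hrc (H : Compat n dx dy s u r c) : r ≤ c ∧ c ≤ r + 1 := by rcases H.h with ⟨h, _⟩ | ⟨h, _⟩ <;> omega

lemma A (H : Compat n dx dy s u r c) {p q : ℕ} (hp : p < dy0 + u) (hq : q < s) (h : dy0 + psum dy r ≤ p ∨ psum dx (c + 1) ≤ q) :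
    Aent V p q = 0 := by
  rcases H.h with ⟨e1, e2, e3⟩ | ⟨e1, e2, e3⟩
  · subst e1; exact Aent_lo V (j := r) (by omega) (by omega)
  · subst e1; exact Aent_hi V (j := r) (by omega) (by change _ ∨ psum dx (r + 2) ≤ q at h; omega)

lemma B (H : Compat n dx dy s u r c) {p q : ℕ} (hp : p < dy0' + u) (hq : q < s) (h : dy0' + psum dy r ≤ p ∨ psum dx (c + 1) ≤ q) :
    Bent V p q = 0 := by
  rcases H.h with ⟨e1, e2, e3⟩ | ⟨e1, e2, e3⟩
  · subst e1; exact Bent_lo V (j := r) (by omega) (by omega)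
  · subst e1; exact Bent_hi V (j := r) (by omega) (by change _ ∨ psum dx (r + 2) ≤ q at h; omega)
end Compat

lemma Yoff_succ (dy : ℕ → ℕ) (d r : ℕ) : Yoff dy d (r + 1) = d + psum dy r := by
  rw [Yoff, if_neg (by omega), Nat.add_sub_cancel]
lemma Yoff_zero (dy : ℕ → ℕ) (d : ℕ) : Yoff dy d 0 = 0 := rfl

lemma nge_iff {y u : ℕ} (j : Fin y) : ¬ ge' u j ↔ (j : ℕ) < u := by simp [ge']

theorem RA_A (H : Compat n dx dy s u r c) :
    RA (A0V V) (A1V V) (lt' s) (ge' u) = rkA V 0 r 0 c := by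
  classical
  have e1 := Yoff_succ dy dy0 r
  have e2 := Yoff_zero dy dy0
  have e3 := psum_zero dx
  have h1 := H.hs; have h2 := H.hu; have h3 := H.hcs; have h4 := H.hru
  refine rank_dict _ _ _ (fun p => spl p (by have := p.2; omega)) (fun q => ⟨q, by have := q.2; omega⟩)
    ?_ ?_ ?_ ?_
  · intro p q
    rw [rowsA V (nge_iff (u := u)) _ _ (by have := p.2; omega), Matrix.of_apply]
    refine congrArg₂ (Aent V) ?_ ?_ <;> (try simp only) <;> omega
  · intro q; have := q.2; simp only [lt']; omega
  · intro i
    obtain ⟨p, hp, rfl⟩ := spl_surj i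
    by_cases h : p < dy0 + psum dy r
    · exact Or.inl ⟨⟨p, by omega⟩, rfl⟩
    · right; intro q hq
      by_cases h' : p < dy0 + u
      · rw [rowsA V (nge_iff (u := u)) _ _ h']; exact H.A V h' hq (by omega)
      · exact rows0 (nge_iff (u := u)) _ _ _ _ h'
  · intro q hq
    by_cases h : (q : ℕ) < psum dx (c + 1)
    · exact Or.inl ⟨⟨q, by omega⟩, rfl⟩
    · right; intro i
      obtain ⟨p, hp, rfl⟩ := spl_surj i
      by_cases h' : p < dy0 + u
      · rw [rowsA V (nge_iff (u := u)) _ _ h']; exact H.A V h' hq (by omega)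
      · exact rows0 (nge_iff (u := u)) _ _ _ _ h'

theorem RA_B (H : Compat n dx dy s u r c) (hc1 : 1 ≤ c) :
    RA (B0V V) (A1V V) (lt' s) (ge' u) = rkB V 0 r 1 c := by
  classical
  have e1 := Yoff_succ dy dy0' r
  have e2 := Yoff_zero dy dy0'
  have h1 := H.hs; have h2 := H.hu; have h3 := H.hcs; have h4 := H.hru
  have h5 := psum_mono dx (show 1 ≤ c + 1 by omega)
  refine rank_dict _ _ _ (fun p => spl p (by have := p.2; omega))
    (fun q => ⟨psum dx 1 + q, by have := q.2; omega⟩)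
    ?_ ?_ ?_ ?_
  · intro p q
    rw [rowsB V (nge_iff (u := u)) _ _ (by have := p.2; omega), Matrix.of_apply]
    refine congrArg₂ (Bent V) ?_ ?_ <;> (try simp only) <;> omega
  · intro q; have := q.2; simp only [lt']; omega
  · intro i
    obtain ⟨p, hp, rfl⟩ := spl_surj i
    by_cases h : p < dy0' + psum dy r
    · exact Or.inl ⟨⟨p, by omega⟩, rfl⟩
    · right; intro q hq
      by_cases h' : p < dy0' + u
      · rw [rowsB V (nge_iff (u := u)) _ _ h']; exact H.B V h' hq (by omega)
      · exact rows0 (nge_iff (u := u)) _ _ _ _ h'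
  · intro q hq
    by_cases h : psum dx 1 ≤ (q : ℕ) ∧ (q : ℕ) < psum dx (c + 1)
    · exact Or.inl ⟨⟨q - psum dx 1, by omega⟩, Fin.ext (by simp only; omega)⟩
    · right; intro i
      obtain ⟨p, hp, rfl⟩ := spl_surj i
      by_cases h' : p < dy0' + u
      · rw [rowsB V (nge_iff (u := u)) _ _ h']
        by_cases h0 : (q : ℕ) < psum dx 1
        · exact Bent_0 V h0
        · exact H.B V h' hq (by omega)
      · exact rows0 (nge_iff (u := u)) _ _ _ _ h'

theorem RA_B0 (H : Compat n dx dy s u r c) (hc1 : c = 0) :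
    RA (B0V V) (A1V V) (lt' s) (ge' u) = 0 := by
  classical
  rw [RA, fr_zero_iff]
  intro i q hq
  obtain ⟨p, hp, rfl⟩ := spl_surj i
  have hs : s = psum dx 1 := by rcases H.h with ⟨_, h, _⟩ | ⟨h, _⟩ <;> [rw [h, hc1]; omega]
  by_cases h' : p < dy0' + u
  · rw [rowsB V (nge_iff (u := u)) _ _ h']; exact Bent_0 V (hs ▸ hq)
  · exact rows0 (nge_iff (u := u)) _ _ _ _ h'

/-- index maps for the `y`-rows -/
lemma rmA {P : Fin (dYt dy n) → Prop} {_ : DecidablePred P} (i : Fin (dYt dy n)) (q : Fin (dXt dx n)) (h : P i) :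
    rm P (A1V V) i q = Aent V (dy0 + i) q := by
  rw [rm, Matrix.of_apply, if_pos h]; rfl
lemma rm0 {P : Fin (dYt dy n) → Prop} {_ : DecidablePred P} (i : Fin (dYt dy n)) (q : Fin (dXt dx n)) (h : P i → Aent V (dy0 + i) q = 0) :
    rm P (A1V V) i q = 0 := by
  by_cases hh : P i
  · rw [rmA V i q hh, h hh]
  · rw [rm, Matrix.of_apply, if_neg hh]

theorem RL_A (H : Compat n dx dy s u r c) {j : ℕ} (hj : j + 1 ≤ r) :
    RL (A1V V) (lt' s) (ge' u) (lt' (psum dy j)) = rkA V (j + 1) r (j + 1) c := by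
  classical
  have e1 := Yoff_succ dy dy0 r
  have e2 := Yoff_succ dy dy0 j
  have h1 := H.hs; have h2 := H.hu; have h3 := H.hcs; have h4 := H.hru
  have h5 := H.hrc
  have h6 := psum_mono dx (show j + 1 ≤ c + 1 by omega)
  have h7 := psum_mono dy (show j ≤ r by omega)
  refine rank_dict _ _ _ (fun p => ⟨psum dy j + p, by have := p.2; omega⟩)
    (fun q => .inl ⟨psum dx (j + 1) + q, by have := q.2; omega⟩) ?_ ?_ ?_ ?_
  · intro p q
    rw [Matrix.fromCols_apply_inl, rmA, Matrix.of_apply]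
    · refine congrArg₂ (Aent V) ?_ ?_ <;> (try simp only) <;> omega
    · have := p.2; simp only [ge', lt']; omega
  · intro q; have := q.2; simp only [lt', Sum.elim_inl]; omega
  · intro i
    by_cases h : psum dy j ≤ i ∧ (i : ℕ) < psum dy r
    · exact Or.inl ⟨⟨i - psum dy j, by omega⟩, Fin.ext (by simp only; omega)⟩
    · right
      rintro (q | q) hq
      · rw [Matrix.fromCols_apply_inl]
        refine rm0 V _ _ (fun hi => ?_)
        simp only [ge', lt'] at hi
        exact H.A V (by omega) hq (by omega)
      · rfl
  · rintro (q | q) hq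
    · simp only [Sum.elim_inl, lt'] at hq
      by_cases h : psum dx (j + 1) ≤ q ∧ (q : ℕ) < psum dx (c + 1)
      · exact Or.inl ⟨⟨q - psum dx (j + 1), by omega⟩, by congr 1; exact Fin.ext (by simp only; omega)⟩
      · right; intro i
        rw [Matrix.fromCols_apply_inl]
        refine rm0 V _ _ (fun hi => ?_)
        simp only [ge', lt'] at hi
        by_cases h0 : (q : ℕ) < psum dx (j + 1)
        · exact Aent_lo V (j := j) (by omega) h0
        · exact H.A V (by omega) hq (by omega)
    · exact Or.inr (fun _ => rfl)

theorem RL_0 (H : Compat n dx dy s u r c) {j : ℕ} (hj : r ≤ j) :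
    RL (A1V V) (lt' s) (ge' u) (lt' (psum dy j)) = 0 := by
  classical
  rw [RL, fr_zero_iff]
  have h7 := psum_mono dy hj
  rintro i (q | q) hq
  · rw [Matrix.fromCols_apply_inl]
    refine rm0 V _ _ (fun hi => ?_)
    simp only [ge', lt'] at hi
    exact H.A V (by omega) hq (by omega)
  · rfl

theorem RD_A (H : Compat n dx dy s u r c) {i : ℕ} (hi : 2 ≤ i) (hic : i ≤ c) :
    RD (A0V V) (A1V V) (B0V V) (ge' (psum dx i)) (lt' s) (ge' u) = rkA V (i - 1) r i c := by
  classical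
  obtain ⟨l, rfl⟩ : ∃ l, i = l + 2 := ⟨i - 2, by omega⟩
  have e1 := Yoff_succ dy dy0 r
  have e2 : Yoff dy dy0 (l + 2 - 1) = dy0 + psum dy l := Yoff_succ dy dy0 l
  have h1 := H.hs; have h2 := H.hu; have h3 := H.hcs; have h4 := H.hru
  have h5 := H.hrc
  have h6 := psum_mono dx (show l + 2 ≤ c + 1 by omega)
  have h7 := psum_mono dy (show l ≤ r by omega)
  have h8 := psum_mono dx (show 0 + 2 ≤ l + 2 by omega)
  have h9 := psum_zero dy
  refine rank_dict _ _ _ (fun p => .inr (.inr ⟨psum dy l + p, by have := p.2; omega⟩))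
    (fun q => ⟨psum dx (l + 2) + q, by have := q.2; omega⟩) ?_ ?_ ?_ ?_
  · intro p q
    rw [Matrix.fromRows_apply_inr, Matrix.fromRows_apply_inr, rmA, Matrix.of_apply]
    · refine congrArg₂ (Aent V) ?_ ?_ <;> (try simp only) <;> omega
    · have := p.2; simp only [ge', lt']; omega
  · intro q; have := q.2; simp only [lt', ge']; omega
  · rintro (p | p | p)
    · right; rintro q ⟨hq1, hq2⟩
      exact Aent_hi V (j := 0) (by omega) (by simp only [ge'] at hq1; omega)
    · right; rintro q ⟨hq1, hq2⟩
      exact Bent_hi V (j := 0) (by omega) (by simp only [ge'] at hq1; omega)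
    · by_cases h : psum dy l ≤ p ∧ (p : ℕ) < psum dy r
      · exact Or.inl ⟨⟨p - psum dy l, by omega⟩, by congr 2; exact Fin.ext (by simp only; omega)⟩
      · right
        rintro q ⟨hq1, hq2⟩
        rw [Matrix.fromRows_apply_inr, Matrix.fromRows_apply_inr]
        refine rm0 V _ _ (fun hi => ?_)
        simp only [ge', lt'] at hi hq1 hq2
        by_cases h0 : (p : ℕ) < psum dy l
        · exact Aent_hi V (j := l) (by omega) (by omega)
        · exact H.A V (by omega) hq2 (by omega)
  · rintro q ⟨hq1, hq2⟩
    simp only [ge', lt'] at hq1 hq2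
    by_cases h : (q : ℕ) < psum dx (c + 1)
    · exact Or.inl ⟨⟨q - psum dx (l + 2), by omega⟩, Fin.ext (by simp only; omega)⟩
    · right
      rintro (p | p | p)
      · exact Aent_hi V (j := 0) (by omega) (by omega)
      · exact Bent_hi V (j := 0) (by omega) (by omega)
      · rw [Matrix.fromRows_apply_inr, Matrix.fromRows_apply_inr]
        refine rm0 V _ _ (fun hi => ?_)
        simp only [ge', lt'] at hi
        exact H.A V (by omega) hq2 (by omega)

theorem RD_0 (H : Compat n dx dy s u r c) {i : ℕ} (hic : c < i) :
    RD (A0V V) (A1V V) (B0V V) (ge' (psum dx i)) (lt' s) (ge' u) = 0 := by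
  classical
  rw [RD, fr_zero_iff]
  have h7 := psum_mono dx (show c + 1 ≤ i by omega)
  rintro (p | p | p) q ⟨hq1, hq2⟩ <;> simp only [ge', lt'] at hq1 hq2
  · exact H.A V (p := p) (by omega) hq2 (by omega)
  · exact H.B V (p := p) (by omega) hq2 (by omega)
  · rw [Matrix.fromRows_apply_inr, Matrix.fromRows_apply_inr]
    refine rm0 V _ _ (fun hi => ?_)
    simp only [ge', lt'] at hi
    exact H.A V (by omega) hq2 (by omega)

end dict2
end FC

set_option linter.unusedSectionVars false
set_option linter.unusedVariables false
set_option linter.unusedSimpArgs false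
set_option maxHeartbeats 1000000
namespace FC
open Submodule Module
section dict3
variable {k : Type} [Field k] {n : ℕ} {dx dy : ℕ → ℕ} {dy0 dy0' : ℕ}
  (V : QRep k n dx dy dy0 dy0') {s u r c : ℕ}

def rS {z y z' : ℕ} (w : ℕ) (hw : w ≤ y) (p : ℕ) (h : p < z + w + (z' + w)) :
    Fin z ⊕ (Fin z' ⊕ Fin y) :=
  if h1 : p < z then .inl ⟨p, h1⟩ else
  if h2 : p < z + w then .inr (.inr ⟨p - z, by omega⟩) else
  if h3 : p - (z + w) < z' then .inr (.inl ⟨p - (z + w), h3⟩) else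
  .inr (.inr ⟨p - (z + w) - z', by omega⟩)

theorem RD_gen (H : Compat n dx dy s u r c) {i : ℕ}
    (M' : Matrix (Fin (Yoff dy dy0 (r + 1) + Yoff dy dy0' (r + 1))) (Fin (psum dx (c + 1))) k)
    (hz : ∀ p (q : Fin (psum dx (c + 1))), ¬ psum dx i ≤ (q : ℕ) → M' p q = 0)
    (hM : ∀ p (q : Fin (psum dx (c + 1))), psum dx i ≤ (q : ℕ) → M' p q = if (p : ℕ) < Yoff dy dy0 (r + 1) then Aent V p q
      else Bent V (p - Yoff dy dy0 (r + 1)) q) :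
    RD (A0V V) (A1V V) (B0V V) (ge' (psum dx i)) (lt' s) (ge' u) = M'.rank := by
  classical
  have e1 := Yoff_succ dy dy0 r
  have e2 := Yoff_succ dy dy0' r
  have h1 := H.hs; have h2 := H.hu; have h3 := H.hcs; have h4 := H.hru
  refine rank_dict' _ _ _ (fun q => psum dx i ≤ (q : ℕ)) hz
    (fun p => rS (psum dy r) (h4.trans h2) p (by have := p.2; omega))
    (fun q => ⟨q, by have := q.2; omega⟩) ?_ ?_ ?_ ?_
  · intro p q hq
    have hp := p.2
    rw [hM p q hq]
    unfold rS
    simp only [e1]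
    by_cases g1 : (p : ℕ) < dy0 + psum dy r
    · rw [if_pos g1]
      by_cases g2 : (p : ℕ) < dy0
      · rw [dif_pos g2]; rfl
      · rw [dif_neg g2, dif_pos g1, Matrix.fromRows_apply_inr, Matrix.fromRows_apply_inr, rmA]
        · refine congrArg₂ (Aent V) ?_ rfl; simp only; omega
        · simp only [ge', lt']; omega
    · rw [if_neg g1, dif_neg (by omega), dif_neg g1]
      by_cases g2 : (p : ℕ) - (dy0 + psum dy r) < dy0'
      · rw [dif_pos g2]; rfl
      · rw [dif_neg g2, Matrix.fromRows_apply_inr, Matrix.fromRows_apply_inr, rmA, ← Bent_y]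
        · refine congrArg₂ (Bent V) ?_ rfl; simp only; omega
        · simp only [ge', lt']; omega
  · intro q hq; have := q.2; exact ⟨hq, by simp only [lt']; omega⟩
  · rintro (p | p | p)
    · left; refine ⟨⟨p, by omega⟩, ?_⟩
      unfold rS; rw [dif_pos p.2]
    · left; refine ⟨⟨dy0 + psum dy r + p, by omega⟩, ?_⟩
      unfold rS; simp only
      rw [dif_neg (by omega), dif_neg (by omega), dif_pos (by omega)]
      congr 2; exact Fin.ext (by simp only; omega)
    · by_cases h : (p : ℕ) < psum dy r
      · left; refine ⟨⟨dy0 + p, by omega⟩, ?_⟩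
        unfold rS; simp only
        rw [dif_neg (by omega), dif_pos (by omega)]
        congr 2; exact Fin.ext (by simp only; omega)
      · right
        rintro q ⟨hq1, hq2⟩
        rw [Matrix.fromRows_apply_inr, Matrix.fromRows_apply_inr]
        refine rm0 V _ _ (fun hi => ?_)
        simp only [ge', lt'] at hi hq1 hq2
        exact H.A V (by omega) hq2 (by omega)
  · rintro q ⟨hq1, hq2⟩
    simp only [ge', lt'] at hq1 hq2
    by_cases h : (q : ℕ) < psum dx (c + 1)
    · exact Or.inl ⟨⟨q, h⟩, hq1, rfl⟩
    · right
      rintro (p | p | p)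
      · exact H.A V (p := p) (by omega) hq2 (by omega)
      · exact H.B V (p := p) (by omega) hq2 (by omega)
      · rw [Matrix.fromRows_apply_inr, Matrix.fromRows_apply_inr]
        refine rm0 V _ _ (fun hi => ?_)
        simp only [ge', lt'] at hi
        exact H.A V (by omega) hq2 (by omega)

theorem RD_S (H : Compat n dx dy s u r c) :
    RD (A0V V) (A1V V) (B0V V) (ge' (psum dx 0)) (lt' s) (ge' u) = rkS V r c := by
  refine RD_gen V H _ (fun p q h => absurd (by rw [psum_zero]; omega) h) (fun p q h => ?_)
  rw [Matrix.of_apply]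

theorem RD_S0 (H : Compat n dx dy s u r c) :
    RD (A0V V) (A1V V) (B0V V) (ge' (psum dx 1)) (lt' s) (ge' u) = rkS0 V r c := by
  refine RD_gen V H _ (fun p q h => ?_) (fun p q h => ?_)
  · rw [Matrix.of_apply]
    split_ifs with h1
    · by_cases h2 : (p : ℕ) < dy0
      · exact Aent0_zero V h2 (by omega)
      · rw [Aent0_eq V (by omega)]
        exact Aent_lo V (j := 0) (by rw [psum_zero]; omega) (by rw [zero_add]; omega)
    · exact Bent_0 V (by omega)
  · rw [Matrix.of_apply, Aent0_eq V (Or.inl h)]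

theorem rkS_00 : rkS V 0 0 = rkA V 0 0 0 0 := by
  classical
  have e1 : Yoff dy dy0 (0 + 1) = dy0 := by rw [Yoff_succ, psum_zero, add_zero]
  have e2 : Yoff dy dy0' (0 + 1) = dy0' := by rw [Yoff_succ, psum_zero, add_zero]
  have e3 : Yoff dy dy0 0 = 0 := rfl
  have e4 := psum_zero dx
  rw [rkS, ← rank_of_supp _ (fun _ => True) (fun _ _ h => absurd trivial h)]
  refine rank_dict _ _ _ (fun p => ⟨p, by have := p.2; omega⟩) (fun q => ⟨q, by have := q.2; omega⟩)
    ?_ (fun _ => trivial) ?_ ?_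
  · intro p q
    have := p.2
    rw [Matrix.of_apply, Matrix.of_apply, if_pos (by simp only; omega)]
    refine congrArg₂ (Aent V) ?_ ?_ <;> (try simp only) <;> omega
  · intro p
    by_cases h : (p : ℕ) < dy0
    · exact Or.inl ⟨⟨p, by omega⟩, rfl⟩
    · right; intro q _
      rw [Matrix.of_apply, if_neg (by omega)]
      exact Bent_0 V (q.2)
  · intro q _
    exact Or.inl ⟨⟨q, by omega⟩, rfl⟩

/-! entries of `matMA` -/
local notation "MA" => matMA (A0V V) (A1V V) (B0V V) (ge' u)

lemma mA_A {p : ℕ} (h : p < dy0 + dYt dy n) (q : Fin (dXt dx n)) (hp : p < dy0 + u) :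
    MA (.inl (spl p h)) (.inl q) = Aent V p q := rowsA V (nge_iff (u := u)) h q hp
lemma mA_A' {p : ℕ} (h : p < dy0 + dYt dy n) (q : Fin (dXt dx n)) (hp : p < dy0 + u) :
    MA (.inl (spl p h)) (.inr (.inr q)) = Aent V p q := rowsA V (nge_iff (u := u)) h q hp
lemma mA_B {p : ℕ} (h : p < dy0' + dYt dy n) (q : Fin (dXt dx n)) (hp : p < dy0' + u) :
    MA (.inr (spl p h)) (.inr (.inl q)) = Bent V p q := rowsB V (nge_iff (u := u)) h q hp
lemma mA_B' {p : ℕ} (h : p < dy0' + dYt dy n) (q : Fin (dXt dx n)) (hp : p < dy0' + u) :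
    MA (.inr (spl p h)) (.inr (.inr q)) = Bent V p q := rowsB V (nge_iff (u := u)) h q hp
lemma mA_r0 {p : ℕ} (h : p < dy0 + dYt dy n) (hp : ¬ p < dy0 + u) (q) :
    MA (.inl (spl p h)) q = 0 := by
  rcases q with q | q | q
  · exact rows0 (nge_iff (u := u)) _ _ h q hp
  · rfl
  · exact rows0 (nge_iff (u := u)) _ _ h q hp
lemma mA_r0' {p : ℕ} (h : p < dy0' + dYt dy n) (hp : ¬ p < dy0' + u) (q) :
    MA (.inr (spl p h)) q = 0 := by
  rcases q with q | q | q
  · rfl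
  · exact rows0 (nge_iff (u := u)) _ _ h q hp
  · exact rows0 (nge_iff (u := u)) _ _ h q hp
lemma mA_0 (p) (q) : MA (.inl p) (.inr (.inl q)) = 0 := rfl
lemma mA_0' (p) (q) : MA (.inr p) (.inl q) = 0 := rfl

/-- rows beyond `r` vanish -/
lemma mA_rows (H : Compat n dx dy s u r c) {t : ℕ} (ht : t ≤ s) (i)
    (hi : (∀ p h, i = .inl (spl p h) → dy0 + psum dy r ≤ p) ∧
      ∀ p h, i = .inr (spl p h) → dy0' + psum dy r ≤ p)
    (q) (hq : Sum.elim (lt' t) (Sum.elim (lt' t) (fun j => lt' s j ∧ ¬ lt' t j)) q) :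
    MA i q = 0 := by
  rcases i with i | i
  · obtain ⟨p, hp, rfl⟩ := spl_surj i
    have h0 := hi.1 p hp rfl
    by_cases h' : p < dy0 + u
    · rcases q with q | q | q
      · rw [mA_A V hp q h']
        exact H.A V h' (lt_of_lt_of_le hq ht) (Or.inl h0)
      · rfl
      · rw [mA_A' V hp q h']
        exact H.A V h' hq.1 (Or.inl h0)
    · exact mA_r0 V hp h' q
  · obtain ⟨p, hp, rfl⟩ := spl_surj i
    have h0 := hi.2 p hp rfl
    by_cases h' : p < dy0' + u
    · rcases q with q | q | q
      · rfl
      · rw [mA_B V hp q h']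
        exact H.B V h' (lt_of_lt_of_le hq ht) (Or.inl h0)
      · rw [mA_B' V hp q h']
        exact H.B V h' hq.1 (Or.inl h0)
    · exact mA_r0' V hp h' q

lemma spl_inj {a b p p' : ℕ} {h : p < a + b} {h' : p' < a + b} (e : spl p h = spl p' h') : p = p' := by
  unfold spl at e
  split_ifs at e with h1 h2 h2
  · exact Fin.mk.inj (Sum.inl.inj e)
  · have := Fin.mk.inj (Sum.inr.inj e); omega

/-- row map -/
def rM {z y z' : ℕ} (w : ℕ) (hw : w ≤ y) (p : ℕ) (h : p < z + w + (z' + w)) :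
    (Fin z ⊕ Fin y) ⊕ (Fin z' ⊕ Fin y) :=
  if h1 : p < z + w then .inl (spl p (by omega)) else .inr (spl (p - (z + w)) (by omega))

lemma rM_l {z y z' : ℕ} {w : ℕ} (hw : w ≤ y) {p : ℕ} (h : p < z + w + (z' + w)) (h1 : p < z + w) :
    rM w hw p h = .inl (spl p (by omega)) := dif_pos h1
lemma rM_r {z y z' : ℕ} {w : ℕ} (hw : w ≤ y) {p : ℕ} (h : p < z + w + (z' + w)) (h1 : ¬ p < z + w) :
    rM w hw p h = .inr (spl (p - (z + w)) (by omega)) := dif_neg h1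

lemma mA_hr (H : Compat n dx dy s u r c) {t : ℕ} (ht : t ≤ s) (hw : psum dy r ≤ dYt dy n) (i) :
    (∃ p, ∃ h, rM (psum dy r) hw p h = i) ∨
    ∀ q, Sum.elim (lt' t) (Sum.elim (lt' t) (fun j => lt' s j ∧ ¬ lt' t j)) q → MA i q = 0 := by
  by_cases hh : ((∀ p h, i = .inl (spl p h) → dy0 + psum dy r ≤ p) ∧
      ∀ p h, i = .inr (spl p h) → dy0' + psum dy r ≤ p)
  · exact Or.inr (mA_rows V H ht i hh)
  · left
    rw [not_and_or] at hh
    push Not at hh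
    rcases hh with ⟨p, h, e, hp⟩ | ⟨p, h, e, hp⟩
    · exact ⟨p, by omega, by rw [rM_l hw _ hp, e]⟩
    · refine ⟨dy0 + psum dy r + p, by omega, ?_⟩
      rw [rM_r hw _ (by omega), e]
      congr 2; omega

theorem RMA_A (H : Compat n dx dy s u r c) {i : ℕ} (hi : 2 ≤ i) (hic : i ≤ c) :
    RMA (A0V V) (A1V V) (B0V V) (lt' (psum dx i)) (lt' s) (ge' u) = rkMA V i r c := by
  classical
  have e1 := Yoff_succ dy dy0 r
  have e2 := Yoff_succ dy dy0' r
  have h1 := H.hs; have h2 := H.hu; have h3 := H.hcs; have h4 := H.hru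
  have h5 := psum_mono dx (show i ≤ c + 1 by omega)
  have h6 := psum_mono dx (show 1 ≤ i by omega)
  refine rank_dict _ _ _ (fun p => rM (psum dy r) (h4.trans h2) p (by have := p.2; omega))
    (fun q => if hq : (q : ℕ) < psum dx i then .inl ⟨q, by omega⟩ else
      if hq' : (q : ℕ) < psum dx i + (psum dx i - psum dx 1) then
        .inr (.inl ⟨psum dx 1 + (q - psum dx i), by omega⟩) else
        .inr (.inr ⟨psum dx i + (q - (psum dx i + (psum dx i - psum dx 1))), by have := q.2; omega⟩))
    ?_ ?_ ?_ ?_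
  · intro p q
    have hp := p.2
    rw [Matrix.of_apply]
    by_cases g1 : (p : ℕ) < dy0 + psum dy r
    · rw [rM_l _ _ g1]
      simp only [e1, if_pos g1, if_neg (not_le.2 g1)]
      split_ifs with g2 g3
      · rw [mA_A V _ _ (by omega)]
      · rw [mA_0]
      · rw [mA_A' V _ _ (by omega)]
    · rw [rM_r _ _ g1]
      simp only [e1, if_neg g1, if_pos (not_lt.1 g1)]
      split_ifs with g2 g3
      · rw [mA_0']
      · rw [mA_B V _ _ (by omega)]
      · rw [mA_B' V _ _ (by omega)]
  · intro q
    have := q.2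
    split_ifs with g2 g3
    · exact g2
    · simp only [Sum.elim_inl, Sum.elim_inr, lt']; omega
    · simp only [Sum.elim_inl, Sum.elim_inr, lt']; omega
  · intro a
    rcases mA_hr V H (h5.trans h3) (h4.trans h2) a with ⟨p, hp, e⟩ | h
    · exact Or.inl ⟨⟨p, by omega⟩, e⟩
    · exact Or.inr h
  · rintro (q | q | q) hq <;> simp only [Sum.elim_inl, Sum.elim_inr, lt'] at hq
    · left; refine ⟨⟨q, by omega⟩, ?_⟩
      simp only; rw [dif_pos hq]
    · by_cases h0 : (q : ℕ) < psum dx 1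
      · right
        rintro (a | a)
        · rfl
        · obtain ⟨p, hp, rfl⟩ := spl_surj a
          by_cases h' : p < dy0' + u
          · rw [mA_B V _ _ h', Bent_0 V h0]
          · exact mA_r0' V hp h' _
      · left; refine ⟨⟨psum dx i + (q - psum dx 1), by omega⟩, ?_⟩
        simp only; rw [dif_neg (by omega), dif_pos (by omega)]
        congr 2; exact Fin.ext (by simp only; omega)
    · by_cases h0 : (q : ℕ) < psum dx (c + 1)
      · left; refine ⟨⟨psum dx i + (psum dx i - psum dx 1) + (q - psum dx i), by omega⟩, ?_⟩
        simp only; rw [dif_neg (by omega), dif_neg (by omega)]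
        congr 2; exact Fin.ext (by simp only; omega)
      · right
        rintro (a | a) <;> obtain ⟨p, hp, rfl⟩ := spl_surj a
        · by_cases h' : p < dy0 + u
          · rw [mA_A' V _ _ h']; exact H.A V h' hq.1 (by omega)
          · exact mA_r0 V hp h' _
        · by_cases h' : p < dy0' + u
          · rw [mA_B' V _ _ h']; exact H.B V h' hq.1 (by omega)
          · exact mA_r0' V hp h' _

theorem RMA_S (H : Compat n dx dy s u r c) (hic : 1 ≤ c) :
    RMA (A0V V) (A1V V) (B0V V) (lt' (psum dx 1)) (lt' s) (ge' u) = rkS V r c := by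
  classical
  have e1 := Yoff_succ dy dy0 r
  have e2 := Yoff_succ dy dy0' r
  have h1 := H.hs; have h2 := H.hu; have h3 := H.hcs; have h4 := H.hru
  have h5 := psum_mono dx (show 1 ≤ c + 1 by omega)
  refine rank_dict _ _ _ (fun p => rM (psum dy r) (h4.trans h2) p (by have := p.2; omega))
    (fun q => if hq : (q : ℕ) < psum dx 1 then .inl ⟨q, by omega⟩ else
        .inr (.inr ⟨q, by have := q.2; omega⟩))
    ?_ ?_ ?_ ?_
  · intro p q
    have hp := p.2
    rw [Matrix.of_apply]
    by_cases g1 : (p : ℕ) < dy0 + psum dy r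
    · rw [rM_l _ _ g1]
      simp only [e1, if_pos g1, if_neg (not_le.2 g1)]
      split_ifs with g2
      · rw [mA_A V _ _ (by omega)]
      · rw [mA_A' V _ _ (by omega)]
    · rw [rM_r _ _ g1]
      simp only [e1, if_neg g1, if_pos (not_lt.1 g1)]
      split_ifs with g2
      · rw [mA_0', Bent_0 V g2]
      · rw [mA_B' V _ _ (by omega)]
  · intro q
    have := q.2
    split_ifs with g2
    · exact g2
    · simp only [Sum.elim_inl, Sum.elim_inr, lt']; omega
  · intro a
    rcases mA_hr V H (h5.trans h3) (h4.trans h2) a with ⟨p, hp, e⟩ | h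
    · exact Or.inl ⟨⟨p, by omega⟩, e⟩
    · exact Or.inr h
  · rintro (q | q | q) hq <;> simp only [Sum.elim_inl, Sum.elim_inr, lt'] at hq
    · left; refine ⟨⟨q, by omega⟩, ?_⟩
      simp only; rw [dif_pos hq]
    · right
      rintro (a | a)
      · rfl
      · obtain ⟨p, hp, rfl⟩ := spl_surj a
        by_cases h' : p < dy0' + u
        · rw [mA_B V _ _ h', Bent_0 V hq]
        · exact mA_r0' V hp h' _
    · by_cases h0 : (q : ℕ) < psum dx (c + 1)
      · left; refine ⟨⟨q, by omega⟩, ?_⟩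
        simp only; rw [dif_neg (by omega)]
      · right
        rintro (a | a) <;> obtain ⟨p, hp, rfl⟩ := spl_surj a
        · by_cases h' : p < dy0 + u
          · rw [mA_A' V _ _ h']; exact H.A V h' hq.1 (by omega)
          · exact mA_r0 V hp h' _
        · by_cases h' : p < dy0' + u
          · rw [mA_B' V _ _ h']; exact H.B V h' hq.1 (by omega)
          · exact mA_r0' V hp h' _

/-! entries of `matMB` -/
section mb
variable {v : ℕ}
local notation "MB" => matMB (A0V V) (A1V V) (B0V V) (ge' u) (ge' v)

lemma mB_A {p : ℕ} (h : p < dy0 + dYt dy n) (q : Fin (dXt dx n)) (hp : p < dy0 + v) :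
    MB (.inl (spl p h)) (.inl q) = Aent V p q := rowsA V (nge_iff (u := v)) h q hp
lemma mB_B {p : ℕ} (h : p < dy0' + dYt dy n) (q : Fin (dXt dx n)) (hp : p < dy0' + v) :
    MB (.inr (.inl (spl p h))) (.inr (.inl q)) = Bent V p q := rowsB V (nge_iff (u := v)) h q hp
lemma mB_r0 {p : ℕ} (h : p < dy0 + dYt dy n) (hp : ¬ p < dy0 + v) (q) :
    MB (.inl (spl p h)) q = 0 := by
  rcases q with q | q | q
  · exact rows0 (nge_iff (u := v)) _ _ h q hp
  · rfl
  · rfl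
lemma mB_r0' {p : ℕ} (h : p < dy0' + dYt dy n) (hp : ¬ p < dy0' + v) (q) :
    MB (.inr (.inl (spl p h))) q = 0 := by
  rcases q with q | q | q
  · rfl
  · exact rows0 (nge_iff (u := v)) _ _ h q hp
  · rfl
lemma mB_0 (p) (q) : MB (.inl p) (.inr q) = 0 := rfl
lemma mB_0' (p) (q) : MB (.inr (.inl p)) (.inl q) = 0 := rfl
lemma mB_L (p : Fin (dYt dy n)) (q : Fin (dXt dx n)) (h : v ≤ (p : ℕ) ∧ (p : ℕ) < u) :
    MB (.inr (.inr p)) (.inl q) = Aent V (dy0 + p) q := by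
  unfold matMB
  simp only [Matrix.fromRows_apply_inr, Matrix.fromCols_apply_inl, Matrix.fromCols_apply_inr]
  exact rmA V p q ⟨h.1, (nge_iff p).2 h.2⟩
lemma mB_L' (p : Fin (dYt dy n)) (q : Fin (dXt dx n)) (h : v ≤ (p : ℕ) ∧ (p : ℕ) < u) :
    MB (.inr (.inr p)) (.inr (.inl q)) = Aent V (dy0 + p) q := by
  unfold matMB
  simp only [Matrix.fromRows_apply_inr, Matrix.fromCols_apply_inl, Matrix.fromCols_apply_inr]
  exact rmA V p q ⟨h.1, (nge_iff p).2 h.2⟩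
lemma mB_L0 (p : Fin (dYt dy n)) (q : Fin (dXt dx n)) (h : v ≤ (p : ℕ) → (p : ℕ) < u → Aent V (dy0 + p) q = 0) :
    MB (.inr (.inr p)) (.inl q) = 0 := by
  unfold matMB
  simp only [Matrix.fromRows_apply_inr, Matrix.fromCols_apply_inl, Matrix.fromCols_apply_inr]
  exact rm0 V p q (fun hh => h hh.1 ((nge_iff p).1 hh.2))
lemma mB_L0' (p : Fin (dYt dy n)) (q : Fin (dXt dx n)) (h : v ≤ (p : ℕ) → (p : ℕ) < u → Aent V (dy0 + p) q = 0) :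
    MB (.inr (.inr p)) (.inr (.inl q)) = 0 := by
  unfold matMB
  simp only [Matrix.fromRows_apply_inr, Matrix.fromCols_apply_inl, Matrix.fromCols_apply_inr]
  exact rm0 V p q (fun hh => h hh.1 ((nge_iff p).1 hh.2))
lemma mB_3 (p) (q) : MB p (.inr (.inr q)) = 0 := by
  rcases p with p | p | p <;> rfl

theorem RMB_A (H : Compat n dx dy s u r c) {m : ℕ} (hm : m + 1 ≤ r) :
    RMB (A0V V) (A1V V) (B0V V) (lt' s) (ge' u) (ge' (psum dy m)) = rkMB V (m + 1) r c := by
  classical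
  have e1 := Yoff_succ dy dy0 r
  have e2 := Yoff_succ dy dy0 m
  have e3 := Yoff_succ dy dy0' m
  have h1 := H.hs; have h2 := H.hu; have h3 := H.hcs; have h4 := H.hru
  have h5 := psum_mono dx (show 1 ≤ c + 1 by omega)
  have h6 := psum_mono dy (show m ≤ r by omega)
  refine rank_dict _ _ _ (fun p => if hp : (p : ℕ) < dy0 + psum dy m then .inl (spl p (by omega)) else
      if hp' : (p : ℕ) < dy0 + psum dy m + (dy0' + psum dy m) then
        .inr (.inl (spl (p - (dy0 + psum dy m)) (by omega))) else
        .inr (.inr ⟨psum dy m + (p - (dy0 + psum dy m + (dy0' + psum dy m))), by have := p.2; omega⟩))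
    (fun q => if hq : (q : ℕ) < psum dx (c + 1) then .inl ⟨q, by omega⟩ else
        .inr (.inl ⟨psum dx 1 + (q - psum dx (c + 1)), by have := q.2; omega⟩))
    ?_ ?_ ?_ ?_
  · intro p q
    have hp := p.2
    rw [Matrix.of_apply]
    by_cases g1 : (p : ℕ) < dy0 + psum dy m
    · simp only [e2, e3, if_pos g1, dif_pos g1]
      split_ifs with g2
      · rw [mB_A V _ _ g1]
      · rw [mB_0]
    by_cases g2 : (p : ℕ) < dy0 + psum dy m + (dy0' + psum dy m)
    · simp only [e2, e3, if_neg g1, dif_neg g1, if_pos g2, dif_pos g2]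
      split_ifs with g3 g4 g4
      · omega
      · rw [mB_B V _ _ (by omega)]
      · rw [mB_0']
      · omega
    · simp only [e2, e3, if_neg g1, dif_neg g1, if_neg g2, dif_neg g2]
      split_ifs with g3
      · rw [mB_L V _ _ ⟨Nat.le_add_right _ _, show psum dy m + (↑p - (dy0 + psum dy m + (dy0' + psum dy m))) < u by omega⟩]
        refine congrArg₂ (Aent V) ?_ rfl; simp only; omega
      · rw [mB_L' V _ _ ⟨Nat.le_add_right _ _, show psum dy m + (↑p - (dy0 + psum dy m + (dy0' + psum dy m))) < u by omega⟩, ← Bent_y]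
        refine congrArg₂ (Bent V) ?_ rfl; simp only; omega
  · intro q
    have := q.2
    split_ifs with g2
    · exact lt_of_lt_of_le g2 h3
    · simp only [Sum.elim_inl, Sum.elim_inr, lt']; omega
  · rintro (a | a | a)
    · obtain ⟨p, hp, rfl⟩ := spl_surj a
      by_cases g : p < dy0 + psum dy m
      · left; refine ⟨⟨p, by omega⟩, ?_⟩
        simp only; rw [dif_pos g]
      · exact Or.inr (fun q _ => mB_r0 V hp g q)
    · obtain ⟨p, hp, rfl⟩ := spl_surj a
      by_cases g : p < dy0' + psum dy m
      · left; refine ⟨⟨dy0 + psum dy m + p, by omega⟩, ?_⟩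
        simp only; rw [dif_neg (by omega), dif_pos (by omega)]
        congr 3; omega
      · exact Or.inr (fun q _ => mB_r0' V hp g q)
    · by_cases g : psum dy m ≤ (a : ℕ) ∧ (a : ℕ) < psum dy r
      · left; refine ⟨⟨dy0 + psum dy m + (dy0' + psum dy m) + (a - psum dy m), by omega⟩, ?_⟩
        simp only; rw [dif_neg (by omega), dif_neg (by omega)]
        congr 2; exact Fin.ext (by simp only; omega)
      · right
        rintro (q | q | q) hq
        · exact mB_L0 V a q (fun g1 g2 => H.A V (by omega) hq (by omega))
        · exact mB_L0' V a q (fun g1 g2 => H.A V (by omega) hq (by omega))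
        · exact mB_3 V _ _
  · rintro (q | q | q) hq
    · by_cases g : (q : ℕ) < psum dx (c + 1)
      · left; refine ⟨⟨q, by omega⟩, ?_⟩
        simp only; rw [dif_pos g]
      · right
        rintro (a | a | a)
        · obtain ⟨p, hp, rfl⟩ := spl_surj a
          by_cases g : p < dy0 + psum dy m
          · rw [mB_A V _ _ g]; exact H.A V (by omega) hq (by omega)
          · exact mB_r0 V hp g _
        · rfl
        · exact mB_L0 V a q (fun g1 g2 => H.A V (by omega) hq (by omega))
    · by_cases g : psum dx 1 ≤ (q : ℕ) ∧ (q : ℕ) < psum dx (c + 1)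
      · left; refine ⟨⟨psum dx (c + 1) + (q - psum dx 1), by omega⟩, ?_⟩
        simp only; rw [dif_neg (by omega)]
        congr 2; exact Fin.ext (by simp only; omega)
      · right
        rintro (a | a | a)
        · rfl
        · obtain ⟨p, hp, rfl⟩ := spl_surj a
          by_cases g' : p < dy0' + psum dy m
          · rw [mB_B V _ _ g']
            by_cases g0 : (q : ℕ) < psum dx 1
            · exact Bent_0 V g0
            · exact H.B V (by omega) hq (by omega)
          · exact mB_r0' V hp g' _
        · refine mB_L0' V a q (fun g1 g2 => ?_)
          rw [← Bent_y]
          by_cases g0 : (q : ℕ) < psum dx 1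
          · exact Bent_0 V g0
          · exact H.B V (by omega) hq (by omega)
    · exact Or.inr (fun p => mB_3 V _ _)
end mb

end dict3
end FC

set_option linter.unusedSectionVars false
set_option linter.unusedVariables false
set_option linter.unusedSimpArgs false
set_option maxHeartbeats 1000000
namespace FC
open Submodule Module
section trans
variable {k : Type} [Field k] {n : ℕ} {dx dy : ℕ → ℕ} {dy0 dy0' : ℕ}
  (V W : QRep k n dx dy dy0 dy0')

def cuts (n : ℕ) (dx dy : ℕ → ℕ) (dy0 dy0' : ℕ) : Set ℕ := {x | isCut n dx dy dy0 dy0' x}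

lemma D_cut {i : ℕ} (hi : i ≤ n + 1) : dXt dx n - psum dx i ∈ cuts n dx dy dy0 dy0' :=
  Or.inl ⟨i, hi, rfl⟩

lemma L_cut {j : ℕ} (hj : j ≤ n) :
    2 * dXt dx n + dYt dy n + dy0 + dy0' + psum dy j ∈ cuts n dx dy dy0 dy0' :=
  Or.inr (Or.inr (Or.inr (Or.inr ⟨j, hj, rfl⟩)))

lemma C_cut {s u r c : ℕ} (H : Compat n dx dy s u r c) :
    dXt dx n + s + (dYt dy n - u) ∈ cuts n dx dy dy0 dy0' := by
  rcases H.h with ⟨e1, e2, e3⟩ | ⟨e1, e2, e3⟩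
  · refine Or.inr (Or.inl ⟨c + 1, by have := H.hc; omega, ?_⟩)
    rw [e2, e3]; unfold dYt; omega
  · have hc := H.hc
    refine Or.inr (Or.inr (Or.inl ⟨r, by omega, ?_⟩))
    have := psum_mono dy (show r ≤ n by omega)
    rw [e2, e3]; unfold dYt dXt; omega

lemma cut_cases {p : ℕ} (h : p ∈ cuts n dx dy dy0 dy0') :
    (∃ i ≤ n + 1, p = dXt dx n - psum dx i) ∨
    (∃ s u r c, Compat n dx dy s u r c ∧ p = dXt dx n + s + (dYt dy n - u)) ∨
    (∃ j ≤ n, p = 2 * dXt dx n + dYt dy n + dy0 + dy0' + psum dy j) := by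
  rcases h with ⟨m, hm, e⟩ | ⟨m, hm, e⟩ | ⟨m, hm, e⟩ | e | h
  · exact Or.inl ⟨m, hm, e⟩
  · rcases m with _ | m
    · refine Or.inl ⟨0, by omega, ?_⟩
      rw [e, psum_zero]; rfl
    · refine Or.inr (Or.inl ⟨psum dx (m + 1), psum dy n, m, m, ⟨by omega, Or.inl ⟨rfl, rfl, rfl⟩⟩, ?_⟩)
      rw [e]; unfold dYt; omega
  · have := psum_mono dy hm
    by_cases hmn : m = n
    · refine Or.inr (Or.inl ⟨psum dx (n + 1), psum dy n, n, n, ⟨le_rfl, Or.inl ⟨rfl, rfl, rfl⟩⟩, ?_⟩)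
      rw [e, hmn]; unfold dYt dXt; omega
    · refine Or.inr (Or.inl ⟨psum dx (n + 1), psum dy m, m, m + 1, ⟨by omega, Or.inr ⟨rfl, rfl, rfl⟩⟩, ?_⟩)
      rw [e]; unfold dYt dXt; omega
  · exact Or.inr (Or.inr ⟨0, by omega, by rw [e, psum_zero]; rfl⟩)
  · exact Or.inr (Or.inr h)

lemma exists_compat {r c : ℕ} (hc : c ≤ n) (h : r = c ∨ c = r + 1) :
    ∃ s u, Compat n dx dy s u r c := by
  rcases h with h | h
  · exact ⟨_, _, hc, Or.inl ⟨h, rfl, rfl⟩⟩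
  · exact ⟨_, _, hc, Or.inr ⟨h, rfl, rfl⟩⟩

def Dn' (R : ℕ → ℕ → Prop) (V W : QRep k n dx dy dy0 dy0') : Prop :=
  ∀ r c, c ≤ n → (r = c ∨ c = r + 1) →
    R (rkA V 0 r 0 c) (rkA W 0 r 0 c) ∧
    (1 ≤ c → R (rkB V 0 r 1 c) (rkB W 0 r 1 c)) ∧
    (∀ i, 1 ≤ i → i ≤ r → R (rkA V i r i c) (rkA W i r i c)) ∧
    (∀ i, 2 ≤ i → i ≤ c → R (rkA V (i - 1) r i c) (rkA W (i - 1) r i c)) ∧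
    (1 ≤ c → R (rkS V r c) (rkS W r c)) ∧
    (1 ≤ c → R (rkS0 V r c) (rkS0 W r c)) ∧
    (∀ i, 2 ≤ i → i ≤ c → R (rkMA V i r c) (rkMA W i r c)) ∧
    (∀ i, 1 ≤ i → i ≤ r → R (rkMB V i r c) (rkMB W i r c))

lemma dn_iff (R : ℕ → ℕ → Prop) (hn : 1 ≤ n) : DnRel R V W ↔ Dn' R V W := by
  constructor
  · rintro ⟨h1, h2, h3, h4, h5, h6, h7, h8, h9, h10, h11, h12⟩ r c hc hrc
    rcases hrc with rfl | rfl
    · refine ⟨?_, fun h => h5 r h hc, fun i hi hir => h6 i r hi hir hc,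
        fun i hi hir => (h8 i r hi hir hc).2, fun h => (h9 r h hc).2.1, fun h => (h9 r h hc).2.2.2,
        fun i hi hir => (h10 i r hi hir hc).2, fun i hi hir => h11 i r hi hir hc⟩
      rcases Nat.eq_zero_or_pos r with rfl | hr
      · exact h1
      · exact (h2 r hr hc).2
    · refine ⟨(h2 (r + 1) (by omega) hc).1, fun h => ?_,
        fun i hi hir => h7 i (r + 1) hi (by omega) hc,
        fun i hi hir => (h8 i (r + 1) hi hir hc).1, fun h => (h9 (r + 1) h hc).1,
        fun h => (h9 (r + 1) h hc).2.2.1,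
        fun i hi hir => (h10 i (r + 1) hi hir hc).1, fun i hi hir => h12 i r hi hir hc⟩
      rcases Nat.eq_zero_or_pos r with rfl | hr
      · exact h3
      · exact h4 (r + 1) (by omega) hc
  · intro h
    have e : ∀ j, 1 ≤ j → (j - 1 = j ∨ j = j - 1 + 1) := fun j hj => Or.inr (by omega)
    refine ⟨(h 0 0 (by omega) (Or.inl rfl)).1,
      fun j hj hjn => ⟨(h (j - 1) j hjn (e j hj)).1, (h j j hjn (Or.inl rfl)).1⟩,
      (h 0 1 hn (Or.inr rfl)).2.1 le_rfl,
      fun j hj hjn => (h (j - 1) j hjn (e j (by omega))).2.1 (by omega),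
      fun j hj hjn => (h j j hjn (Or.inl rfl)).2.1 hj,
      fun i j hi hij hjn => (h j j hjn (Or.inl rfl)).2.2.1 i hi hij,
      fun i j hi hij hjn => (h (j - 1) j hjn (e j (by omega))).2.2.1 i hi (by omega),
      fun i j hi hij hjn => ⟨(h (j - 1) j hjn (e j (by omega))).2.2.2.1 i hi hij,
        (h j j hjn (Or.inl rfl)).2.2.2.1 i hi hij⟩,
      fun j hj hjn => ⟨(h (j - 1) j hjn (e j hj)).2.2.2.2.1 hj,
        (h j j hjn (Or.inl rfl)).2.2.2.2.1 hj, (h (j - 1) j hjn (e j hj)).2.2.2.2.2.1 hj,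
        (h j j hjn (Or.inl rfl)).2.2.2.2.2.1 hj⟩,
      fun i j hi hij hjn => ⟨(h (j - 1) j hjn (e j (by omega))).2.2.2.2.2.2.1 i hi hij,
        (h j j hjn (Or.inl rfl)).2.2.2.2.2.2.1 i hi hij⟩,
      fun i j hi hij hjn => (h j j hjn (Or.inl rfl)).2.2.2.2.2.2.2 i hi hij,
      fun i j hi hij hjn => (h j (j + 1) hjn (Or.inr rfl)).2.2.2.2.2.2.2 i hi hij⟩

abbrev TA (k : Type) [Field k] (n : ℕ) (dx dy : ℕ → ℕ) (dy0 dy0' : ℕ) :=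
  TT k (NN n dx dy dy0 dy0') (dy0 + dYt dy n + dXt dx n)
abbrev TA' (k : Type) [Field k] (n : ℕ) (dx dy : ℕ → ℕ) (dy0 dy0' : ℕ) :=
  TT' k (NN n dx dy dy0 dy0') (dy0 + dYt dy n + dXt dx n)

def FRel (m m' : Matrix (Fin (NN n dx dy dy0 dy0')) (Fin (NN n dx dy dy0 dy0')) k) : Prop :=
  FLeOn (cuts n dx dy dy0 dy0') (TA k n dx dy dy0 dy0') (TA' k n dx dy dy0 dy0') (Fl m) (Fl m')

lemma FRel.all {m m' : Matrix (Fin (NN n dx dy dy0 dy0')) (Fin (NN n dx dy dy0 dy0')) k}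
    (h : FRel m m') {i j : ℕ} (hi : i ∈ cuts n dx dy dy0 dy0') (hj : j ∈ cuts n dx dy dy0 dy0') :
    phi (TA k n dx dy dy0 dy0') (Fl m j) (Fl m i) ≤ phi (TA k n dx dy dy0 dy0') (Fl m' j) (Fl m' i) :=
  FLeOn.all (TT_Pr _) (Fl_mono m) (Fl_mono m') h hi hj

variable {s u r c : ℕ}

lemma MA_iff (H : Compat n dx dy s u r c) {i : ℕ} (h1 : 1 ≤ i) (hi : i ≤ c) :
    phi (TA k n dx dy dy0 dy0') (Fl (etaMat V) (dXt dx n + s + (dYt dy n - u)))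
        (Fl (etaMat V) (dXt dx n + psum dx i + (dYt dy n - dYt dy n))) ≤
      phi (TA k n dx dy dy0 dy0') (Fl (etaMat W) (dXt dx n + s + (dYt dy n - u)))
        (Fl (etaMat W) (dXt dx n + psum dx i + (dYt dy n - dYt dy n))) ↔
    (if i = 1 then rkS V r c ≤ rkS W r c else rkMA V i r c ≤ rkMA W i r c) := by
  have hrc := H.hrc
  have h3 := H.hcs
  have h4 := H.hru
  have h5 := psum_mono dx (show i ≤ c + 1 by omega)
  have h6 := psum_mono dx (show i ≤ r + 1 by omega)
  have van : ∀ U : QRep k n dx dy dy0 dy0', Van (A1V U) (ge' u) (lt' (psum dx i)) := by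
    intro U p q hp hq
    exact Aent_lo U (j := r) (by have : u ≤ (p : ℕ) := hp; omega)
      (by have : (q : ℕ) < psum dx i := hq; omega)
  refine (iff_MA (shape_eta V) (shape_eta W) H.hs H.hu H.hsu (by omega) (van V) (van W)).trans ?_
  split_ifs with h
  · subst h; rw [RMA_S V H hi, RMA_S W H hi]
  · rw [RMA_A V H (by omega) hi, RMA_A W H (by omega) hi]

lemma MB_iff (H : Compat n dx dy s u r c) {m : ℕ} (hm : m + 1 ≤ r) :
    phi (TA k n dx dy dy0 dy0') (Fl (etaMat V) (dXt dx n + dXt dx n + (dYt dy n - psum dy m)))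
        (Fl (etaMat V) (dXt dx n + s + (dYt dy n - u))) ≤
      phi (TA k n dx dy dy0 dy0') (Fl (etaMat W) (dXt dx n + dXt dx n + (dYt dy n - psum dy m)))
        (Fl (etaMat W) (dXt dx n + s + (dYt dy n - u))) ↔
    rkMB V (m + 1) r c ≤ rkMB W (m + 1) r c := by
  have hrc := H.hrc
  have h3 := H.hcs
  have h4 := H.hru
  have h5 := psum_mono dy (show m ≤ r by omega)
  have h6 := psum_mono dx (show m + 2 ≤ c + 1 by omega)
  have h7 := psum_mono dx (show 0 + 2 ≤ m + 2 by omega)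
  have va : ∀ (U : QRep k n dx dy dy0 dy0') i (j : Fin (dXt dx n)), s ≤ (j : ℕ) → A0V U i j = 0 :=
    fun U i j hj => Aent_hi U (j := 0) (by omega) (by omega)
  have vb : ∀ (U : QRep k n dx dy dy0 dy0') i (j : Fin (dXt dx n)), s ≤ (j : ℕ) → B0V U i j = 0 :=
    fun U i j hj => Bent_hi U (j := 0) (by omega) (by omega)
  have van : ∀ U : QRep k n dx dy dy0 dy0', Van (A1V U) (lt' (psum dy m)) (ge' s) := by
    intro U p q hp hq
    exact Aent_hi U (j := m) (by have : (p : ℕ) < psum dy m := hp; omega)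
      (by have : s ≤ (q : ℕ) := hq; omega)
  refine (iff_MB (shape_eta V) (shape_eta W) H.hs H.hu H.hsu (by omega) (va V) (va W) (vb V) (vb W)
    (van V) (van W)).trans ?_
  rw [RMB_A V H hm, RMB_A W H hm]

theorem trans_mp (h : FRel (etaMat V) (etaMat W)) : Dn' (· ≤ ·) V W := by
  intro r c hc hrc
  obtain ⟨s, u, H⟩ := exists_compat (dx := dx) (dy := dy) hc hrc
  have hV := shape_eta V
  have hW := shape_eta W
  have hC := C_cut (dy0 := dy0) (dy0' := dy0') H
  refine ⟨?_, fun h1 => ?_, fun i hi hir => ?_, fun i hi hir => ?_, fun h1 => ?_, fun h1 => ?_,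
    fun i hi hir => ?_, fun i hi hir => ?_⟩
  · have := (iff_A hV hW H.hs H.hu H.hsu).1 (h.a _ hC)
    rwa [RA_A V H, RA_A W H] at this
  · have := (iff_B hV hW H.hs H.hu H.hsu).1 (h.b _ hC)
    rwa [RA_B V H h1, RA_B W H h1] at this
  · obtain ⟨j, rfl⟩ : ∃ j, i = j + 1 := ⟨i - 1, by omega⟩
    have := (iff_L hV hW (psum dy j) H.hs H.hu H.hsu).1 (h.all hC (L_cut (by omega)))
    rwa [RL_A V H hir, RL_A W H hir] at this
  · have := (iff_D hV hW (psum dx i) H.hs H.hu H.hsu).1 (h.all (D_cut (by omega)) hC)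
    rwa [RD_A V H hi hir, RD_A W H hi hir] at this
  · have := (iff_D hV hW (psum dx 0) H.hs H.hu H.hsu).1 (h.all (D_cut (by omega)) hC)
    rwa [RD_S V H, RD_S W H] at this
  · have := (iff_D hV hW (psum dx 1) H.hs H.hu H.hsu).1 (h.all (D_cut (by omega)) hC)
    rwa [RD_S0 V H, RD_S0 W H] at this
  · have H1 : Compat n dx dy (psum dx i) (psum dy n) (i - 1) (i - 1) :=
      ⟨by omega, Or.inl ⟨rfl, by rw [Nat.sub_add_cancel (by omega)], rfl⟩⟩
    have := (MA_iff V W H (by omega) hir).1 (h.all (C_cut H1) hC)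
    rwa [if_neg (by omega)] at this
  · obtain ⟨j, rfl⟩ : ∃ j, i = j + 1 := ⟨i - 1, by omega⟩
    have H1 : Compat n dx dy (psum dx (n + 1)) (psum dy j) j (j + 1) :=
      ⟨by omega, Or.inr ⟨rfl, rfl, rfl⟩⟩
    exact (MB_iff V W H hir).1 (h.all hC (C_cut H1))

lemma D_part (h : Dn' (· ≤ ·) V W) (H : Compat n dx dy s u r c) (i : ℕ) :
    RD (A0V V) (A1V V) (B0V V) (ge' (psum dx i)) (lt' s) (ge' u) ≤
      RD (A0V W) (A1V W) (B0V W) (ge' (psum dx i)) (lt' s) (ge' u) := by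
  have hrc := H.hrc
  have hrc' : r = c ∨ c = r + 1 := by rcases H.h with e | e <;> [left; right] <;> exact e.1
  obtain ⟨h1, h2, h3, h4, h5, h6, h7, h8⟩ := h r c H.hc hrc'
  by_cases hic : c < i
  · rw [RD_0 V H hic, RD_0 W H hic]
  rcases i with _ | _ | i
  · rw [RD_S V H, RD_S W H]
    rcases Nat.eq_zero_or_pos c with rfl | hc
    · have : r = 0 := by omega
      subst this
      rw [rkS_00 V, rkS_00 W]; exact h1
    · exact h5 hc
  · have := RD_S0 V H
    have := RD_S0 W H
    simp only [zero_add] at *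
    rw [RD_S0 V H, RD_S0 W H]; exact h6 (by omega)
  · rw [RD_A V H (by omega) (by omega), RD_A W H (by omega) (by omega)]
    exact h4 _ (by omega) (by omega)

lemma L_part (h : Dn' (· ≤ ·) V W) (H : Compat n dx dy s u r c) (j : ℕ) :
    RL (A1V V) (lt' s) (ge' u) (lt' (psum dy j)) ≤ RL (A1V W) (lt' s) (ge' u) (lt' (psum dy j)) := by
  have hrc' : r = c ∨ c = r + 1 := by rcases H.h with e | e <;> [left; right] <;> exact e.1
  obtain ⟨h1, h2, h3, h4, h5, h6, h7, h8⟩ := h r c H.hc hrc'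
  by_cases hj : r ≤ j
  · rw [RL_0 V H hj, RL_0 W H hj]
  · rw [RL_A V H (by omega), RL_A W H (by omega)]; exact h3 _ (by omega) (by omega)

lemma CC_part (h : Dn' (· ≤ ·) V W) (H : Compat n dx dy s u r c) {s' u' r' c' : ℕ}
    (H' : Compat n dx dy s' u' r' c')
    (hlt : dXt dx n + s + (dYt dy n - u) < dXt dx n + s' + (dYt dy n - u')) :
    phi (TA k n dx dy dy0 dy0') (Fl (etaMat V) (dXt dx n + s' + (dYt dy n - u')))
        (Fl (etaMat V) (dXt dx n + s + (dYt dy n - u))) ≤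
      phi (TA k n dx dy dy0 dy0') (Fl (etaMat W) (dXt dx n + s' + (dYt dy n - u')))
        (Fl (etaMat W) (dXt dx n + s + (dYt dy n - u))) := by
  have hrc1 : r = c ∨ c = r + 1 := by rcases H.h with e | e <;> [left; right] <;> exact e.1
  have hrc2 : r' = c' ∨ c' = r' + 1 := by rcases H'.h with e | e <;> [left; right] <;> exact e.1
  have D1 := h r c H.hc hrc1
  have D2 := h r' c' H'.hc hrc2
  have hs := H.hs; have hs' := H'.hs; have hu := H.hu; have hu' := H'.hu
  have hc := H.hc; have hc' := H'.hc
  by_cases hm : ∃ i, 1 ≤ i ∧ i ≤ c' ∧ s = psum dx i ∧ u = dYt dy n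
  · obtain ⟨i, h1, h2, rfl, rfl⟩ := hm
    refine (MA_iff V W H' h1 h2).2 ?_
    split_ifs with h
    · exact D2.2.2.2.2.1 (by omega)
    · exact D2.2.2.2.2.2.2.1 i (by omega) h2
  have hM : r' + 1 ≤ r → s' = psum dx (n + 1) → u' = psum dy r' →
      phi (TA k n dx dy dy0 dy0') (Fl (etaMat V) (dXt dx n + s' + (dYt dy n - u')))
        (Fl (etaMat V) (dXt dx n + s + (dYt dy n - u))) ≤
      phi (TA k n dx dy dy0 dy0') (Fl (etaMat W) (dXt dx n + s' + (dYt dy n - u')))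
        (Fl (etaMat W) (dXt dx n + s + (dYt dy n - u))) := by
    intro h1 h2 h3
    subst h2 h3
    exact (MB_iff V W H h1).2 (D1.2.2.2.2.2.2.2 _ (by omega) h1)
  rcases H.h with ⟨e1, e2, e3⟩ | ⟨e1, e2, e3⟩ <;> rcases H'.h with ⟨f1, f2, f3⟩ | ⟨f1, f2, f3⟩
  · have : c + 1 < c' + 1 := lt_of_psum (f := dx) (by omega)
    exact absurd ⟨c + 1, by omega, by omega, e2, e3⟩ hm
  · by_cases hcc : c + 1 ≤ c'
    · exact absurd ⟨c + 1, by omega, by omega, e2, e3⟩ hm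
    · exact hM (by omega) f2 f3
  · unfold dXt dYt at *
    omega
  · have : r' < r := lt_of_psum (f := dy) (by omega)
    exact hM (by omega) f2 f3

theorem trans_mpr (h : Dn' (· ≤ ·) V W) : FRel (etaMat V) (etaMat W) := by
  have hV := shape_eta V
  have hW := shape_eta W
  have hrc : ∀ {s u r c}, Compat n dx dy s u r c → r = c ∨ c = r + 1 := by
    intro s u r c H
    rcases H.h with e | e <;> [left; right] <;> exact e.1
  have eD : ∀ t, Fl (etaMat V) (dXt dx n - t) = Fl (etaMat W) (dXt dx n - t) :=
    fun t => FlD_eq hV hW t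
  have eL : ∀ t, Fl (etaMat V) (2 * dXt dx n + dYt dy n + dy0 + dy0' + t) =
      Fl (etaMat W) (2 * dXt dx n + dYt dy n + dy0 + dy0' + t) := fun t => FlL_eq hV hW t
  refine ⟨fun p hp => ?_, fun p hp => ?_, fun p hp q hq hpq => ?_⟩
  · rcases cut_cases hp with ⟨i, hi, rfl⟩ | ⟨s, u, r, c, H, rfl⟩ | ⟨j, hj, rfl⟩
    · rw [eD]
    · refine (iff_A hV hW H.hs H.hu H.hsu).2 ?_
      rw [RA_A V H, RA_A W H]
      exact (h r c H.hc (hrc H)).1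
    · rw [eL]
  · rcases cut_cases hp with ⟨i, hi, rfl⟩ | ⟨s, u, r, c, H, rfl⟩ | ⟨j, hj, rfl⟩
    · rw [eD]
    · refine (iff_B hV hW H.hs H.hu H.hsu).2 ?_
      rcases Nat.eq_zero_or_pos c with hc | hc
      · rw [RA_B0 V H hc, RA_B0 W H hc]
      · rw [RA_B V H hc, RA_B W H hc]
        exact (h r c H.hc (hrc H)).2.1 hc
    · rw [eL]
  · rcases cut_cases hp with ⟨i, hi, rfl⟩ | ⟨s, u, r, c, H, rfl⟩ | ⟨j, hj, rfl⟩ <;>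
    rcases cut_cases hq with ⟨i', hi', rfl⟩ | ⟨s', u', r', c', H', rfl⟩ | ⟨j', hj', rfl⟩
    · rw [eD, eD]
    · refine (iff_D hV hW (psum dx i) H'.hs H'.hu H'.hsu).2 ?_
      exact D_part V W h H' i
    · rw [eD, eL]
    · omega
    · exact CC_part V W h H H' hpq
    · refine (iff_L hV hW (psum dy j') H.hs H.hu H.hsu).2 ?_
      exact L_part V W h H j'
    · omega
    · have := H'.hs; omega
    · rw [eL, eL]

end trans
end FC

set_option linter.unusedSectionVars false
set_option linter.unusedVariables false
set_option linter.unusedSimpArgs false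
set_option maxHeartbeats 1000000
namespace FC
open Submodule Module
section fin
variable {k : Type} [Field k] {n : ℕ} {dx dy : ℕ → ℕ} {dy0 dy0' : ℕ}
  (V W : QRep k n dx dy dy0 dy0')

lemma comm_iff {N s : ℕ} (g : Matrix (Fin N) (Fin N) k) :
    (∀ v, g.mulVecLin (TT k N s v) = TT k N s (g.mulVecLin v)) ↔
    ∀ i c : Fin N, (((i : ℕ) < s ∧ s ≤ (c : ℕ)) ∨ (s ≤ (i : ℕ) ∧ (c : ℕ) < s)) → g i c = 0 := by
  classical
  constructor
  · intro h i c hic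
    have := congrFun (h (Pi.single c 1)) i
    have e : TT k N s (Pi.single c 1) = if (c : ℕ) < s then Pi.single c 1 else 0 := by
      ext j
      rw [TT, cm_apply]
      by_cases hj : j = c
      · subst hj; split_ifs <;> simp
      · rw [Pi.single_eq_of_ne hj]; split_ifs <;> simp [hj]
    rw [e] at this
    have e2 : ∀ w, TT k N s w i = if (i : ℕ) < s then w i else 0 := fun w => by
      rw [TT, cm_apply]
    rw [e2] at this
    rcases hic with ⟨h1, h2⟩ | ⟨h1, h2⟩
    · rw [if_neg (by omega), if_pos h1] at this
      simpa using this.symm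
    · rw [if_pos h2, if_neg (by omega)] at this
      simpa using this
  · intro h v
    ext i
    have e2 : ∀ w i, TT k N s w i = if (i : ℕ) < s then w i else 0 := fun w i => by
      rw [TT, cm_apply]
    rw [e2]
    simp only [Matrix.mulVecLin_apply, Matrix.mulVec, dotProduct]
    split_ifs with hi
    · refine Finset.sum_congr rfl (fun c _ => ?_)
      rw [e2]
      split_ifs with hc
      · rfl
      · rw [h i c (Or.inl ⟨hi, by omega⟩), zero_mul, zero_mul]
    · refine Finset.sum_eq_zero (fun c _ => ?_)
      rw [e2]
      split_ifs with hc
      · rw [h i c (Or.inr ⟨by omega, hc⟩), zero_mul]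
      · rw [mul_zero]

lemma para_iff {N : ℕ} {C : Set ℕ} (hC : C ⊆ Set.Iic N) {g : Matrix (Fin N) (Fin N) k}
    (hg : IsUnit g) :
    (∀ x ∈ C, Fl g x = Est k N x) ↔
    ∀ i c : Fin N, (∃ x, x ∈ C ∧ (c : ℕ) < x ∧ x ≤ (i : ℕ)) → g i c = 0 := by
  classical
  constructor
  · rintro h i c ⟨x, hx, h1, h2⟩
    have : g.mulVecLin (Pi.single c 1) ∈ Fl g x := by
      refine ⟨Pi.single c 1, ?_, rfl⟩
      intro j hj
      exact Pi.single_eq_of_ne (by rintro rfl; omega) _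
    rw [h x hx] at this
    simpa using this i h2
  · intro h x hx
    have hle : Fl g x ≤ Est k N x := by
      rintro _ ⟨v, hv, rfl⟩ i hi
      simp only [Matrix.mulVecLin_apply, Matrix.mulVec, dotProduct]
      refine Finset.sum_eq_zero (fun c _ => ?_)
      by_cases hc : (c : ℕ) < x
      · rw [h i c ⟨x, hx, hc, hi⟩, zero_mul]
      · rw [hv c (by omega), mul_zero]
    refine Submodule.eq_of_le_of_finrank_eq hle ?_
    rw [(Fl_flag hg).dim x (by rw [finrank_fin_fun]; exact hC hx), Est_finrank x (hC hx)]

lemma cuts_le : cuts n dx dy dy0 dy0' ⊆ Set.Iic (NN n dx dy dy0 dy0') := by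
  intro p hp
  change p ≤ dy0 + dYt dy n + dXt dx n + (dy0' + dYt dy n + dXt dx n)
  rcases hp with ⟨m, hm, e⟩ | ⟨m, hm, e⟩ | ⟨m, hm, e⟩ | e | ⟨m, hm, e⟩
  · omega
  · have : psum dx m ≤ dXt dx n := psum_mono dx hm
    omega
  · omega
  · omega
  · have : psum dy m ≤ dYt dy n := psum_mono dy hm
    omega

lemma cuts_0 : 0 ∈ cuts n dx dy dy0 dy0' :=
  Or.inl ⟨n + 1, le_rfl, (Nat.sub_self _).symm⟩

lemma cuts_N : NN n dx dy dy0 dy0' ∈ cuts n dx dy dy0 dy0' := by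
  refine Or.inr (Or.inr (Or.inr (Or.inr ⟨n, le_rfl, ?_⟩)))
  change dy0 + dYt dy n + dXt dx n + (dy0' + dYt dy n + dXt dx n) =
    2 * dXt dx n + dYt dy n + dy0 + dy0' + dYt dy n
  omega

lemma orbit_eq (g : Matrix (Fin (NN n dx dy dy0 dy0')) (Fin (NN n dx dy dy0 dy0')) k) :
    orbitKP k n dx dy dy0 dy0' g = KP (TA k n dx dy dy0 dy0') (cuts n dx dy dy0 dy0') g := by
  ext y
  constructor
  · rintro ⟨κ, ⟨k1, k2⟩, p, ⟨p1, p2⟩, e⟩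
    exact ⟨κ, p, k1, (comm_iff κ).2 k2, p1, (para_iff cuts_le p1).2 p2, e⟩
  · rintro ⟨κ, p, k1, k2, p1, p2, e⟩
    exact ⟨κ, ⟨k1, (comm_iff κ).1 k2⟩, p, ⟨p1, (para_iff cuts_le p1).1 p2⟩, e⟩

lemma KP_self {N : ℕ} (T : (Fin N → k) →ₗ[k] (Fin N → k)) (C : Set ℕ) (h : Matrix (Fin N) (Fin N) k) :
    h ∈ KP T C h :=
  ⟨1, 1, isUnit_one, fun v => by simp, isUnit_one, fun i _ => Fl_one i, by simp⟩

lemma KP_mul {N : ℕ} {T : (Fin N → k) →ₗ[k] (Fin N → k)} {C : Set ℕ}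
    {h y κ p : Matrix (Fin N) (Fin N) k} (hy : y ∈ KP T C h) (k1 : IsUnit κ)
    (k2 : ∀ v, κ.mulVecLin (T v) = T (κ.mulVecLin v)) (p1 : IsUnit p)
    (p2 : ∀ i ∈ C, Fl p i = Est k N i) : κ * y * p ∈ KP T C h := by
  obtain ⟨κ', p', k1', k2', p1', p2', rfl⟩ := hy
  refine ⟨κ * κ', p' * p, k1.mul k1', fun v => ?_, p1'.mul p1, fun i hi => ?_, ?_⟩
  · rw [Matrix.mulVecLin_mul]
    simp only [LinearMap.comp_apply]
    rw [k2', k2]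
  · rw [Fl_mul' _ _ _ (p2 i hi), p2' i hi]
  · simp only [Matrix.mul_assoc]

lemma Zcl_KP {N : ℕ} {T : (Fin N → k) →ₗ[k] (Fin N → k)} {C : Set ℕ}
    {g h : Matrix (Fin N) (Fin N) k} (hg : g ∈ Zcl (KP T C h)) : Zcl (KP T C g) ⊆ Zcl (KP T C h) := by
  intro x hx
  refine Zcl_mono ?_ hx
  rintro _ ⟨κ, p, k1, k2, p1, p2, rfl⟩
  exact Zcl_mul κ p (fun y hy => subset_Zcl _ (KP_mul hy k1 k2 p1 p2)) hg

lemma KP_sub {N : ℕ} {T : (Fin N → k) →ₗ[k] (Fin N → k)} {C : Set ℕ}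
    {g h : Matrix (Fin N) (Fin N) k} (hg : g ∈ KP T C h) : KP T C g ⊆ KP T C h := by
  rintro _ ⟨κ, p, k1, k2, p1, p2, rfl⟩
  exact KP_mul hg k1 k2 p1 p2

def ofM (hn : 1 ≤ n) (A0 : Matrix (Fin dy0) (Fin (dXt dx n)) k)
    (A1 : Matrix (Fin (dYt dy n)) (Fin (dXt dx n)) k)
    (B0 : Matrix (Fin dy0') (Fin (dXt dx n)) k) : QRep k n dx dy dy0 dy0' where
  vb0 := Matrix.of fun i c => A0 i ⟨c, by
    have h1 := psum_mono dx (show 1 ≤ n + 1 by omega)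
    have h2 := psum_one dx
    have h3 : dXt dx n = psum dx (n + 1) := rfl
    omega⟩
  va1 := Matrix.of fun i c => A0 i ⟨psum dx 1 + c, by
    have h1 := psum_mono dx (show 2 ≤ n + 1 by omega)
    have h2 : psum dx 2 = psum dx 1 + dx 1 := psum_succ dx 1
    have h3 : dXt dx n = psum dx (n + 1) := rfl
    omega⟩
  va1' := Matrix.of fun i c => B0 i ⟨psum dx 1 + c, by
    have h1 := psum_mono dx (show 2 ≤ n + 1 by omega)
    have h2 : psum dx 2 = psum dx 1 + dx 1 := psum_succ dx 1
    have h3 : dXt dx n = psum dx (n + 1) := rfl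
    omega⟩
  vb := fun i => Matrix.of fun p c => A1 ⟨psum dy i + p, by
      have h0 := i.2
      have h1 := psum_mono dy (show (i : ℕ) + 1 ≤ n by omega)
      have h2 : psum dy ((i : ℕ) + 1) = psum dy i + dy i := psum_succ dy i
      have h3 : dYt dy n = psum dy n := rfl
      omega⟩ ⟨psum dx ((i : ℕ) + 1) + c, by
      have h0 := i.2
      have h1 := psum_mono dx (show (i : ℕ) + 2 ≤ n + 1 by omega)
      have h2 : psum dx ((i : ℕ) + 2) = psum dx ((i : ℕ) + 1) + dx ((i : ℕ) + 1) := psum_succ dx _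
      have h3 : dXt dx n = psum dx (n + 1) := rfl
      omega⟩
  va := fun i => Matrix.of fun p c => A1 ⟨psum dy i + p, by
      have h0 := i.2
      have h1 := psum_mono dy (show (i : ℕ) + 1 ≤ n by omega)
      have h2 : psum dy ((i : ℕ) + 1) = psum dy i + dy i := psum_succ dy i
      have h3 : dYt dy n = psum dy n := rfl
      omega⟩ ⟨psum dx ((i : ℕ) + 2) + c, by
      have h0 := i.2
      have h1 := psum_mono dx (show (i : ℕ) + 3 ≤ n + 1 by omega)
      have h2 : psum dx ((i : ℕ) + 3) = psum dx ((i : ℕ) + 2) + dx ((i : ℕ) + 2) := psum_succ dx _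
      have h3 : dXt dx n = psum dx (n + 1) := rfl
      omega⟩

section build
variable (hn : 1 ≤ n) {A0 : Matrix (Fin dy0) (Fin (dXt dx n)) k}
    {A1 : Matrix (Fin (dYt dy n)) (Fin (dXt dx n)) k}
    {B0 : Matrix (Fin dy0') (Fin (dXt dx n)) k}

lemma ofM_A0 (h2 : ∀ i (q : Fin (dXt dx n)), psum dx 2 ≤ (q : ℕ) → A0 i q = 0) :
    A0V (ofM hn A0 A1 B0) = A0 := by
  ext i q
  change Aent _ (i : ℕ) (q : ℕ) = _
  have e1 := psum_one dx
  have e2 : psum dx 2 = psum dx 1 + dx 1 := psum_succ dx 1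
  by_cases c1 : (q : ℕ) < psum dx 1
  · rw [Aent_b0 _ i.2 (by omega)]; rfl
  by_cases c2 : (q : ℕ) < psum dx 2
  · obtain ⟨q, hq⟩ := q
    simp only at c1 c2
    obtain ⟨t, rfl⟩ : ∃ t, q = psum dx 1 + t := ⟨q - psum dx 1, by omega⟩
    rw [Aent_a1 _ i.2 (by omega)]; rfl
  · rw [h2 i q (by omega)]
    exact Aent_hi _ (j := 0) (by have := i.2; omega) (by change psum dx 2 ≤ _; omega)

lemma ofM_B0 (h1 : ∀ i (q : Fin (dXt dx n)), (q : ℕ) < psum dx 1 → B0 i q = 0)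
    (h2 : ∀ i (q : Fin (dXt dx n)), psum dx 2 ≤ (q : ℕ) → B0 i q = 0) :
    B0V (ofM hn A0 A1 B0) = B0 := by
  ext i q
  change Bent _ (i : ℕ) (q : ℕ) = _
  have e2 : psum dx 2 = psum dx 1 + dx 1 := psum_succ dx 1
  by_cases c1 : (q : ℕ) < psum dx 1
  · rw [Bent_0 _ c1, h1 i q c1]
  by_cases c2 : (q : ℕ) < psum dx 2
  · obtain ⟨q, hq⟩ := q
    simp only at c1 c2
    obtain ⟨t, rfl⟩ : ∃ t, q = psum dx 1 + t := ⟨q - psum dx 1, by omega⟩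
    rw [Bent_a1 _ i.2 (by omega)]; rfl
  · rw [h2 i q (by omega)]
    exact Bent_hi _ (j := 0) (by have := i.2; omega) (by change psum dx 2 ≤ _; omega)

lemma ofM_A1 (h1 : ∀ j ≤ n, ∀ (i : Fin (dYt dy n)) (q : Fin (dXt dx n)), psum dy j ≤ (i : ℕ) →
      (q : ℕ) < psum dx (j + 1) → A1 i q = 0)
    (h2 : ∀ j < n, ∀ (i : Fin (dYt dy n)) (q : Fin (dXt dx n)), (i : ℕ) < psum dy j →
      psum dx (j + 2) ≤ (q : ℕ) → A1 i q = 0) :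
    A1V (ofM hn A0 A1 B0) = A1 := by
  ext i q
  change Aent _ (dy0 + (i : ℕ)) (q : ℕ) = _
  obtain ⟨l, hl, b1, b2⟩ := exists_blk dy (show (i : ℕ) < psum dy n from i.2)
  have e1 : psum dx (l + 2) = psum dx (l + 1) + dx (l + 1) := psum_succ dx (l + 1)
  have e2 : psum dx (l + 3) = psum dx (l + 2) + dx (l + 2) := psum_succ dx (l + 2)
  have e3 : psum dy (l + 1) = psum dy l + dy l := psum_succ dy l
  have hq : (q : ℕ) < psum dx (n + 1) := q.2
  by_cases c1 : (q : ℕ) < psum dx (l + 1)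
  · rw [h1 l hl.le i q b1 c1]
    exact Aent_lo _ (j := l) (by omega) c1
  obtain ⟨i, hi⟩ := i
  obtain ⟨q, hq'⟩ := q
  simp only at b1 b2 hq c1 ⊢
  obtain ⟨p, rfl⟩ : ∃ p, i = psum dy l + p := ⟨i - psum dy l, by omega⟩
  by_cases c2 : q < psum dx (l + 2)
  · obtain ⟨t, rfl⟩ : ∃ t, q = psum dx (l + 1) + t := ⟨q - psum dx (l + 1), by omega⟩
    rw [Aent_b _ hl (by omega) (by omega)]; rfl
  have d1 : l + 2 < n + 1 := lt_of_psum (f := dx) (by omega)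
  by_cases c3 : q < psum dx (l + 3)
  · obtain ⟨t, rfl⟩ : ∃ t, q = psum dx (l + 2) + t := ⟨q - psum dx (l + 2), by omega⟩
    rw [Aent_a _ (i := l) (by omega) (by omega) (by omega)]; rfl
  have d2 : l + 3 < n + 1 := lt_of_psum (f := dx) (by omega)
  rw [h2 (l + 1) (by omega) _ _ b2 (by change psum dx (l + 3) ≤ q; omega)]
  exact Aent_hi _ (j := l + 1) (by omega) (by change psum dx (l + 3) ≤ q; omega)
end build

theorem part_a (hn : 1 ≤ n) {m} (hm : m ∈ sTildeD k n dx dy dy0 dy0')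
    (h : FRel m (etaMat V)) : ∃ V' : QRep k n dx dy dy0 dy0', m = etaMat V' := by
  classical
  obtain ⟨A0, A1, B0, B1, hS⟩ := shape_sT hm
  have hV := shape_eta V
  have hB : B1 = A1 := rank_bad hS hV
    (h.all (i := dXt dx n - 0) (j := 2 * dXt dx n + dYt dy n + dy0 + dy0' + 0)
      (D_cut (i := 0) (by omega)) (L_cut (j := 0) (by omega)))
  subst hB
  have F1 : ∀ i (q : Fin (dXt dx n)), (q : ℕ) < psum dx 1 → B0 i q = 0 := by
    have H : Compat n dx dy (psum dx 1) (psum dy n) 0 0 := ⟨by omega, Or.inl ⟨rfl, rfl, rfl⟩⟩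
    have e := (iff_B hS hV H.hs H.hu H.hsu).1 (h.b _ (C_cut H))
    rw [RA_B0 V H rfl, Nat.le_zero, RA, fr_zero_iff] at e
    intro i q hq
    exact e (.inl i) q hq
  have F2 : ∀ j < n, ∀ q : Fin (dXt dx n), psum dx (j + 2) ≤ (q : ℕ) →
      (∀ i, A0 i q = 0) ∧ (∀ i, B0 i q = 0) ∧
        ∀ i : Fin (dYt dy n), (i : ℕ) < psum dy j → B1 i q = 0 := by
    intro j hj q hq
    have H : Compat n dx dy (psum dx (n + 1)) (psum dy j) j (j + 1) :=
      ⟨by omega, Or.inr ⟨rfl, rfl, rfl⟩⟩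
    have e := (iff_D hS hV (psum dx (j + 2)) H.hs H.hu H.hsu).1
      (h.all (D_cut (i := j + 2) (by omega)) (C_cut H))
    rw [RD_0 V H (by omega), Nat.le_zero, RD, fr_zero_iff] at e
    have hQ : ge' (psum dx (j + 2)) q ∧ lt' (psum dx (n + 1)) q := ⟨hq, q.2⟩
    refine ⟨fun i => e (.inl i) q hQ, fun i => e (.inr (.inl i)) q hQ, fun i hi => ?_⟩
    have := e (.inr (.inr i)) q hQ
    rw [Matrix.fromRows_apply_inr, Matrix.fromRows_apply_inr, rm, Matrix.of_apply,
      if_pos ((nge_iff i).2 hi)] at this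
    exact this
  have F3 : ∀ j ≤ n, ∀ (i : Fin (dYt dy n)) (q : Fin (dXt dx n)), psum dy j ≤ (i : ℕ) →
      (q : ℕ) < psum dx (j + 1) → B1 i q = 0 := by
    intro j hj i q hi hq
    have H : Compat n dx dy (psum dx (j + 1)) (psum dy n) j j :=
      ⟨by omega, Or.inl ⟨rfl, rfl, rfl⟩⟩
    have e := (iff_L hS hV (psum dy j) H.hs H.hu H.hsu).1
      (h.all (C_cut H) (L_cut (j := j) (by omega)))
    rw [RL_0 V H le_rfl, Nat.le_zero, RL, fr_zero_iff] at e
    have := e i (.inl q) hq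
    rw [Matrix.fromCols_apply_inl, rm, Matrix.of_apply,
      if_pos ⟨(nge_iff i).2 i.2, by simp only [lt']; omega⟩] at this
    exact this
  refine ⟨ofM hn A0 B1 B0, ?_⟩
  have hV' := shape_eta (ofM hn A0 B1 B0)
  rw [ofM_A0 hn (fun i q hq => (F2 0 (by omega) q hq).1 i),
    ofM_B0 hn F1 (fun i q hq => (F2 0 (by omega) q hq).2.1 i),
    ofM_A1 hn F3 (fun j hj i q hi hq => (F2 j hj q hq).2.2 i hi)] at hV'
  exact Shape.ext' hS hV'

lemma eta_unit : IsUnit (etaMat V) := (shape_eta V).unit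

lemma nec {x y : Matrix (Fin (NN n dx dy dy0 dy0')) (Fin (NN n dx dy dy0 dy0')) k}
    (h : x ∈ Zcl (orbitKP k n dx dy dy0 dy0' y)) : FRel x y := by
  rw [orbit_eq] at h
  exact necessity (TT_Pr _) cuts_0 h

lemma dn_eq_iff (hn : 1 ≤ n) : DnRel (· = ·) V W ↔ DnRel (· ≤ ·) V W ∧ DnRel (· ≤ ·) W V := by
  rw [dn_iff V W _ hn, dn_iff V W _ hn, dn_iff W V _ hn]
  constructor
  · intro h
    constructor
    · intro r c hc hrc
      obtain ⟨h1, h2, h3, h4, h5, h6, h7, h8⟩ := h r c hc hrc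
      exact ⟨h1.le, fun a => (h2 a).le, fun i a b => (h3 i a b).le, fun i a b => (h4 i a b).le,
        fun a => (h5 a).le, fun a => (h6 a).le, fun i a b => (h7 i a b).le, fun i a b => (h8 i a b).le⟩
    · intro r c hc hrc
      obtain ⟨h1, h2, h3, h4, h5, h6, h7, h8⟩ := h r c hc hrc
      exact ⟨h1.ge, fun a => (h2 a).ge, fun i a b => (h3 i a b).ge, fun i a b => (h4 i a b).ge,
        fun a => (h5 a).ge, fun a => (h6 a).ge, fun i a b => (h7 i a b).ge, fun i a b => (h8 i a b).ge⟩
  · rintro ⟨h, h'⟩ r c hc hrc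
    obtain ⟨h1, h2, h3, h4, h5, h6, h7, h8⟩ := h r c hc hrc
    obtain ⟨g1, g2, g3, g4, g5, g6, g7, g8⟩ := h' r c hc hrc
    exact ⟨le_antisymm h1 g1, fun a => le_antisymm (h2 a) (g2 a),
      fun i a b => le_antisymm (h3 i a b) (g3 i a b), fun i a b => le_antisymm (h4 i a b) (g4 i a b),
      fun a => le_antisymm (h5 a) (g5 a), fun a => le_antisymm (h6 a) (g6 a),
      fun i a b => le_antisymm (h7 i a b) (g7 i a b), fun i a b => le_antisymm (h8 i a b) (g8 i a b)⟩

lemma eta_orbit : etaMat V ∈ orbitKP k n dx dy dy0 dy0' (etaMat V) := by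
  rw [orbit_eq]; exact KP_self _ _ _

theorem part_b [Infinite k] (hn : 1 ≤ n) :
    (Zcl (orbitKP k n dx dy dy0 dy0' (etaMat V)) ∩ sTildeD k n dx dy dy0 dy0' ⊆
        Zcl (orbitKP k n dx dy dy0 dy0' (etaMat W))) ↔ DnRel (· ≤ ·) V W := by
  rw [dn_iff V W _ hn]
  constructor
  · intro h
    exact trans_mp V W (nec (h ⟨subset_Zcl _ (eta_orbit V), eta_sT V⟩))
  · intro h
    have := core_b (TT_Pr _) cuts_le cuts_0 cuts_N (eta_unit V) (eta_unit W) (trans_mpr V W h)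
    rw [orbit_eq, orbit_eq]
    exact fun x hx => Zcl_KP this hx.1

theorem part_c [Infinite k] (hn : 1 ≤ n) :
    ((orbitKP k n dx dy dy0 dy0' (etaMat V) ∩ sTildeD k n dx dy dy0 dy0' =
        orbitKP k n dx dy dy0 dy0' (etaMat W) ∩ sTildeD k n dx dy dy0 dy0') ↔
      DnRel (· = ·) V W) := by
  rw [dn_eq_iff V W hn, dn_iff V W _ hn, dn_iff W V _ hn]
  constructor
  · intro h
    have h1 : etaMat V ∈ orbitKP k n dx dy dy0 dy0' (etaMat W) ∩ sTildeD k n dx dy dy0 dy0' := by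
      rw [← h]; exact ⟨eta_orbit V, eta_sT V⟩
    have h2 : etaMat W ∈ orbitKP k n dx dy dy0 dy0' (etaMat V) ∩ sTildeD k n dx dy dy0 dy0' := by
      rw [h]; exact ⟨eta_orbit W, eta_sT W⟩
    exact ⟨trans_mp V W (nec (subset_Zcl _ h1.1)), trans_mp W V (nec (subset_Zcl _ h2.1))⟩
  · rintro ⟨h1, h2⟩
    have g1 := trans_mpr V W h1
    have g2 := trans_mpr W V h2
    have k1 := core_c (TT_Pr _) cuts_le cuts_0 cuts_N (eta_unit V) (eta_unit W) g1 g2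
    have k2 := core_c (TT_Pr _) cuts_le cuts_0 cuts_N (eta_unit W) (eta_unit V) g2 g1
    rw [orbit_eq, orbit_eq, Set.Subset.antisymm (KP_sub k1) (KP_sub k2)]

end fin
end FC

/-- Over an algebraically closed field: (a) every element of `S̃(d*)`
lying in the Zariski closure of `K·η(V)·P(d*)` is of the form `η(V')`;
(b) `Zcl(K·η(V)·P(d*)) ∩ S̃(d*) ⊆ Zcl(K·η(W)·P(d*))` iff `f(V) ≤ f(W)` for every
`f ∈ D_n`; (c) `(K·η(V)·P(d*)) ∩ S̃(d*) = (K·η(W)·P(d*)) ∩ S̃(d*)` iff `f(V) = f(W)` for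
every `f ∈ D_n`. -/
theorem stmt14 (k : Type) [Field k] [IsAlgClosed k] (n : ℕ) (hn : 1 ≤ n)
    (dx dy : ℕ → ℕ) (dy0 dy0' : ℕ) (V W : QRep k n dx dy dy0 dy0') :
    (∀ m ∈ sTildeD k n dx dy dy0 dy0',
      m ∈ Zcl (orbitKP k n dx dy dy0 dy0' (etaMat V)) →
      ∃ V' : QRep k n dx dy dy0 dy0', m = etaMat V') ∧
    ((Zcl (orbitKP k n dx dy dy0 dy0' (etaMat V)) ∩ sTildeD k n dx dy dy0 dy0' ⊆
        Zcl (orbitKP k n dx dy dy0 dy0' (etaMat W))) ↔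
      DnRel (· ≤ ·) V W) ∧
    ((orbitKP k n dx dy dy0 dy0' (etaMat V) ∩ sTildeD k n dx dy dy0 dy0' =
        orbitKP k n dx dy dy0 dy0' (etaMat W) ∩ sTildeD k n dx dy dy0 dy0') ↔
      DnRel (· = ·) V W) := by
  have : Infinite k := inferInstance
  exact ⟨fun m hm h => FC.part_a V hn hm (FC.nec h), FC.part_b V W hn, FC.part_c V W hn⟩
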